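/- arXiv:1408.3572 — 4 statements merged into one kernel-verified Lean document; each statement's English description precedes it below -/
import Mathlib

section
/- Let n ∈ ℤ, n ≥ 2. The set {s ∈ ℝ : the forward orbit 𝒪^ℕ_{T_n}([s]) is not dense in 𝕋, and s is well approximable} has Hausdorff dimension 1. -/
open MeasureTheory Matrix Filter Set
open scoped ENNReal

noncomputable section

/-- The circle `𝕋 = ℝ/ℤ`. -/
abbrev Circ := UnitAddCircle

/-- A real number `s` is badly approximable if `|s - p/q| ≥ c/q²` for some `c > 0` and
all rationals `p/q`. -/
def BadlyApproximable1 (s : ℝ) : Prop :=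
  ∃ c > 0, ∀ (p : ℤ) (q : ℕ), 0 < q → c / (q : ℝ) ^ 2 ≤ |s - (p : ℝ) / (q : ℝ)|

/-- `τ(m) ≤ C m ^ (1 / s)` for the number-of-divisors function `τ`. -/
theorem exists_card_divisors_le_rpow (s : ℕ) (hs : 1 ≤ s) :
    ∃ C : ℝ, 0 < C ∧ ∀ m : ℕ, m ≠ 0 → (m.divisors.card : ℝ) ≤ C * (m : ℝ) ^ (1 / (s : ℝ)) := by
  have hs0 : (0 : ℝ) < s := by exact_mod_cast hs
  have hs1 : (1 : ℝ) ≤ s := by exact_mod_cast hs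
  refine ⟨(2 * s : ℝ) ^ (2 ^ s : ℕ), by positivity, fun m hm => ?_⟩
  have hlarge : ∀ p v : ℕ, 2 ^ s ≤ p → ((v : ℝ) + 1) ≤ ((p : ℝ) ^ v) ^ (1 / (s : ℝ)) := by
    intro p v hp
    have h1 : ((2 : ℝ) ^ v) ≤ ((p : ℝ) ^ v) ^ (1 / (s : ℝ)) := by
      have : ((2 : ℝ) ^ v) = (((2 : ℝ) ^ s) ^ v) ^ (1 / (s : ℝ)) := by
        rw [← pow_mul, mul_comm, pow_mul, one_div, Real.pow_rpow_inv_natCast (by positivity) (by omega)]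
      rw [this]
      gcongr
      exact_mod_cast hp
    have h2 : ((v : ℝ) + 1) ≤ 2 ^ v := by exact_mod_cast Nat.lt_two_pow_self
    linarith
  have hsmall : ∀ p v : ℕ, 2 ≤ p → ((v : ℝ) + 1) ≤ (2 * s : ℝ) * ((p : ℝ) ^ v) ^ (1 / (s : ℝ)) := by
    intro p v hp
    have h1 : ((2 : ℝ) ^ v) ^ (1 / (s : ℝ)) ≤ ((p : ℝ) ^ v) ^ (1 / (s : ℝ)) := by
      gcongr
      exact_mod_cast hp
    have h2 : 1 + ((v : ℝ) / s) * Real.log 2 ≤ ((2 : ℝ) ^ v) ^ (1 / (s : ℝ)) := by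
      rw [← Real.rpow_natCast, ← Real.rpow_mul (by norm_num), Real.rpow_def_of_pos (by norm_num)]
      have := Real.add_one_le_exp (Real.log 2 * ((v : ℝ) * (1 / s)))
      have e : Real.log 2 * ((v : ℝ) * (1 / s)) = ((v : ℝ) / s) * Real.log 2 := by ring
      rw [e] at this ⊢
      linarith
    have h3 : (0.5 : ℝ) ≤ Real.log 2 := by linarith [Real.log_two_gt_d9]
    have h4 : ((v : ℝ) + 1) ≤ (2 * s : ℝ) * (1 + ((v : ℝ) / s) * Real.log 2) := by
      have : (2 * s : ℝ) * (1 + ((v : ℝ) / s) * Real.log 2) = 2 * s + 2 * v * Real.log 2 := by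
        field_simp
      rw [this]
      nlinarith [(Nat.cast_nonneg v : (0 : ℝ) ≤ v)]
    calc ((v : ℝ) + 1) ≤ _ := h4
      _ ≤ _ := by gcongr; exact h2.trans h1
  have hm' : (m : ℝ) ^ (1 / (s : ℝ)) =
      ∏ p ∈ m.primeFactors, ((p : ℝ) ^ (m.factorization p)) ^ (1 / (s : ℝ)) := by
    rw [Real.finsetProd_rpow _ _ (fun i _ => by positivity)]
    congr 1
    conv_lhs => rw [← Nat.prod_factorization_pow_eq_self hm]
    rw [Finsupp.prod]
    push_cast
    rfl
  rw [Nat.card_divisors hm, hm']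
  push_cast
  calc ∏ p ∈ m.primeFactors, ((m.factorization p : ℝ) + 1)
      ≤ ∏ p ∈ m.primeFactors, ((if p < 2 ^ s then (2 * s : ℝ) else 1) *
          ((p : ℝ) ^ (m.factorization p)) ^ (1 / (s : ℝ))) := by
        refine Finset.prod_le_prod (fun _ _ => by positivity) fun p hp => ?_
        split_ifs with h
        · exact hsmall _ _ (Nat.prime_of_mem_primeFactors hp).two_le
        · rw [one_mul]
          exact hlarge _ _ (not_lt.1 h)
    _ = (∏ p ∈ m.primeFactors, (if p < 2 ^ s then (2 * s : ℝ) else 1)) * _ :=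
        Finset.prod_mul_distrib
    _ ≤ _ := by
        gcongr
        rw [Finset.prod_ite, Finset.prod_const_one, mul_one, Finset.prod_const]
        refine pow_le_pow_right₀ (by linarith) ?_
        calc _ ≤ (Finset.range (2 ^ s)).card := Finset.card_le_card fun p hp => by
              simpa using (Finset.mem_filter.1 hp).2
          _ = _ := Finset.card_range _

/-- The number of multiples of `r` in `[Q, 2Q)` is at most `Q / r + 1`. -/
theorem card_filter_dvd_Ico_le (Q r : ℕ) (hr : 1 ≤ r) :
    (((Finset.Ico Q (2 * Q)).filter (r ∣ ·)).card : ℝ) ≤ (Q : ℝ) / r + 1 := by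
  have h1 : (((Finset.Ico Q (2 * Q)).filter (r ∣ ·)).card) ≤ Q / r + 1 := by
    have hmap : ∀ q ∈ (Finset.Ico Q (2 * Q)).filter (r ∣ ·),
        q / r ∈ Finset.Icc ((Q + r - 1) / r) ((2 * Q - 1) / r) := by
      intro q hq
      obtain ⟨hq, t, rfl⟩ := Finset.mem_filter.1 hq
      rw [Finset.mem_Ico] at hq
      rw [Finset.mem_Icc, Nat.mul_div_cancel_left _ hr]
      constructor
      · rw [← Nat.lt_succ_iff, Nat.div_lt_iff_lt_mul hr, Nat.succ_mul, mul_comm]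
        omega
      · rw [Nat.le_div_iff_mul_le hr, mul_comm]
        omega
    have hinj : Set.InjOn (· / r) ((Finset.Ico Q (2 * Q)).filter (r ∣ ·) : Set ℕ) := by
      intro a ha b hb hab
      have ha := (Finset.mem_filter.1 ha).2
      have hb := (Finset.mem_filter.1 hb).2
      exact (Nat.div_left_inj ha hb).1 hab
    refine (Finset.card_le_card_of_injOn _ hmap hinj).trans ?_
    rw [Nat.card_Icc]
    rcases Nat.eq_zero_or_pos Q with rfl | hQ
    · have : (0 + r - 1) / r = 0 := Nat.div_eq_of_lt (by omega)
      simp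
    have h2 : (2 * Q - 1) / r ≤ (Q + r - 1) / r + Q / r := by
      rw [← Nat.lt_succ_iff, Nat.div_lt_iff_lt_mul hr]
      have e1 := Nat.div_add_mod (Q + r - 1) r
      have e2 := Nat.mod_lt (Q + r - 1) hr
      have e3 := Nat.div_add_mod Q r
      have e4 := Nat.mod_lt Q hr
      have : ((Q + r - 1) / r + Q / r).succ * r =
        r * ((Q + r - 1) / r) + r * (Q / r) + r := by rw [Nat.succ_eq_add_one]; ring
      rw [this]
      omega
    generalize Q / r = x at *
    omega
  calc _ ≤ ((Q / r + 1 : ℕ) : ℝ) := by exact_mod_cast h1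
    _ ≤ _ := by
      push_cast
      gcongr
      exact Nat.cast_div_le

/-- Exchange of a sum over divisors of `q ∈ [Q, 2Q)`. -/
theorem sum_Ico_sum_divisors (Q : ℕ) (f : ℕ → ℝ) :
    ∑ q ∈ Finset.Ico Q (2 * Q), ∑ d ∈ q.divisors, f d =
      ∑ d ∈ Finset.Ico 1 (2 * Q), ((Finset.Ico Q (2 * Q)).filter (d ∣ ·)).card * f d := by
  have : ∀ d ∈ Finset.Ico 1 (2 * Q), ((Finset.Ico Q (2 * Q)).filter (d ∣ ·)).card * f d =
      ∑ q ∈ (Finset.Ico Q (2 * Q)).filter (d ∣ ·), f d := by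
    intro d _
    rw [Finset.sum_const, nsmul_eq_mul]
  rw [Finset.sum_congr rfl this]
  refine Finset.sum_comm' fun q d => ?_
  simp only [Finset.mem_Ico, Nat.mem_divisors, Finset.mem_filter]
  constructor
  · rintro ⟨h, hd, hq⟩
    have := Nat.le_of_dvd (by omega) hd
    have := Nat.pos_of_dvd_of_pos hd (by omega)
    exact ⟨⟨h, hd⟩, by omega, by omega⟩
  · rintro ⟨⟨h, hd⟩, _⟩
    exact ⟨h, hd, by omega⟩

/-- `∑_r ∑_h a(hr)` is controlled by `∑_m τ(m) a(m)`. -/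
theorem sum_sum_mul_le (R H : ℕ) (a : ℕ → ℝ) (ha : ∀ m, 0 ≤ a m) (D : ℝ) (hD₀ : 0 ≤ D)
    (hD : ∀ m, 1 ≤ m → m < R * (H + 1) → (m.divisors.card : ℝ) ≤ D) :
    ∑ r ∈ Finset.Ico 1 R, ∑ h ∈ Finset.Icc 1 H, a (h * r) ≤
      D * ∑ m ∈ Finset.range (R * (H + 1)), a m := by
  rw [← Finset.sum_product', Finset.mul_sum]
  have hmaps : ∀ x ∈ Finset.Ico 1 R ×ˢ Finset.Icc 1 H, x.2 * x.1 ∈ Finset.Ico 1 (R * (H + 1)) := by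
    rintro ⟨r, h⟩ hx
    simp only [Finset.mem_product, Finset.mem_Ico, Finset.mem_Icc] at hx ⊢
    constructor
    · nlinarith
    · nlinarith
  rw [← Finset.sum_fiberwise_of_maps_to hmaps]
  calc _ ≤ ∑ m ∈ Finset.Ico 1 (R * (H + 1)), D * a m := by
        refine Finset.sum_le_sum fun m hm => ?_
        have hc : ∀ x ∈ (Finset.Ico 1 R ×ˢ Finset.Icc 1 H).filter (fun x => x.2 * x.1 = m),
            a (x.2 * x.1) = a m := fun x hx => by rw [(Finset.mem_filter.1 hx).2]
        rw [Finset.sum_congr rfl hc, Finset.sum_const, nsmul_eq_mul]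
        refine mul_le_mul_of_nonneg_right ?_ (ha m)
        rw [Finset.mem_Ico] at hm
        refine le_trans ?_ (hD m hm.1 hm.2)
        norm_cast
        refine Finset.card_le_card_of_injOn (fun x => x.1) ?_ ?_
        · rintro ⟨r, h⟩ hx
          have hx := (Finset.mem_filter.1 hx).2
          simp only [Finset.mem_coe, Nat.mem_divisors]
          exact ⟨Dvd.intro_left h hx, by omega⟩
        · rintro ⟨r, h⟩ hx ⟨r', h'⟩ hx' hrr
          simp only [Finset.coe_filter, Set.mem_ofPred_eq, Finset.mem_product, Finset.mem_Ico] at hx hx'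
          simp only at hrr
          subst hrr
          have : h * r = h' * r := hx.2.trans hx'.2.symm
          rw [Nat.mul_right_cancel (by omega) this]
    _ ≤ _ := by
        exact Finset.sum_le_sum_of_subset_of_nonneg
          (fun m hm => Finset.mem_range.2 (Finset.mem_Ico.1 hm).2)
          fun m _ _ => mul_nonneg hD₀ (ha m)

/-- The `1`-periodic triangle function of height `1` supported on `‖y‖ ≤ δ`. -/
def tri (δ y : ℝ) : ℝ := max 0 (1 - |y - round y| / δ)

/-- The cosine coefficients of `tri δ`. -/
def triCoeff (δ : ℝ) (h : ℕ) : ℝ :=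
  (1 - Real.cos (2 * Real.pi * h * δ)) / (Real.pi ^ 2 * (h : ℝ) ^ 2 * δ)

/-- The partial sums of the Fourier series of `tri δ`. -/
def triPoly (δ : ℝ) (H : ℕ) (y : ℝ) : ℝ :=
  δ + ∑ h ∈ Finset.Icc 1 H, triCoeff δ h * Real.cos (2 * Real.pi * h * y)

theorem tri_nonneg (δ y : ℝ) : 0 ≤ tri δ y := le_max_left _ _

theorem tri_le_one {δ : ℝ} (hδ : 0 ≤ δ) (y : ℝ) : tri δ y ≤ 1 :=
  max_le zero_le_one (by have : 0 ≤ |y - round y| / δ := by positivity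
                         linarith)

theorem tri_pos_iff {δ : ℝ} (hδ : 0 < δ) (y : ℝ) : 0 < tri δ y ↔ |y - round y| < δ := by
  rw [tri, lt_max_iff, sub_pos, div_lt_one hδ]
  simp

theorem triCoeff_nonneg {δ : ℝ} (hδ : 0 ≤ δ) (h : ℕ) : 0 ≤ triCoeff δ h :=
  div_nonneg (by linarith [Real.cos_le_one (2 * Real.pi * h * δ)]) (by positivity)

theorem triCoeff_le {δ : ℝ} (hδ : 0 < δ) (h : ℕ) : triCoeff δ h ≤ 2 * δ := by
  rcases Nat.eq_zero_or_pos h with rfl | hh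
  · simp [triCoeff, hδ.le]
  have hh : (0 : ℝ) < h := by exact_mod_cast hh
  rw [triCoeff, div_le_iff₀ (by positivity)]
  have := Real.one_sub_sq_div_two_le_cos (x := 2 * Real.pi * h * δ)
  nlinarith

theorem triCoeff_le_inv {δ : ℝ} (hδ : 0 < δ) (h : ℕ) :
    triCoeff δ h ≤ ((h : ℝ) ^ 2)⁻¹ / δ := by
  rcases Nat.eq_zero_or_pos h with rfl | hh
  · simp [triCoeff]
  have hh : (0 : ℝ) < h := by exact_mod_cast hh
  rw [triCoeff, div_le_iff₀ (by positivity)]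
  have e : ((h : ℝ) ^ 2)⁻¹ / δ * (Real.pi ^ 2 * (h : ℝ) ^ 2 * δ) = Real.pi ^ 2 := by
    field_simp
  rw [e]
  nlinarith [Real.neg_one_le_cos (2 * Real.pi * h * δ), Real.pi_gt_three]

theorem hasSum_cos_div_sq {x : ℝ} (hx : x ∈ Icc (0 : ℝ) 1) :
    HasSum (fun h : ℕ => 1 / (h : ℝ) ^ 2 * Real.cos (2 * Real.pi * h * x))
      (Real.pi ^ 2 * (x ^ 2 - x + 1 / 6)) := by
  convert! hasSum_one_div_nat_pow_mul_cos one_ne_zero hx using 1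
  simp [Polynomial.bernoulli, Finset.sum_range_succ, bernoulli_two, bernoulli_one]
  ring

theorem hasSum_tri {δ : ℝ} (hδ : 0 < δ) (hδ' : δ ≤ 1 / 2) (y : ℝ) :
    HasSum (fun h : ℕ => triCoeff δ h * Real.cos (2 * Real.pi * h * y)) (tri δ y - δ) := by
  set v := |y - round y| with hv
  have hv0 : 0 ≤ v := abs_nonneg _
  have hv1 : v ≤ 1 / 2 := abs_sub_round y
  have hcos : ∀ h : ℕ, Real.cos (2 * Real.pi * h * y) = Real.cos (2 * Real.pi * h * v) := by
    intro h
    have : Real.cos (2 * Real.pi * h * v) = Real.cos (2 * Real.pi * h * (y - round y)) := by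
      rw [hv, ← Real.cos_abs (2 * Real.pi * h * (y - round y)), abs_mul,
        abs_of_nonneg (show (0 : ℝ) ≤ 2 * Real.pi * h by positivity)]
    rw [this]
    have e : 2 * Real.pi * h * (y - round y) =
        2 * Real.pi * h * y - ((h * round y : ℤ) : ℝ) * (2 * Real.pi) := by push_cast; ring
    rw [e, Real.cos_sub_int_mul_two_pi]
  have h1 := hasSum_cos_div_sq (x := v) ⟨hv0, by linarith⟩
  have h2 := hasSum_cos_div_sq (x := v + δ) ⟨by linarith, by linarith⟩
  have h3 := hasSum_cos_div_sq (x := |v - δ|) ⟨abs_nonneg _, abs_le.2 ⟨by linarith, by linarith⟩⟩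
  have h4 := ((h1.sub ((h2.add h3).mul_left (1 / 2))).mul_left (1 / (Real.pi ^ 2 * δ)))
  convert! h4 using 1
  · funext h
    rw [hcos]
    have e : Real.cos (2 * Real.pi * h * |v - δ|) = Real.cos (2 * Real.pi * h * (v - δ)) := by
      rw [← Real.cos_abs (2 * Real.pi * h * (v - δ)), abs_mul,
        abs_of_nonneg (show (0 : ℝ) ≤ 2 * Real.pi * h by positivity)]
    rw [e, mul_add _ v δ, mul_sub _ v δ, Real.cos_add, Real.cos_sub, triCoeff]
    rcases Nat.eq_zero_or_pos h with rfl | hh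
    · simp
    have hh : (0 : ℝ) < h := by exact_mod_cast hh
    field_simp
    ring
  · have hpi := Real.pi_ne_zero
    rw [tri, ← hv]
    rcases le_total δ v with h | h
    · have : (1 : ℝ) - v / δ ≤ 0 := by rw [sub_nonpos, one_le_div hδ]; exact h
      rw [max_eq_left this, abs_of_nonneg (sub_nonneg.2 h)]
      field_simp
      ring
    · have : (0 : ℝ) ≤ 1 - v / δ := by rw [sub_nonneg, div_le_one hδ]; exact h
      rw [max_eq_right this, abs_of_nonpos (sub_nonpos.2 h)]
      field_simp
      ring

theorem abs_triPoly_sub_tri_le {δ : ℝ} (hδ : 0 < δ) (hδ' : δ ≤ 1 / 2) {H : ℕ} (hH : 1 ≤ H)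
    (y : ℝ) : |triPoly δ H y - tri δ y| ≤ 1 / (H * δ) := by
  have hlim : Tendsto (fun n => |triPoly δ H y - triPoly δ n y|) atTop
      (nhds |triPoly δ H y - tri δ y|) := by
    have h1 : Tendsto (fun n => triPoly δ n y) atTop (nhds (tri δ y)) := by
      have h2 := ((hasSum_tri hδ hδ' y).tendsto_sum_nat.comp (tendsto_add_atTop_nat 1)).const_add δ
      rw [add_sub_cancel] at h2
      refine h2.congr fun n => ?_
      rw [triPoly, Function.comp_apply, Finset.sum_range_eq_add_Ico _ (by omega)]
      simp only [Nat.cast_zero, triCoeff]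
      rw [← Finset.Ico_add_one_right_eq_Icc]
      simp
    exact (h1.const_sub _).abs
  refine le_of_tendsto hlim (eventually_atTop.2 ⟨H, fun n hn => ?_⟩)
  have e : triPoly δ n y - triPoly δ H y =
      ∑ h ∈ Finset.Ioc H n, triCoeff δ h * Real.cos (2 * Real.pi * h * y) := by
    have h1 : ∀ m : ℕ, Finset.Icc 1 m = Finset.Ioc 0 m := fun m => by ext; simp; omega
    rw [triPoly, triPoly, h1, h1, ← Finset.sum_Ioc_consecutive _ (Nat.zero_le H) hn]
    ring
  rw [abs_sub_comm, e]
  calc _ ≤ ∑ h ∈ Finset.Ioc H n, ((h : ℝ) ^ 2)⁻¹ / δ := by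
        refine (Finset.abs_sum_le_sum_abs _ _).trans (Finset.sum_le_sum fun h _ => ?_)
        rw [abs_mul, abs_of_nonneg (triCoeff_nonneg hδ.le h)]
        calc _ ≤ triCoeff δ h * 1 :=
              mul_le_mul_of_nonneg_left (Real.abs_cos_le_one _) (triCoeff_nonneg hδ.le h)
          _ ≤ _ := by rw [mul_one]; exact triCoeff_le_inv hδ h
    _ ≤ _ := by
        rw [← Finset.sum_div]
        have h1 := sum_Ioc_inv_sq_le_sub (α := ℝ) (by omega : H ≠ 0) hn
        have h2 : (0 : ℝ) ≤ (n : ℝ)⁻¹ := by positivity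
        rw [one_div, mul_inv, div_eq_mul_inv]
        gcongr
        linarith

/-- `tri` at a point of a common multiple: if `d` divides both `q` and the integer closest to
`q x`, then `tri (δ / d) ((q / d) x) = tri δ (q x)`. -/
theorem tri_div {δ : ℝ} (hδ : 0 < δ) (hδ' : δ ≤ 1 / 2) {q d : ℕ} {x : ℝ} (hd : 1 ≤ d) (hdq : d ∣ q)
    (hda : (d : ℤ) ∣ round ((q : ℝ) * x)) (hx : |(q : ℝ) * x - round ((q : ℝ) * x)| < δ) :
    tri (δ / d) ((q / d : ℕ) * x) = tri δ (q * x) := by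
  obtain ⟨a, ha⟩ := hda
  obtain ⟨r, rfl⟩ := hdq
  have hd0 : (0 : ℝ) < d := by exact_mod_cast hd
  have hd1 : (1 : ℝ) ≤ d := by exact_mod_cast hd
  rw [Nat.mul_div_cancel_left _ hd]
  have e : ((d * r : ℕ) : ℝ) * x - round (((d * r : ℕ) : ℝ) * x) = d * (r * x - a) := by
    rw [ha]; push_cast; ring
  have hlt : |(r : ℝ) * x - a| < 1 / 2 := by
    rw [e, abs_mul, abs_of_pos hd0] at hx
    nlinarith [abs_nonneg ((r : ℝ) * x - a)]
  have hround : round ((r : ℝ) * x) = a := by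
    rw [round_eq, Int.floor_eq_iff]
    rw [abs_lt] at hlt
    constructor <;> linarith
  rw [tri, tri, hround, e, abs_mul, abs_of_pos hd0]
  congr 2
  field_simp

/-- The sign of the term `d` in the Bonferroni-type sieve. -/
def sieveSign (d : ℕ) : ℝ := if d = 1 then 1 else -1

/-- A minorant of the indicator function of `⋃_{Q ≤ q < 2Q} {‖q x‖ < δ}`. -/
theorem sum_sieveSign_mul_tri_le {Q : ℕ} (hQ : 1 ≤ Q) {δ : ℝ} (hδ : 0 < δ) (hδQ : 8 * Q * δ ≤ 1)
    (x : ℝ) :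
    ∑ q ∈ Finset.Ico Q (2 * Q), ∑ d ∈ q.divisors,
        sieveSign d * tri (δ / d) ((q / d : ℕ) * x) ≤
      {x : ℝ | ∃ q ∈ Finset.Ico Q (2 * Q), |(q : ℝ) * x - round ((q : ℝ) * x)| < δ}.indicator
        1 x := by
  have hQ1 : (1 : ℝ) ≤ Q := by exact_mod_cast hQ
  have hδ2 : δ ≤ 1 / 2 := by nlinarith
  set g : ℕ → ℝ := fun q => ∑ d ∈ q.divisors, sieveSign d * tri (δ / d) ((q / d : ℕ) * x) with hg
  have hsplit : ∀ q ∈ Finset.Ico Q (2 * Q),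
      g q = tri δ (q * x) - ∑ d ∈ q.divisors.erase 1, tri (δ / d) ((q / d : ℕ) * x) := by
    intro q hq
    have hq0 : q ≠ 0 := by have := (Finset.mem_Ico.1 hq).1; omega
    rw [hg]
    simp only
    rw [← Finset.add_sum_erase _ _ (Nat.one_mem_divisors.2 hq0), sub_eq_add_neg,
      ← Finset.sum_neg_distrib]
    congr 1
    · simp [sieveSign]
    · refine Finset.sum_congr rfl fun d hd => ?_
      rw [sieveSign, if_neg (Finset.ne_of_mem_erase hd)]
      ring
  have hle : ∀ q ∈ Finset.Ico Q (2 * Q), g q ≤ tri δ (q * x) := by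
    intro q hq
    rw [hsplit q hq]
    exact sub_le_self _ (Finset.sum_nonneg fun _ _ => tri_nonneg _ _)
  have hpos : ∀ q ∈ Finset.Ico Q (2 * Q), 0 < g q →
      |(q : ℝ) * x - round ((q : ℝ) * x)| < δ ∧ IsCoprime (round ((q : ℝ) * x)) (q : ℤ) := by
    intro q hq hgq
    have hq0 : q ≠ 0 := by have := (Finset.mem_Ico.1 hq).1; omega
    have h1 := (tri_pos_iff hδ _).1 (hgq.trans_le (hle q hq))
    refine ⟨h1, ?_⟩
    by_contra hcop
    rw [Int.isCoprime_iff_gcd_eq_one] at hcop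
    set d := Int.gcd (round ((q : ℝ) * x)) (q : ℤ) with hd
    have hdq : d ∣ q := by
      have := Int.gcd_dvd_right (round ((q : ℝ) * x)) (q : ℤ)
      exact_mod_cast this
    have hda : (d : ℤ) ∣ round ((q : ℝ) * x) := Int.gcd_dvd_left _ _
    have hd1 : 1 ≤ d := Nat.pos_of_dvd_of_pos hdq (Nat.pos_of_ne_zero hq0)
    have h2 := tri_div hδ hδ2 hd1 hdq hda h1
    have h3 : tri (δ / d) ((q / d : ℕ) * x) ≤
        ∑ d ∈ q.divisors.erase 1, tri (δ / d) ((q / d : ℕ) * x) :=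
      Finset.single_le_sum (f := fun d : ℕ => tri (δ / d) ((q / d : ℕ) * x))
        (fun _ _ => tri_nonneg _ _)
        (Finset.mem_erase.2 ⟨hcop, Nat.mem_divisors.2 ⟨hdq, hq0⟩⟩)
    have h4 := hsplit q hq
    linarith
  have huniq : ∀ q ∈ Finset.Ico Q (2 * Q), ∀ q' ∈ Finset.Ico Q (2 * Q), 0 < g q → 0 < g q' →
      q = q' := by
    intro q hq q' hq' h h'
    obtain ⟨h1, hc⟩ := hpos q hq h
    obtain ⟨h1', hc'⟩ := hpos q' hq' h'
    rw [Finset.mem_Ico] at hq hq'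
    set a := round ((q : ℝ) * x)
    set a' := round ((q' : ℝ) * x)
    have hqr : (q : ℝ) < 2 * Q := by exact_mod_cast hq.2
    have hqr' : (q' : ℝ) < 2 * Q := by exact_mod_cast hq'.2
    have hcross : a * q' = a' * q := by
      have hlt : |((a * q' - a' * q : ℤ) : ℝ)| < 1 := by
        have e : ((a * q' - a' * q : ℤ) : ℝ) = q * (q' * x - a') - q' * (q * x - a) := by
          push_cast; ring
        rw [e]
        calc _ ≤ |(q : ℝ) * (q' * x - a')| + |(q' : ℝ) * (q * x - a)| := abs_sub _ _
          _ = (q : ℝ) * |q' * x - a'| + (q' : ℝ) * |q * x - a| := by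
            rw [abs_mul, abs_mul, Nat.abs_cast, Nat.abs_cast]
          _ ≤ 2 * Q * δ + 2 * Q * δ := by gcongr
          _ < 1 := by linarith
      have : |a * q' - a' * q| < 1 := by exact_mod_cast hlt
      have := Int.abs_lt_one_iff.1 this
      linarith
    have d1 : (q : ℤ) ∣ q' := hc.symm.dvd_of_dvd_mul_left ⟨a', by rw [hcross]; ring⟩
    have d2 : (q' : ℤ) ∣ q := hc'.symm.dvd_of_dvd_mul_left ⟨a, by rw [← hcross]; ring⟩
    exact Nat.dvd_antisymm (by exact_mod_cast d1) (by exact_mod_cast d2)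
  by_cases hex : ∃ q ∈ Finset.Ico Q (2 * Q), 0 < g q
  · obtain ⟨q, hq, hgq⟩ := hex
    have hmem : x ∈ {x : ℝ | ∃ q ∈ Finset.Ico Q (2 * Q),
        |(q : ℝ) * x - round ((q : ℝ) * x)| < δ} := ⟨q, hq, (hpos q hq hgq).1⟩
    rw [Set.indicator_of_mem hmem, ← Finset.add_sum_erase _ _ hq]
    have h1 : ∑ q' ∈ (Finset.Ico Q (2 * Q)).erase q, g q' ≤ 0 := by
      refine Finset.sum_nonpos fun q' hq' => not_lt.1 fun h => ?_
      exact Finset.ne_of_mem_erase hq' (huniq q' (Finset.mem_of_mem_erase hq') q hq h hgq)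
    have h2 := (hle q hq).trans (tri_le_one hδ.le _)
    simp only [Pi.one_apply]
    linarith
  · push Not at hex
    exact (Finset.sum_nonpos hex).trans (Set.indicator_nonneg (fun _ _ => zero_le_one) _)

/-- The map sending `∑ dᵢ b⁻ⁱ` (base `b` digits) to `∑ dᵢ (b + 1)⁻ⁱ`, extended `1`-periodically.
Its image is a Cantor set of numbers whose base `b + 1` expansion omits the digit `b`. -/
def digitSpread (b : ℕ) (y : ℝ) : ℝ :=
  ∑' i : ℕ, (⌊(b : ℝ) * Int.fract ((b : ℝ) ^ i * y)⌋ : ℝ) / ((b : ℝ) + 1) ^ (i + 1)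

theorem floor_mul_fract_nonneg (b : ℕ) (y : ℝ) : 0 ≤ ⌊(b : ℝ) * Int.fract y⌋ :=
  Int.floor_nonneg.2 (by positivity)

theorem floor_mul_fract_le {b : ℕ} (hb : 1 ≤ b) (y : ℝ) :
    (⌊(b : ℝ) * Int.fract y⌋ : ℝ) ≤ b - 1 := by
  have hb0 : (0 : ℝ) < b := by exact_mod_cast hb
  have h : ⌊(b : ℝ) * Int.fract y⌋ < b := by
    rw [Int.floor_lt]
    push_cast
    nlinarith [Int.fract_lt_one y]
  have : ⌊(b : ℝ) * Int.fract y⌋ ≤ (b : ℤ) - 1 := by omega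
  exact_mod_cast this

theorem hasSum_geometric_spread {b : ℕ} (hb : 1 ≤ b) :
    HasSum (fun i : ℕ => ((b : ℝ) - 1) / ((b : ℝ) + 1) ^ (i + 1)) (1 - 1 / b) := by
  have hb0 : (0 : ℝ) < b := by exact_mod_cast hb
  have h := (hasSum_geometric_of_lt_one (r := 1 / ((b : ℝ) + 1)) (by positivity)
    (by rw [div_lt_one (by positivity)]; linarith)).mul_left (((b : ℝ) - 1) / (b + 1))
  convert! h using 1
  · funext i
    rw [pow_succ, one_div, inv_pow]
    field_simp
  · have e : 1 - 1 / ((b : ℝ) + 1) = b / (b + 1) := by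
      field_simp
      ring
    rw [e, inv_div]
    field_simp

theorem summable_digitSpread {b : ℕ} (hb : 1 ≤ b) (y : ℝ) :
    Summable fun i : ℕ =>
      (⌊(b : ℝ) * Int.fract ((b : ℝ) ^ i * y)⌋ : ℝ) / ((b : ℝ) + 1) ^ (i + 1) := by
  refine Summable.of_nonneg_of_le (fun i => ?_) (fun i => ?_) (hasSum_geometric_spread hb).summable
  · have : (0 : ℝ) ≤ ⌊(b : ℝ) * Int.fract ((b : ℝ) ^ i * y)⌋ := by
      exact_mod_cast floor_mul_fract_nonneg b _
    positivity
  · gcongr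
    exact floor_mul_fract_le hb _

theorem digitSpread_nonneg (b : ℕ) (y : ℝ) : 0 ≤ digitSpread b y := by
  refine tsum_nonneg fun i => ?_
  have : (0 : ℝ) ≤ ⌊(b : ℝ) * Int.fract ((b : ℝ) ^ i * y)⌋ := by
    exact_mod_cast floor_mul_fract_nonneg b _
  positivity

theorem digitSpread_le {b : ℕ} (hb : 1 ≤ b) (y : ℝ) : digitSpread b y ≤ 1 - 1 / b := by
  rw [← (hasSum_geometric_spread hb).tsum_eq]
  refine (summable_digitSpread hb y).tsum_le_tsum (fun i => ?_) (hasSum_geometric_spread hb).summable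
  gcongr
  exact floor_mul_fract_le hb _

theorem digitSpread_int_add (b : ℕ) (a : ℤ) (y : ℝ) : digitSpread b (a + y) = digitSpread b y := by
  unfold digitSpread
  congr 1
  funext i
  have e : (b : ℝ) ^ i * (a + y) = ((b ^ i * a : ℤ) : ℝ) + (b : ℝ) ^ i * y := by push_cast; ring
  rw [e, Int.fract_intCast_add]

theorem digitSpread_eq {b : ℕ} (hb : 1 ≤ b) (y : ℝ) :
    digitSpread b y = (⌊(b : ℝ) * Int.fract y⌋ + digitSpread b (b * y)) / (b + 1) := by
  have hb0 : (0 : ℝ) < b := by exact_mod_cast hb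
  rw [digitSpread, (summable_digitSpread hb y).tsum_eq_zero_add, digitSpread, add_div,
    ← tsum_div_const]
  congr 1
  · simp
  · congr 1
    funext i
    have e : (b : ℝ) ^ (i + 1) * y = (b : ℝ) ^ i * (b * y) := by ring
    rw [e, pow_succ _ (i + 1), div_div]

theorem measurable_digitSpread {b : ℕ} (hb : 1 ≤ b) : Measurable (digitSpread b) := by
  refine measurable_of_tendsto_metrizable (f := fun n y => ∑ i ∈ Finset.range n,
    (⌊(b : ℝ) * Int.fract ((b : ℝ) ^ i * y)⌋ : ℝ) / ((b : ℝ) + 1) ^ (i + 1)) (fun n => ?_) ?_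
  · refine Finset.measurable_sum _ fun i _ => ?_
    refine Measurable.div_const ?_ _
    exact (measurable_from_top (f := fun a : ℤ => (a : ℝ))).comp (Int.measurable_floor.comp
      ((measurable_fract.comp (measurable_id.const_mul _)).const_mul _))
  · rw [tendsto_pi_nhds]
    exact fun y => (summable_digitSpread hb y).hasSum.tendsto_sum_nat

theorem digitSpread_add_div {b : ℕ} (hb : 1 ≤ b) {d : ℕ} (hd : d < b) {z : ℝ} (hz : z ∈ Ico (0 : ℝ) 1) :
    digitSpread b ((d + z) / b) = (d + digitSpread b z) / (b + 1) := by
  have hb0 : (0 : ℝ) < b := by exact_mod_cast hb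
  have hd' : (d : ℝ) + 1 ≤ b := by exact_mod_cast hd
  have hfr : Int.fract ((d + z) / b) = (d + z) / b := by
    rw [Int.fract_eq_self]
    constructor
    · have := hz.1
      positivity
    · rw [div_lt_one hb0]
      linarith [hz.2]
  have hmul : (b : ℝ) * ((d + z) / b) = ((d : ℤ) : ℝ) + z := by
    field_simp
    push_cast
    ring
  rw [digitSpread_eq hb, hfr, hmul, digitSpread_int_add, Int.floor_intCast_add,
    Int.floor_eq_zero_iff.2 hz]
  simp

/-- On each `b`-adic interval, `digitSpread b` is an affine copy of itself. -/
theorem exists_digitSpread_affine {b : ℕ} (hb : 1 ≤ b) (k a : ℕ) :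
    ∃ x : ℝ, ∀ z ∈ Ico (0 : ℝ) 1,
      digitSpread b ((a + z) / (b : ℝ) ^ k) = x + digitSpread b z / ((b : ℝ) + 1) ^ k := by
  have hb0 : (0 : ℝ) < b := by exact_mod_cast hb
  induction k generalizing a with
  | zero =>
    refine ⟨0, fun z _ => ?_⟩
    have := digitSpread_int_add b a z
    simpa using this
  | succ k ih =>
    obtain ⟨x, hx⟩ := ih (a / b)
    refine ⟨x + ((a % b : ℕ) : ℝ) / ((b : ℝ) + 1) ^ (k + 1), fun z hz => ?_⟩
    have hmod : a % b < b := Nat.mod_lt _ hb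
    have hmod' : ((a % b : ℕ) : ℝ) + 1 ≤ b := by exact_mod_cast hmod
    have hz' : (((a % b : ℕ) : ℝ) + z) / b ∈ Ico (0 : ℝ) 1 := by
      constructor
      · have := hz.1
        positivity
      · rw [div_lt_one hb0]
        linarith [hz.2]
    have h := hx _ hz'
    rw [digitSpread_add_div hb hmod hz] at h
    have e : ((a : ℝ) + z) / (b : ℝ) ^ (k + 1) =
        (((a / b : ℕ) : ℝ) + (((a % b : ℕ) : ℝ) + z) / b) / (b : ℝ) ^ k := by
      have hab : (a : ℝ) = b * ((a / b : ℕ) : ℝ) + ((a % b : ℕ) : ℝ) := by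
        exact_mod_cast (Nat.div_add_mod a b).symm
      have hbk : (b : ℝ) ^ k ≠ 0 := by positivity
      rw [pow_succ]
      field_simp
      linarith
    rw [e, h, pow_succ]
    field_simp
    ring

theorem abs_sub_le_of_abs_digitSpread_sub_lt {b : ℕ} (hb : 1 ≤ b) (i : ℕ) {y y' : ℝ}
    (hy : y ∈ Ico (0 : ℝ) 1) (hy' : y' ∈ Ico (0 : ℝ) 1)
    (h : |digitSpread b y - digitSpread b y'| < 1 / ((b : ℝ) + 1) ^ (i + 1)) :
    |y - y'| ≤ 1 / (b : ℝ) ^ i := by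
  have hb0 : (0 : ℝ) < b := by exact_mod_cast hb
  have hb1 : (1 : ℝ) ≤ b := by exact_mod_cast hb
  induction i generalizing y y' with
  | zero =>
    rw [pow_zero, div_one, abs_le]
    constructor <;> linarith [hy.1, hy.2, hy'.1, hy'.2]
  | succ i ih =>
    have e1 := digitSpread_eq hb y
    have e2 := digitSpread_eq hb y'
    rw [Int.fract_eq_self.2 hy] at e1
    rw [Int.fract_eq_self.2 hy'] at e2
    have hfl : ⌊(b : ℝ) * y⌋ = ⌊(b : ℝ) * y'⌋ := by
      have hlt : |digitSpread b y - digitSpread b y'| < 1 / ((b : ℝ) + 1) ^ 2 := by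
        refine h.trans_le ?_
        gcongr
        · linarith
        · omega
      have hd : |((⌊(b : ℝ) * y⌋ - ⌊(b : ℝ) * y'⌋ : ℤ) : ℝ)| < 1 := by
        have e : ((⌊(b : ℝ) * y⌋ - ⌊(b : ℝ) * y'⌋ : ℤ) : ℝ) =
            (b + 1) * (digitSpread b y - digitSpread b y') -
              (digitSpread b (b * y) - digitSpread b (b * y')) := by
          rw [e1, e2]
          push_cast
          field_simp
          ring
        have h1 : |digitSpread b (b * y) - digitSpread b (b * y')| ≤ 1 - 1 / b := by
          rw [abs_le]
          constructor <;> linarith [digitSpread_nonneg b (b * y), digitSpread_nonneg b (b * y'),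
            digitSpread_le hb (b * y), digitSpread_le hb (b * y')]
        rw [e]
        calc _ ≤ |((b : ℝ) + 1) * (digitSpread b y - digitSpread b y')| +
              |digitSpread b (b * y) - digitSpread b (b * y')| := abs_sub _ _
          _ = ((b : ℝ) + 1) * |digitSpread b y - digitSpread b y'| +
              |digitSpread b (b * y) - digitSpread b (b * y')| := by
            rw [abs_mul, abs_of_pos (by positivity : (0 : ℝ) < b + 1)]
          _ < ((b : ℝ) + 1) * (1 / ((b : ℝ) + 1) ^ 2) + (1 - 1 / b) :=
            add_lt_add_of_lt_of_le (mul_lt_mul_of_pos_left hlt (by positivity)) h1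
          _ ≤ 1 := by
            have : ((b : ℝ) + 1) * (1 / ((b : ℝ) + 1) ^ 2) = 1 / (b + 1) := by field_simp
            have h2 : 1 / ((b : ℝ) + 1) ≤ 1 / b := by gcongr; linarith
            linarith
      have : |⌊(b : ℝ) * y⌋ - ⌊(b : ℝ) * y'⌋| < 1 := by exact_mod_cast hd
      have := Int.abs_lt_one_iff.1 this
      omega
    have hfract : ∀ z : ℝ, digitSpread b (Int.fract z) = digitSpread b z := by
      intro z
      conv_rhs => rw [← Int.floor_add_fract z, digitSpread_int_add]
    have h3 : |digitSpread b (Int.fract (b * y)) - digitSpread b (Int.fract (b * y'))| <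
        1 / ((b : ℝ) + 1) ^ (i + 1) := by
      rw [hfract, hfract]
      have e : digitSpread b (b * y) - digitSpread b (b * y') =
          (b + 1) * (digitSpread b y - digitSpread b y') := by
        rw [e1, e2, hfl]
        field_simp
        ring
      rw [e, abs_mul, abs_of_pos (by positivity : (0 : ℝ) < b + 1)]
      calc _ < ((b : ℝ) + 1) * (1 / ((b : ℝ) + 1) ^ (i + 1 + 1)) := by gcongr
        _ = _ := by rw [pow_succ _ (i + 1)]; field_simp
    have h4 := ih ⟨Int.fract_nonneg _, Int.fract_lt_one _⟩
      ⟨Int.fract_nonneg _, Int.fract_lt_one _⟩ h3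
    have e5 : Int.fract ((b : ℝ) * y) - Int.fract ((b : ℝ) * y') = b * (y - y') := by
      rw [Int.fract, Int.fract, hfl]
      ring
    rw [e5, abs_mul, abs_of_pos hb0] at h4
    rw [pow_succ, ← div_div, le_div_iff₀ hb0]
    linarith

/-- The inverse of `digitSpread b` on `[0, 1)` is Hölder. -/
theorem abs_sub_le_rpow_digitSpread {b : ℕ} (hb : 2 ≤ b) {y y' : ℝ}
    (hy : y ∈ Ico (0 : ℝ) 1) (hy' : y' ∈ Ico (0 : ℝ) 1) :
    |y - y'| ≤ (((b : ℝ) + 1) ^ 2 * |digitSpread b y - digitSpread b y'|) ^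
      (Real.log b / Real.log (b + 1)) := by
  have hb0 : (0 : ℝ) < b := by positivity
  have hb1 : (1 : ℝ) < b := by exact_mod_cast hb
  have hlog : 0 < Real.log b := Real.log_pos hb1
  have hlog' : 0 < Real.log (b + 1) := Real.log_pos (by linarith)
  set α := Real.log b / Real.log (b + 1)
  set t := |digitSpread b y - digitSpread b y'|
  have ht : 0 ≤ t := abs_nonneg _
  have hpow : ((b : ℝ) + 1) ^ α = b := by
    rw [Real.rpow_def_of_pos (by positivity), mul_div_cancel₀ _ hlog'.ne', Real.exp_log hb0]
  rcases ht.eq_or_lt with h0 | hpos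
  · have hle : ∀ i : ℕ, |y - y'| ≤ (1 / (b : ℝ)) ^ i := fun i => by
      rw [_root_.one_div_pow]
      exact abs_sub_le_of_abs_digitSpread_sub_lt (by omega) i hy hy' (by
        change t < _
        rw [← h0]
        positivity)
    have hlim := tendsto_pow_atTop_nhds_zero_of_lt_one (r := 1 / (b : ℝ)) (by positivity)
      (by rw [div_lt_one hb0]; exact hb1)
    have := ge_of_tendsto' hlim hle
    exact this.trans (by positivity)
  · by_cases hex : t < 1 / ((b : ℝ) + 1)
    · have hlim := tendsto_pow_atTop_nhds_zero_of_lt_one (r := 1 / ((b : ℝ) + 1)) (by positivity)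
        (by rw [div_lt_one (by positivity)]; linarith)
      have hex2 : ∃ j : ℕ, (1 / ((b : ℝ) + 1)) ^ j ≤ t :=
        ((hlim.eventually (gt_mem_nhds hpos)).exists).imp fun _ h => h.le
      classical
      set j := Nat.find hex2 with hj
      have hj1 : (1 / ((b : ℝ) + 1)) ^ j ≤ t := Nat.find_spec hex2
      have hj2 : 2 ≤ j := by
        by_contra hlt
        have : j = 0 ∨ j = 1 := by omega
        rcases this with h | h
        · rw [h, pow_zero] at hj1
          have : 1 / ((b : ℝ) + 1) < 1 := by rw [div_lt_one (by positivity)]; linarith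
          linarith
        · rw [h, pow_one] at hj1
          linarith
      obtain ⟨i, hi⟩ : ∃ i, j = i + 2 := ⟨j - 2, by omega⟩
      have hj3 : t < (1 / ((b : ℝ) + 1)) ^ (i + 1) := by
        have := Nat.find_min hex2 (m := i + 1) (by omega)
        exact not_le.1 this
      rw [_root_.one_div_pow] at hj3
      refine (abs_sub_le_of_abs_digitSpread_sub_lt (by omega) i hy hy' hj3).trans ?_
      rw [hi, _root_.one_div_pow, div_le_iff₀ (by positivity), pow_add] at hj1
      calc 1 / (b : ℝ) ^ i = (1 / ((b : ℝ) + 1) ^ i) ^ α := by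
            conv_lhs => rw [← hpow]
            rw [← Real.rpow_natCast, ← Real.rpow_natCast, ← Real.rpow_mul (by positivity), mul_comm α,
              Real.rpow_mul (by positivity), one_div, one_div, Real.inv_rpow (by positivity)]
        _ ≤ _ := by
            gcongr
            rw [div_le_iff₀ (by positivity)]
            linarith
    · rw [not_lt, div_le_iff₀ (by positivity)] at hex
      calc |y - y'| ≤ 1 := by
            rw [abs_le]
            constructor <;> linarith [hy.1, hy.2, hy'.1, hy'.2]
        _ ≤ _ := by
            refine Real.one_le_rpow ?_ (by positivity)
            nlinarith

/-- The additive character `x ↦ e^{2πix}`. -/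
def expI (x : ℝ) : ℂ := Complex.exp ((2 * Real.pi * x : ℝ) * Complex.I)

theorem norm_expI (x : ℝ) : ‖expI x‖ = 1 := Complex.norm_exp_ofReal_mul_I _

theorem expI_add (x y : ℝ) : expI (x + y) = expI x * expI y := by
  rw [expI, expI, expI, ← Complex.exp_add]
  congr 1
  push_cast
  ring

theorem expI_natCast (n : ℕ) : expI n = 1 := by
  rw [expI, Complex.exp_eq_one_iff]
  exact ⟨n, by push_cast; ring⟩

theorem expI_nat_mul (n : ℕ) (x : ℝ) : expI (n * x) = expI x ^ n := by
  rw [expI, expI, ← Complex.exp_nat_mul]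
  congr 1
  push_cast
  ring

theorem expI_re (x : ℝ) : (expI x).re = Real.cos (2 * Real.pi * x) :=
  Complex.exp_ofReal_mul_I_re _

theorem continuous_expI : Continuous expI := by
  unfold expI
  fun_prop

theorem norm_expI_sub_one (x : ℝ) : ‖expI x - 1‖ = 2 * |Real.sin (Real.pi * x)| := by
  rw [expI, mul_comm, Complex.norm_exp_I_mul_ofReal_sub_one, norm_mul, Real.norm_eq_abs,
    Real.norm_eq_abs, abs_two]
  congr 3
  ring

/-- The normalised Dirichlet kernel `b⁻¹ ∑_{d < b} e(dθ)`. -/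
def digitKernel (b : ℕ) (θ : ℝ) : ℂ := (b : ℂ)⁻¹ * ∑ d ∈ Finset.range b, expI (d * θ)

theorem norm_digitKernel_le_one (b : ℕ) (θ : ℝ) : ‖digitKernel b θ‖ ≤ 1 := by
  have h : ‖∑ d ∈ Finset.range b, expI (d * θ)‖ ≤ b := by
    refine (norm_sum_le _ _).trans ?_
    simp [norm_expI]
  rw [digitKernel, norm_mul, norm_inv, Complex.norm_natCast]
  rcases Nat.eq_zero_or_pos b with rfl | hb
  · simp
  · have : (0 : ℝ) < b := by exact_mod_cast hb
    rw [inv_mul_le_iff₀ this, mul_one]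
    exact h

theorem digitKernel_add_nat (b n : ℕ) (θ : ℝ) : digitKernel b (θ + n) = digitKernel b θ := by
  unfold digitKernel
  congr 1
  refine Finset.sum_congr rfl fun d _ => ?_
  have e : (d : ℝ) * (θ + n) = d * θ + ((d * n : ℕ) : ℝ) := by push_cast; ring
  rw [e, expI_add, expI_natCast, mul_one]

theorem two_mul_min_le_sin {θ : ℝ} (h0 : 0 ≤ θ) (h1 : θ ≤ 1) :
    2 * min θ (1 - θ) ≤ Real.sin (Real.pi * θ) := by
  have hpi := Real.pi_pos
  rcases le_total θ (1 / 2) with h | h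
  · rw [min_eq_left (by linarith)]
    have := Real.mul_le_sin (x := Real.pi * θ) (by positivity) (by nlinarith)
    rwa [← mul_assoc, div_mul_cancel₀ _ hpi.ne'] at this
  · rw [min_eq_right (by linarith)]
    have := Real.mul_le_sin (x := Real.pi * (1 - θ)) (mul_nonneg hpi.le (by linarith))
      (by nlinarith)
    rw [← mul_assoc, div_mul_cancel₀ _ hpi.ne'] at this
    rw [← Real.sin_pi_sub]
    convert! this using 2
    ring

theorem norm_digitKernel_le {b a : ℕ} (ha : 1 ≤ a) (hab : a < b) {u : ℝ} (hu : u ∈ Ico (0 : ℝ) 1) :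
    ‖digitKernel b ((a + u) / (b + 1))‖ ≤ 1 / a + 1 / (b - a : ℕ) := by
  have ha0 : (1 : ℝ) ≤ a := by exact_mod_cast ha
  have hab' : (a : ℝ) + 1 ≤ b := by exact_mod_cast hab
  rw [Nat.cast_sub hab.le]
  have hba : (0 : ℝ) < (b : ℝ) - a := by linarith
  have hb1 : (0 : ℝ) < (b : ℝ) + 1 := by linarith
  set θ := (a + u) / ((b : ℝ) + 1) with hθ
  have h0 : (a : ℝ) / (b + 1) ≤ θ := by
    rw [hθ]
    gcongr
    linarith [hu.1]
  have h1 : ((b : ℝ) - a) / (b + 1) ≤ 1 - θ := by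
    rw [hθ, le_sub_iff_add_le, ← add_div, div_le_one hb1]
    linarith [hu.2]
  have hm : 0 < min (a : ℝ) (b - a) := lt_min (by linarith) hba
  have hmin : min (a : ℝ) (b - a) / (b + 1) ≤ min θ (1 - θ) :=
    le_min ((div_le_div_of_nonneg_right (min_le_left _ _) hb1.le).trans h0)
      ((div_le_div_of_nonneg_right (min_le_right _ _) hb1.le).trans h1)
  have hsin : 2 * (min (a : ℝ) (b - a) / (b + 1)) ≤ Real.sin (Real.pi * θ) := by
    refine (mul_le_mul_of_nonneg_left hmin two_pos.le).trans (two_mul_min_le_sin ?_ ?_)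
    · exact le_trans (by positivity) h0
    · have : 0 ≤ ((b : ℝ) - a) / (b + 1) := by positivity
      linarith
  have hsinpos : 0 < Real.sin (Real.pi * θ) := lt_of_lt_of_le (by positivity) hsin
  have hgeom : (∑ d ∈ Finset.range b, expI (d * θ)) * (expI θ - 1) = expI (b * θ) - 1 := by
    simp_rw [expI_nat_mul]
    exact geom_sum_mul _ _
  have hnorm : ‖∑ d ∈ Finset.range b, expI (d * θ)‖ * Real.sin (Real.pi * θ) ≤ 1 := by
    have h := congrArg norm hgeom
    rw [norm_mul, norm_expI_sub_one, norm_expI_sub_one, abs_of_pos hsinpos] at h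
    linarith [Real.abs_sin_le_one (Real.pi * (b * θ))]
  have hbound : ‖∑ d ∈ Finset.range b, expI (d * θ)‖ * (2 * min (a : ℝ) (b - a)) ≤ b + 1 := by
    have := (mul_le_mul_of_nonneg_left hsin (norm_nonneg _)).trans hnorm
    rw [← mul_div_assoc, ← mul_div_assoc, div_le_one hb1] at this
    exact this
  rw [digitKernel, norm_mul, norm_inv, Complex.norm_natCast]
  have hb0 : (0 : ℝ) < b := by linarith
  have hfin : (b : ℝ)⁻¹ * ‖∑ d ∈ Finset.range b, expI (d * θ)‖ ≤ 1 / min (a : ℝ) (b - a) := by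
    rw [inv_mul_le_iff₀ hb0, mul_one_div, le_div_iff₀ hm]
    linarith
  refine hfin.trans ?_
  have p1 : 0 < 1 / (a : ℝ) := by positivity
  have p2 : 0 < 1 / ((b : ℝ) - a) := by positivity
  rcases min_choice (a : ℝ) (b - a) with h | h <;> rw [h] <;> linarith

/-- An `ℓ¹` bound for the kernel along a shifted set of `(b + 1)`-th roots of unity. -/
theorem sum_norm_digitKernel_le {b : ℕ} (hb : 1 ≤ b) {u : ℝ} (hu : u ∈ Ico (0 : ℝ) 1) :
    ∑ a ∈ Finset.range (b + 1), ‖digitKernel b ((a + u) / (b + 1))‖ ≤ 4 + 2 * Real.log b := by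
  have hharm : ∑ a ∈ Finset.Ico 1 b, (1 / a : ℝ) ≤ 1 + Real.log b := by
    refine le_trans ?_ (harmonic_le_one_add_log b)
    rw [harmonic_eq_sum_Icc]
    push_cast
    simp_rw [one_div]
    refine Finset.sum_le_sum_of_subset_of_nonneg (fun x hx => ?_) fun _ _ _ => by positivity
    simp only [Finset.mem_Ico, Finset.mem_Icc] at hx ⊢
    omega
  have hrefl : ∑ a ∈ Finset.Ico 1 b, (1 / (b - a : ℕ) : ℝ) = ∑ a ∈ Finset.Ico 1 b, (1 / a : ℝ) := by
    have := Finset.sum_Ico_reflect (fun a : ℕ => (1 / a : ℝ)) 1 (m := b) (n := b) (by omega)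
    rw [this]
    simp
  rw [Finset.sum_range_succ, Finset.range_eq_Ico, Finset.sum_eq_sum_Ico_succ_bot (by omega)]
  have hsum := Finset.sum_le_sum (s := Finset.Ico (0 + 1) b) fun a ha =>
    norm_digitKernel_le (Finset.mem_Ico.1 ha).1 (Finset.mem_Ico.1 ha).2 hu
  rw [Finset.sum_add_distrib, zero_add, hrefl] at hsum
  have h1 := norm_digitKernel_le_one b (((0 : ℕ) + u) / (b + 1))
  have h2 := norm_digitKernel_le_one b ((b + u) / (b + 1))
  rw [zero_add]
  linarith

theorem sum_range_mul_eq {M : Type*} [AddCommMonoid M] (A n : ℕ) (f : ℕ → M) :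
    ∑ m ∈ Finset.range (A * n), f m =
      ∑ r ∈ Finset.range A, ∑ a ∈ Finset.range n, f (r + A * a) := by
  rw [Finset.sum_comm]
  induction n with
  | zero => simp
  | succ n ih =>
    rw [Nat.mul_succ, Finset.sum_range_add, ih, Finset.sum_range_succ]
    simp_rw [add_comm]

/-- Frequency-averaged decay of the products of kernels. -/
theorem sum_prod_norm_digitKernel_le {b : ℕ} (hb : 1 ≤ b) {k K : ℕ} (hkK : k ≤ K) :
    ∑ m ∈ Finset.range ((b + 1) ^ K),
        ∏ i ∈ Finset.Ico k K, ‖digitKernel b (m / ((b : ℝ) + 1) ^ (i + 1))‖ ≤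
      ((b : ℝ) + 1) ^ k * (4 + 2 * Real.log b) ^ (K - k) := by
  have hb1 : (0 : ℝ) < (b : ℝ) + 1 := by positivity
  have hS : 0 ≤ 4 + 2 * Real.log b := by
    have := Real.log_nonneg (x := b) (by exact_mod_cast hb)
    linarith
  induction K, hkK using Nat.le_induction with
  | base => simp
  | succ K hkK ih =>
    rw [pow_succ, sum_range_mul_eq]
    calc _ = ∑ r ∈ Finset.range ((b + 1) ^ K),
          (∏ i ∈ Finset.Ico k K, ‖digitKernel b (r / ((b : ℝ) + 1) ^ (i + 1))‖) *
            ∑ a ∈ Finset.range (b + 1),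
              ‖digitKernel b ((a + r / ((b : ℝ) + 1) ^ K) / (b + 1))‖ := by
          refine Finset.sum_congr rfl fun r _ => ?_
          rw [Finset.mul_sum]
          refine Finset.sum_congr rfl fun a _ => ?_
          rw [Finset.prod_Ico_succ_top hkK]
          congr 1
          · refine Finset.prod_congr rfl fun i hi => ?_
            have hi := (Finset.mem_Ico.1 hi).2
            obtain ⟨l, rfl⟩ : ∃ l, K = i + 1 + l := ⟨K - (i + 1), by omega⟩
            rw [← digitKernel_add_nat b ((b + 1) ^ l * a) (r / _)]
            congr 2
            push_cast
            rw [pow_add]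
            field_simp
          · congr 2
            push_cast
            rw [pow_succ]
            field_simp
            ring
      _ ≤ ∑ r ∈ Finset.range ((b + 1) ^ K),
          (∏ i ∈ Finset.Ico k K, ‖digitKernel b (r / ((b : ℝ) + 1) ^ (i + 1))‖) *
            (4 + 2 * Real.log b) := by
          refine Finset.sum_le_sum fun r hr => mul_le_mul_of_nonneg_left ?_
            (Finset.prod_nonneg fun _ _ => norm_nonneg _)
          refine sum_norm_digitKernel_le hb ⟨by positivity, ?_⟩
          rw [div_lt_one (by positivity)]
          exact_mod_cast Finset.mem_range.1 hr
      _ ≤ (((b : ℝ) + 1) ^ k * (4 + 2 * Real.log b) ^ (K - k)) * (4 + 2 * Real.log b) := by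
          rw [← Finset.sum_mul]
          exact mul_le_mul_of_nonneg_right ih hS
      _ = _ := by
          rw [Nat.succ_sub hkK, pow_succ, mul_assoc]

/-- The characteristic function of the distribution of `digitSpread b` on `[0, 1)`. -/
def spreadChar (b : ℕ) (t : ℝ) : ℂ := ∫ y in (0 : ℝ)..1, expI (t * digitSpread b y)

theorem intervalIntegrable_expI_digitSpread {b : ℕ} (hb : 1 ≤ b) (t u v : ℝ) :
    IntervalIntegrable (fun y => expI (t * digitSpread b y)) volume u v := by
  rw [intervalIntegrable_iff]
  refine Measure.integrableOn_of_bounded (M := 1) (by simp) ?_ (by simp [norm_expI])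
  exact (continuous_expI.measurable.comp
    ((measurable_digitSpread hb).const_mul t)).aestronglyMeasurable

theorem norm_spreadChar_le_one (b : ℕ) (t : ℝ) : ‖spreadChar b t‖ ≤ 1 := by
  have := intervalIntegral.norm_integral_le_of_norm_le_const (a := 0) (b := 1) (C := 1)
    (f := fun y => expI (t * digitSpread b y)) (fun x _ => (norm_expI _).le)
  simpa [spreadChar] using this

theorem integral_div_pow {E : Type*} [NormedAddCommGroup E] [NormedSpace ℝ E] {B : ℝ} (hB : B ≠ 0)
    (a : ℝ) (f : ℝ → E) :
    ∫ y in (a / B)..((a + 1) / B), f y = B⁻¹ • ∫ z in (0 : ℝ)..1, f ((a + z) / B) := by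
  have h := intervalIntegral.integral_comp_add_div (a := 0) (b := 1) f hB (a / B)
  simp_rw [add_div]
  rw [h, inv_smul_smul₀ hB]
  simp

theorem spreadChar_eq {b : ℕ} (hb : 1 ≤ b) (t : ℝ) :
    spreadChar b t = digitKernel b (t / (b + 1)) * spreadChar b (t / (b + 1)) := by
  have hb0 : (b : ℝ) ≠ 0 := by positivity
  have h := intervalIntegral.sum_integral_adjacent_intervals (μ := volume) (n := b)
    (a := fun i : ℕ => (i : ℝ) / b) (f := fun y => expI (t * digitSpread b y))
    (fun i _ => intervalIntegrable_expI_digitSpread hb t _ _)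
  simp only [Nat.cast_zero, zero_div, div_self hb0] at h
  rw [spreadChar, ← h, digitKernel, mul_assoc, Finset.sum_mul, Finset.mul_sum]
  refine Finset.sum_congr rfl fun d hd => ?_
  push_cast
  rw [integral_div_pow hb0, spreadChar, ← intervalIntegral.integral_const_mul, Complex.real_smul]
  push_cast
  congr 1
  refine intervalIntegral.integral_congr_Ioo_of_le zero_le_one fun z hz => ?_
  rw [digitSpread_add_div hb (Finset.mem_range.1 hd) (Ioo_subset_Ico_self hz), ← expI_add]
  congr 1
  field_simp

theorem norm_spreadChar_le_prod {b : ℕ} (hb : 1 ≤ b) (t : ℝ) {k K : ℕ} (hkK : k ≤ K) :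
    ‖spreadChar b (t / ((b : ℝ) + 1) ^ k)‖ ≤
      ∏ i ∈ Finset.Ico k K, ‖digitKernel b (t / ((b : ℝ) + 1) ^ (i + 1))‖ := by
  suffices h : ‖spreadChar b (t / ((b : ℝ) + 1) ^ k)‖ =
      (∏ i ∈ Finset.Ico k K, ‖digitKernel b (t / ((b : ℝ) + 1) ^ (i + 1))‖) *
        ‖spreadChar b (t / ((b : ℝ) + 1) ^ K)‖ by
    rw [h]
    exact mul_le_of_le_one_right (Finset.prod_nonneg fun _ _ => norm_nonneg _)
      (norm_spreadChar_le_one _ _)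
  induction K, hkK using Nat.le_induction with
  | base => simp
  | succ K hkK ih =>
    rw [Finset.prod_Ico_succ_top hkK, ih, spreadChar_eq hb, norm_mul, div_div, ← pow_succ, mul_assoc]

/-- Average decay of the characteristic function over the frequencies below `(b + 1) ^ K`. -/
theorem sum_norm_spreadChar_le {b : ℕ} (hb : 1 ≤ b) {k K : ℕ} (hkK : k ≤ K) :
    ∑ m ∈ Finset.range ((b + 1) ^ K), ‖spreadChar b (m / ((b : ℝ) + 1) ^ k)‖ ≤
      ((b : ℝ) + 1) ^ k * (4 + 2 * Real.log b) ^ (K - k) :=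
  (Finset.sum_le_sum fun (m : ℕ) _ => norm_spreadChar_le_prod hb (m : ℝ) hkK).trans
    (sum_prod_norm_digitKernel_le hb hkK)

theorem abs_integral_cos_digitSpread_le {b : ℕ} (hb : 1 ≤ b) (k a : ℕ) (t : ℝ) :
    |∫ y in ((a : ℝ) / (b : ℝ) ^ k)..((a + 1) / (b : ℝ) ^ k),
        Real.cos (2 * Real.pi * (t * digitSpread b y))| ≤
      ((b : ℝ) ^ k)⁻¹ * ‖spreadChar b (t / ((b : ℝ) + 1) ^ k)‖ := by
  have hB : (0 : ℝ) < (b : ℝ) ^ k := by positivity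
  obtain ⟨x, hx⟩ := exists_digitSpread_affine hb k a
  have h1 : ∫ y in ((a : ℝ) / (b : ℝ) ^ k)..((a + 1) / (b : ℝ) ^ k), expI (t * digitSpread b y) =
      ((b : ℝ) ^ k)⁻¹ • (expI (t * x) * spreadChar b (t / ((b : ℝ) + 1) ^ k)) := by
    rw [integral_div_pow hB.ne', spreadChar, ← intervalIntegral.integral_const_mul]
    congr 1
    refine intervalIntegral.integral_congr_Ioo_of_le zero_le_one fun z hz => ?_
    rw [hx z (Ioo_subset_Ico_self hz), ← expI_add]
    congr 1
    field_simp
  have h2 : ∫ y in ((a : ℝ) / (b : ℝ) ^ k)..((a + 1) / (b : ℝ) ^ k),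
      Real.cos (2 * Real.pi * (t * digitSpread b y)) =
      (∫ y in ((a : ℝ) / (b : ℝ) ^ k)..((a + 1) / (b : ℝ) ^ k), expI (t * digitSpread b y)).re := by
    simp_rw [← expI_re]
    exact Complex.reCLM.intervalIntegral_comp_comm (intervalIntegrable_expI_digitSpread hb t _ _)
  rw [h2, h1]
  refine (Complex.abs_re_le_norm _).trans ?_
  rw [norm_smul, norm_mul, norm_expI, one_mul, norm_inv, Real.norm_of_nonneg hB.le]

theorem intervalIntegrable_finsetSum {ι : Type*} (s : Finset ι) {f : ι → ℝ → ℝ} {u v : ℝ}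
    (h : ∀ i ∈ s, IntervalIntegrable (f i) volume u v) :
    IntervalIntegrable (fun y => ∑ i ∈ s, f i y) volume u v := by
  simpa only [Finset.sum_fn] using IntervalIntegrable.sum s h

theorem abs_sieveSign (d : ℕ) : |sieveSign d| = 1 := by
  unfold sieveSign
  split_ifs <;> simp

theorem intervalIntegrable_cos_digitSpread {b : ℕ} (hb : 1 ≤ b) (t u v : ℝ) :
    IntervalIntegrable (fun y => Real.cos (2 * Real.pi * (t * digitSpread b y))) volume u v := by
  rw [intervalIntegrable_iff]
  refine Measure.integrableOn_of_bounded (M := 1) (by simp) ?_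
    (Eventually.of_forall fun _ => Real.abs_cos_le_one _)
  exact (Real.measurable_cos.comp
    (((measurable_digitSpread hb).const_mul t).const_mul _)).aestronglyMeasurable

theorem integrable_triPoly_digitSpread {b : ℕ} (hb : 1 ≤ b) (δ : ℝ) (H r : ℕ) (u v : ℝ) :
    IntervalIntegrable (fun y => triPoly δ H (r * digitSpread b y)) volume u v := by
  unfold triPoly
  refine intervalIntegrable_const.add (intervalIntegrable_finsetSum _ fun h _ => ?_)
  have := (intervalIntegrable_cos_digitSpread hb (h * r) u v).const_mul (triCoeff δ h)
  convert! this using 4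
  ring

theorem abs_integral_triPoly_sub_le {b : ℕ} (hb : 1 ≤ b) {δ : ℝ} (hδ : 0 ≤ δ) (H r k a : ℕ) :
    |(∫ y in ((a : ℝ) / (b : ℝ) ^ k)..((a + 1) / (b : ℝ) ^ k),
        triPoly δ H (r * digitSpread b y)) - ((b : ℝ) ^ k)⁻¹ * δ| ≤
      ((b : ℝ) ^ k)⁻¹ * ∑ h ∈ Finset.Icc 1 H,
        triCoeff δ h * ‖spreadChar b ((h * r : ℕ) / ((b : ℝ) + 1) ^ k)‖ := by
  have hcos : ∀ h : ℕ, IntervalIntegrable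
      (fun y => triCoeff δ h * Real.cos (2 * Real.pi * h * (r * digitSpread b y))) volume
      ((a : ℝ) / (b : ℝ) ^ k) ((a + 1) / (b : ℝ) ^ k) := fun h => by
    have := (intervalIntegrable_cos_digitSpread hb (h * r)
      ((a : ℝ) / (b : ℝ) ^ k) ((a + 1) / (b : ℝ) ^ k)).const_mul (triCoeff δ h)
    convert! this using 4
    ring
  have e : (∫ y in ((a : ℝ) / (b : ℝ) ^ k)..((a + 1) / (b : ℝ) ^ k),
        triPoly δ H (r * digitSpread b y)) = ((b : ℝ) ^ k)⁻¹ * δ + ∑ h ∈ Finset.Icc 1 H,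
        triCoeff δ h * ∫ y in ((a : ℝ) / (b : ℝ) ^ k)..((a + 1) / (b : ℝ) ^ k),
          Real.cos (2 * Real.pi * ((h * r : ℕ) * digitSpread b y)) := by
    unfold triPoly
    rw [intervalIntegral.integral_add intervalIntegrable_const
      (intervalIntegrable_finsetSum _ fun h _ => hcos h),
      intervalIntegral.integral_finsetSum fun h _ => hcos h]
    congr 1
    · rw [intervalIntegral.integral_const, smul_eq_mul]
      ring
    · refine Finset.sum_congr rfl fun h _ => ?_
      rw [← intervalIntegral.integral_const_mul]
      congr 1
      funext y
      push_cast
      congr 2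
      ring
  rw [e, add_sub_cancel_left, Finset.mul_sum]
  refine (Finset.abs_sum_le_sum_abs _ _).trans (Finset.sum_le_sum fun h _ => ?_)
  rw [abs_mul, abs_of_nonneg (triCoeff_nonneg hδ h), mul_left_comm]
  exact mul_le_mul_of_nonneg_left (abs_integral_cos_digitSpread_le hb k a _) (triCoeff_nonneg hδ h)

/-- The reals within `δ / q` of a rational with denominator `q ∈ [Q, 2Q)`. -/
def dyadicApprox (Q : ℕ) (δ : ℝ) : Set ℝ :=
  {x : ℝ | ∃ q ∈ Finset.Ico Q (2 * Q), |(q : ℝ) * x - round ((q : ℝ) * x)| < δ}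

theorem measurableSet_dyadicApprox (Q : ℕ) (δ : ℝ) : MeasurableSet (dyadicApprox Q δ) := by
  have e : dyadicApprox Q δ = ⋃ q ∈ Finset.Ico Q (2 * Q),
      {x : ℝ | |(q : ℝ) * x - round ((q : ℝ) * x)| < δ} := by
    ext x
    simp [dyadicApprox]
  rw [e]
  refine Finset.measurableSet_biUnion _ fun q _ => measurableSet_lt ?_ measurable_const
  simp_rw [abs_sub_round_eq_min]
  have hf : Measurable fun x : ℝ => Int.fract ((q : ℝ) * x) :=
    measurable_fract.comp (measurable_id.const_mul _)
  exact hf.min (measurable_const.sub hf)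

theorem le_integral_indicator_dyadicApprox {b : ℕ} (hb : 1 ≤ b) {Q H : ℕ} (hQ : 1 ≤ Q) (hH : 1 ≤ H)
    {δ : ℝ} (hδ : 0 < δ) (hδQ : 8 * Q * δ ≤ 1) (k a : ℕ) :
    ((b : ℝ) ^ k)⁻¹ * ∑ q ∈ Finset.Ico Q (2 * Q), ∑ d ∈ q.divisors,
        (sieveSign d * (δ / d) -
          (∑ h ∈ Finset.Icc 1 H, triCoeff (δ / d) h *
            ‖spreadChar b ((h * (q / d) : ℕ) / ((b : ℝ) + 1) ^ k)‖) - 1 / (H * (δ / d))) ≤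
      ∫ y in ((a : ℝ) / (b : ℝ) ^ k)..((a + 1) / (b : ℝ) ^ k),
        (dyadicApprox Q δ).indicator 1 (digitSpread b y) := by
  have hb0 : (0 : ℝ) < b := by positivity
  have hB : (0 : ℝ) < (b : ℝ) ^ k := by positivity
  have hle : (a : ℝ) / (b : ℝ) ^ k ≤ (a + 1) / (b : ℝ) ^ k := by gcongr; linarith
  have hQ1 : (1 : ℝ) ≤ Q := by exact_mod_cast hQ
  have hδ2 : δ ≤ 1 / 2 := by nlinarith
  set F : ℕ → ℕ → ℝ → ℝ := fun q d y =>
    sieveSign d * triPoly (δ / d) H ((q / d : ℕ) * digitSpread b y) - 1 / (H * (δ / d)) with hF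
  have hFint : ∀ q d, IntervalIntegrable (F q d) volume
      ((a : ℝ) / (b : ℝ) ^ k) ((a + 1) / (b : ℝ) ^ k) := fun q d =>
    ((integrable_triPoly_digitSpread hb _ _ _ _ _).const_mul _).sub intervalIntegrable_const
  have hFle : ∀ y, ∑ q ∈ Finset.Ico Q (2 * Q), ∑ d ∈ q.divisors, F q d y ≤
      (dyadicApprox Q δ).indicator 1 (digitSpread b y) := by
    intro y
    refine le_trans ?_ (sum_sieveSign_mul_tri_le hQ hδ hδQ (digitSpread b y))
    refine Finset.sum_le_sum fun q _ => Finset.sum_le_sum fun d hd => ?_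
    have hd1 : 1 ≤ d := Nat.pos_of_mem_divisors hd
    have hd1' : (1 : ℝ) ≤ d := by exact_mod_cast hd1
    have h := abs_triPoly_sub_tri_le (δ := δ / d) (by positivity)
      ((div_le_self hδ.le hd1').trans hδ2) hH ((q / d : ℕ) * digitSpread b y)
    rw [hF]
    have h2 : sieveSign d * (triPoly (δ / d) H ((q / d : ℕ) * digitSpread b y) -
        tri (δ / d) ((q / d : ℕ) * digitSpread b y)) ≤ 1 / (H * (δ / d)) := by
      refine (le_abs_self _).trans ?_
      rw [abs_mul, abs_sieveSign, one_mul]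
      exact h
    rw [mul_sub] at h2
    linarith
  have hIint : IntervalIntegrable
      (fun y => (dyadicApprox Q δ).indicator (1 : ℝ → ℝ) (digitSpread b y)) volume
      ((a : ℝ) / (b : ℝ) ^ k) ((a + 1) / (b : ℝ) ^ k) := by
    rw [intervalIntegrable_iff]
    refine Measure.integrableOn_of_bounded (M := 1) (by simp) ?_
      (Eventually.of_forall fun y => ?_)
    · exact ((measurable_const.indicator (measurableSet_dyadicApprox Q δ)).comp
        (measurable_digitSpread hb)).aestronglyMeasurable
    · by_cases h : digitSpread b y ∈ dyadicApprox Q δ <;> simp [h]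
  refine le_trans ?_ (intervalIntegral.integral_mono_on hle
    (intervalIntegrable_finsetSum _ fun q _ => intervalIntegrable_finsetSum _ fun d _ => hFint q d) hIint
    fun y _ => hFle y)
  rw [intervalIntegral.integral_finsetSum fun q _ =>
    intervalIntegrable_finsetSum _ fun d _ => hFint q d, Finset.mul_sum]
  refine Finset.sum_le_sum fun q _ => ?_
  rw [intervalIntegral.integral_finsetSum fun d _ => hFint q d, Finset.mul_sum]
  refine Finset.sum_le_sum fun d hd => ?_
  rw [hF]
  simp only
  rw [intervalIntegral.integral_sub
    ((integrable_triPoly_digitSpread hb _ _ _ _ _).const_mul _) intervalIntegrable_const,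
    intervalIntegral.integral_const, intervalIntegral.integral_const_mul, smul_eq_mul]
  have hlen : ((a : ℝ) + 1) / (b : ℝ) ^ k - a / (b : ℝ) ^ k = ((b : ℝ) ^ k)⁻¹ := by ring
  rw [hlen]
  have h := abs_integral_triPoly_sub_le hb (δ := δ / d) (by positivity) H (q / d) k a
  have h2 : |sieveSign d * ((∫ y in ((a : ℝ) / (b : ℝ) ^ k)..((a + 1) / (b : ℝ) ^ k),
        triPoly (δ / d) H ((q / d : ℕ) * digitSpread b y)) - ((b : ℝ) ^ k)⁻¹ * (δ / d))| ≤
      ((b : ℝ) ^ k)⁻¹ * ∑ h ∈ Finset.Icc 1 H,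
        triCoeff (δ / d) h * ‖spreadChar b ((h * (q / d) : ℕ) / ((b : ℝ) + 1) ^ k)‖ := by
    rw [abs_mul, abs_sieveSign, one_mul]
    exact h
  have h3 := (abs_le.1 h2).1
  rw [mul_sub] at h3
  linarith

theorem sum_sieveSign_div_ge {Q : ℕ} (hQ : 1 ≤ Q) :
    (Q : ℝ) / 4 - (1 + Real.log (2 * Q)) ≤
      ∑ q ∈ Finset.Ico Q (2 * Q), ∑ d ∈ q.divisors, sieveSign d / d := by
  have hQ0 : (0 : ℝ) < Q := by exact_mod_cast hQ
  rw [sum_Ico_sum_divisors Q (fun d => sieveSign d / d),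
    Finset.sum_eq_sum_Ico_succ_bot (by omega)]
  have h1 : (((Finset.Ico Q (2 * Q)).filter (1 ∣ ·)).card : ℝ) * (sieveSign 1 / (1 : ℕ)) = Q := by
    simp [sieveSign]
    rw [two_mul, Nat.add_sub_cancel]
  rw [h1]
  have h2 : -(∑ d ∈ Finset.Ico (1 + 1) (2 * Q), ((Q : ℝ) * (1 / (d : ℝ) ^ 2) + 1 / d)) ≤
      ∑ d ∈ Finset.Ico (1 + 1) (2 * Q),
        (((Finset.Ico Q (2 * Q)).filter (d ∣ ·)).card : ℝ) * (sieveSign d / d) := by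
    rw [← Finset.sum_neg_distrib]
    refine Finset.sum_le_sum fun d hd => ?_
    have hd1 : 2 ≤ d := (Finset.mem_Ico.1 hd).1
    have hd0 : (0 : ℝ) < d := by positivity
    have hc := card_filter_dvd_Ico_le Q d (by omega)
    have hs : sieveSign d = -1 := if_neg (by omega)
    rw [hs]
    have : (((Finset.Ico Q (2 * Q)).filter (d ∣ ·)).card : ℝ) * (1 / d) ≤ (Q / d + 1) * (1 / d) := by
      gcongr
    have e : ((Q : ℝ) / d + 1) * (1 / d) = Q * (1 / (d : ℝ) ^ 2) + 1 / d := by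
      field_simp
    rw [neg_div, mul_neg]
    linarith
  have h3 : ∑ d ∈ Finset.Ico (1 + 1) (2 * Q), 1 / (d : ℝ) ^ 2 ≤ 3 / 4 := by
    have h := sum_le_hasSum (Finset.Ico 1 (2 * Q)) (fun d _ => by positivity) hasSum_zeta_two
    rw [Finset.sum_eq_sum_Ico_succ_bot (by omega)] at h
    have := Real.pi_lt_d2
    have := Real.pi_pos
    norm_num at h ⊢
    nlinarith
  have h4 : ∑ d ∈ Finset.Ico (1 + 1) (2 * Q), 1 / (d : ℝ) ≤ 1 + Real.log (2 * Q) := by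
    have h := harmonic_le_one_add_log (2 * Q)
    rw [harmonic_eq_sum_Icc] at h
    push_cast at h
    refine le_trans ?_ h
    simp_rw [one_div]
    refine Finset.sum_le_sum_of_subset_of_nonneg (fun x hx => ?_) fun _ _ _ => by positivity
    simp only [Finset.mem_Ico, Finset.mem_Icc] at hx ⊢
    omega
  rw [Finset.sum_add_distrib, ← Finset.mul_sum] at h2
  nlinarith

theorem sum_triCoeff_mul_le {Q H : ℕ} (hQ : 1 ≤ Q) {δ : ℝ} (hδ : 0 < δ) {a : ℕ → ℝ}
    (ha : ∀ m, 0 ≤ a m) {D : ℝ} (hD₀ : 0 ≤ D)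
    (hD : ∀ m, 1 ≤ m → m < 2 * Q * (H + 1) → (m.divisors.card : ℝ) ≤ D) :
    ∑ q ∈ Finset.Ico Q (2 * Q), ∑ d ∈ q.divisors, ∑ h ∈ Finset.Icc 1 H,
        triCoeff (δ / d) h * a (h * (q / d)) ≤
      6 * δ * (D * ∑ m ∈ Finset.range (2 * Q * (H + 1)), a m) := by
  have hQ0 : (0 : ℝ) < Q := by exact_mod_cast hQ
  set g : ℕ → ℝ := fun r => 2 * δ * r / Q * ∑ h ∈ Finset.Icc 1 H, a (h * r) with hg
  have hsum : ∀ r, 0 ≤ ∑ h ∈ Finset.Icc 1 H, a (h * r) := fun r =>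
    Finset.sum_nonneg fun _ _ => ha _
  calc _ ≤ ∑ q ∈ Finset.Ico Q (2 * Q), ∑ d ∈ q.divisors, g (q / d) := by
        refine Finset.sum_le_sum fun q hq => Finset.sum_le_sum fun d hd => ?_
        have hd0 : 0 < d := Nat.pos_of_mem_divisors hd
        have hd0' : (0 : ℝ) < d := by exact_mod_cast hd0
        have hQq : (Q : ℝ) ≤ q := by exact_mod_cast (Finset.mem_Ico.1 hq).1
        rw [hg]
        simp only
        rw [Finset.mul_sum]
        refine Finset.sum_le_sum fun h _ => mul_le_mul_of_nonneg_right ?_ (ha _)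
        refine (triCoeff_le (by positivity) h).trans ?_
        rw [Nat.cast_div (Nat.dvd_of_mem_divisors hd) hd0'.ne', le_div_iff₀ hQ0]
        have : 2 * (δ / d) * Q ≤ 2 * (δ / d) * q := by gcongr
        refine this.trans (le_of_eq ?_)
        field_simp
    _ = ∑ q ∈ Finset.Ico Q (2 * Q), ∑ d ∈ q.divisors, g d :=
        Finset.sum_congr rfl fun q _ => Nat.sum_div_divisors q g
    _ = ∑ d ∈ Finset.Ico 1 (2 * Q), (((Finset.Ico Q (2 * Q)).filter (d ∣ ·)).card : ℝ) * g d :=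
        sum_Ico_sum_divisors Q g
    _ ≤ ∑ d ∈ Finset.Ico 1 (2 * Q), 6 * δ * ∑ h ∈ Finset.Icc 1 H, a (h * d) := by
        refine Finset.sum_le_sum fun d hd => ?_
        have hd1 := (Finset.mem_Ico.1 hd).1
        have hd0 : (0 : ℝ) < d := by exact_mod_cast hd1
        have hd2 : (d : ℝ) ≤ 2 * Q := by exact_mod_cast (Finset.mem_Ico.1 hd).2.le
        rw [hg]
        simp only
        rw [← mul_assoc]
        refine mul_le_mul_of_nonneg_right ?_ (hsum d)
        calc _ ≤ ((Q : ℝ) / d + 1) * (2 * δ * d / Q) := by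
              gcongr
              exact card_filter_dvd_Ico_le Q d hd1
          _ = 2 * δ + 2 * δ * (d / Q) := by field_simp
          _ ≤ 2 * δ + 2 * δ * 2 := by
              gcongr
              rwa [div_le_iff₀ hQ0]
          _ = 6 * δ := by ring
    _ ≤ _ := by
        rw [← Finset.mul_sum]
        exact mul_le_mul_of_nonneg_left (sum_sum_mul_le _ _ _ ha _ hD₀ hD) (by positivity)

theorem sum_divisors_inv_le {Q H : ℕ} (hQ : 1 ≤ Q) (hH : 1 ≤ H) {δ : ℝ} (hδ : 0 < δ) :
    ∑ q ∈ Finset.Ico Q (2 * Q), ∑ d ∈ q.divisors, 1 / (H * (δ / d)) ≤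
      4 * (Q : ℝ) ^ 3 / (H * δ) := by
  have hQ0 : (0 : ℝ) < Q := by exact_mod_cast hQ
  have hH0 : (0 : ℝ) < H := by exact_mod_cast hH
  calc _ ≤ ∑ q ∈ Finset.Ico Q (2 * Q), 2 * Q * (2 * Q / (H * δ)) := by
        refine Finset.sum_le_sum fun q hq => ?_
        have hq2 : (q : ℝ) ≤ 2 * Q := by exact_mod_cast (Finset.mem_Ico.1 hq).2.le
        calc _ ≤ ∑ d ∈ q.divisors, 2 * Q / (H * δ) := by
              refine Finset.sum_le_sum fun d hd => ?_
              have hd0 : 0 < d := Nat.pos_of_mem_divisors hd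
              have hd0' : (0 : ℝ) < d := by exact_mod_cast hd0
              have hdq : (d : ℝ) ≤ q := by exact_mod_cast Nat.divisor_le hd
              calc 1 / (H * (δ / d)) = d / (H * δ) := by field_simp
                _ ≤ _ := by gcongr; linarith
          _ ≤ _ := by
              rw [Finset.sum_const, nsmul_eq_mul]
              gcongr
              exact le_trans (by exact_mod_cast Nat.card_divisors_le_self q) hq2
    _ = _ := by
        rw [Finset.sum_const, Nat.card_Ico, two_mul, Nat.add_sub_cancel, nsmul_eq_mul]
        ring

theorem sum_range_norm_spreadChar_le {b : ℕ} (hb : 1 ≤ b)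
    (hS : 4 + 2 * Real.log b ≤ ((b : ℝ) + 1) ^ (1 / 16 : ℝ)) (k : ℕ) {X : ℕ} (hX : 2 ≤ X) :
    ∑ m ∈ Finset.range X, ‖spreadChar b (m / ((b : ℝ) + 1) ^ k)‖ ≤
      ((b : ℝ) + 1) ^ (k + 1) * (X : ℝ) ^ (1 / 16 : ℝ) := by
  have hN : 1 < b + 1 := by omega
  have hN1 : (1 : ℝ) ≤ (b : ℝ) + 1 := by linarith [Nat.cast_nonneg (α := ℝ) b]
  set L := Nat.clog (b + 1) X
  have hL : 0 < L := Nat.clog_pos hN hX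
  have hXL : X ≤ (b + 1) ^ (k + L) :=
    (Nat.le_pow_clog hN X).trans (Nat.pow_le_pow_right (by omega) (by omega))
  have hLX : ((b : ℝ) + 1) ^ L ≤ (b + 1) * X := by
    obtain ⟨l, hl⟩ : ∃ l, L = l + 1 := ⟨L - 1, by omega⟩
    have h : (b + 1) ^ l < X := by
      have := Nat.pow_pred_clog_lt_self hN (x := X) (by omega)
      change (b + 1) ^ (L - 1) < X at this
      rwa [hl, Nat.add_sub_cancel] at this
    have h' : ((b : ℝ) + 1) ^ l ≤ X := by exact_mod_cast h.le
    rw [hl, pow_succ']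
    gcongr
  have hS0 : 0 ≤ 4 + 2 * Real.log b := by
    have := Real.log_nonneg (x := b) (by exact_mod_cast hb)
    linarith
  calc _ ≤ ∑ m ∈ Finset.range ((b + 1) ^ (k + L)), ‖spreadChar b (m / ((b : ℝ) + 1) ^ k)‖ :=
        Finset.sum_le_sum_of_subset_of_nonneg (Finset.range_subset_range.2 hXL)
          fun _ _ _ => norm_nonneg _
    _ ≤ ((b : ℝ) + 1) ^ k * (4 + 2 * Real.log b) ^ (k + L - k) :=
        sum_norm_spreadChar_le hb (Nat.le_add_right _ _)
    _ ≤ ((b : ℝ) + 1) ^ k * (((b : ℝ) + 1) ^ (1 / 16 : ℝ)) ^ L := by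
        rw [Nat.add_sub_cancel_left]
        gcongr
    _ = ((b : ℝ) + 1) ^ k * (((b : ℝ) + 1) ^ L) ^ (1 / 16 : ℝ) := by
        rw [← Real.rpow_natCast, ← Real.rpow_natCast, ← Real.rpow_natCast,
          ← Real.rpow_mul (by positivity), ← Real.rpow_mul (by positivity), mul_comm (1 / 16 : ℝ)]
    _ ≤ ((b : ℝ) + 1) ^ k * ((b + 1) * X) ^ (1 / 16 : ℝ) := by gcongr
    _ ≤ ((b : ℝ) + 1) ^ k * ((b + 1) * (X : ℝ) ^ (1 / 16 : ℝ)) := by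
        rw [Real.mul_rpow (by positivity) (by positivity)]
        gcongr
        exact Real.rpow_le_self_of_one_le hN1 (by norm_num)
    _ = _ := by rw [pow_succ]; ring

theorem natCast_rpow_sixteenth_mul_self_le {Q X : ℕ} (hQ : 1 ≤ Q) (hX : X ≤ 4 * Q ^ 6) :
    (X : ℝ) ^ (1 / 16 : ℝ) * (X : ℝ) ^ (1 / 16 : ℝ) ≤ 4 * (Q : ℝ) ^ (3 / 4 : ℝ) := by
  have hX' : (X : ℝ) ≤ 4 * (Q : ℝ) ^ 6 := by exact_mod_cast hX
  rw [← Real.mul_rpow (by positivity) (by positivity)]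
  calc ((X : ℝ) * X) ^ (1 / 16 : ℝ) ≤ ((4 * (Q : ℝ) ^ 6) * (4 * (Q : ℝ) ^ 6)) ^ (1 / 16 : ℝ) := by
        gcongr
    _ = (16 : ℝ) ^ (1 / 16 : ℝ) * ((Q : ℝ) ^ (12 : ℝ)) ^ (1 / 16 : ℝ) := by
        rw [← Real.mul_rpow (by positivity) (by positivity)]
        congr 1
        have : (Q : ℝ) ^ (12 : ℝ) = (Q : ℝ) ^ (12 : ℕ) := by
          rw [← Real.rpow_natCast]
          norm_num
        rw [this]
        ring
    _ ≤ 4 * (Q : ℝ) ^ (3 / 4 : ℝ) := by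
        rw [← Real.rpow_mul (by positivity)]
        have h4 : (16 : ℝ) ^ (1 / 16 : ℝ) ≤ 4 := by
          calc (16 : ℝ) ^ (1 / 16 : ℝ) ≤ (16 : ℝ) ^ (1 / 2 : ℝ) :=
                Real.rpow_le_rpow_of_exponent_le (by norm_num) (by norm_num)
            _ = 4 := by
                rw [← Real.sqrt_eq_rpow, show (16 : ℝ) = 4 ^ 2 by norm_num]
                exact Real.sqrt_sq (by norm_num)
        norm_num at h4 ⊢
        gcongr

theorem exists_le_integral_dyadicApprox {b : ℕ} (hb : 1 ≤ b)
    (hS : 4 + 2 * Real.log b ≤ ((b : ℝ) + 1) ^ (1 / 16 : ℝ)) {c : ℝ} (hc : 0 < c)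
    (hc' : c ≤ 1 / 4) (k a : ℕ) :
    ∃ Q : ℕ, 1 ≤ Q ∧ ((b : ℝ) ^ k)⁻¹ * (c / 16) ≤
      ∫ y in ((a : ℝ) / (b : ℝ) ^ k)..((a + 1) / (b : ℝ) ^ k),
        (dyadicApprox Q (c / (2 * Q))).indicator 1 (digitSpread b y) := by
  obtain ⟨C, hC0, hC⟩ := exists_card_divisors_le_rpow 16 (by norm_num)
  push_cast at hC
  set M := C * ((b : ℝ) + 1) ^ (k + 1) * 4
  have hlim : Tendsto (fun Q : ℕ => c * (1 / (2 * Q) + Real.log (2 * Q) / (2 * Q)) +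
      3 * c * M * (Q : ℝ) ^ (-(1 / 4) : ℝ) + 8 / c * (1 / (Q : ℝ))) atTop
      (nhds (c * (0 + 0) + 3 * c * M * 0 + 8 / c * 0)) := by
    have h2Q : Tendsto (fun Q : ℕ => 2 * (Q : ℝ)) atTop atTop :=
      tendsto_natCast_atTop_atTop.const_mul_atTop two_pos
    have h1 : Tendsto (fun Q : ℕ => 1 / (2 * (Q : ℝ))) atTop (nhds 0) :=
      tendsto_const_nhds.div_atTop h2Q
    have h2 : Tendsto (fun Q : ℕ => Real.log (2 * (Q : ℝ)) / (2 * (Q : ℝ))) atTop (nhds 0) :=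
      Real.isLittleO_log_id_atTop.tendsto_div_nhds_zero.comp h2Q
    have h3 : Tendsto (fun Q : ℕ => (Q : ℝ) ^ (-(1 / 4) : ℝ)) atTop (nhds 0) :=
      (tendsto_rpow_neg_atTop (by norm_num)).comp tendsto_natCast_atTop_atTop
    exact (((h1.add h2).const_mul c).add (h3.const_mul _)).add
      (tendsto_one_div_atTop_nhds_zero_nat.const_mul _)
  have hev := (hlim.eventually_lt_const (u := c / 16) (by simpa using hc)).and
    (eventually_ge_atTop 1)
  obtain ⟨Q, hQerr, hQ⟩ := hev.exists
  refine ⟨Q, hQ, ?_⟩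
  have hQ0 : (0 : ℝ) < Q := by exact_mod_cast hQ
  have hQ1 : (1 : ℝ) ≤ Q := by exact_mod_cast hQ
  set δ := c / (2 * (Q : ℝ)) with hδdef
  have hδ : 0 < δ := by positivity
  have hδQ : δ * Q = c / 2 := by rw [hδdef]; field_simp
  have hH : 1 ≤ Q ^ 5 := Nat.one_le_pow _ _ hQ
  refine le_trans ?_ (le_integral_indicator_dyadicApprox hb hQ hH hδ (by nlinarith) k a)
  refine mul_le_mul_of_nonneg_left ?_ (by positivity)
  simp only [Finset.sum_sub_distrib]
  set X := 2 * Q * (Q ^ 5 + 1) with hXdef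
  have hX2 : 2 ≤ X := by
    rw [hXdef]
    nlinarith
  have hX4 : X ≤ 4 * Q ^ 6 := by
    rw [hXdef]
    nlinarith
  have hmain : δ * ((Q : ℝ) / 4 - (1 + Real.log (2 * Q))) ≤
      ∑ q ∈ Finset.Ico Q (2 * Q), ∑ d ∈ q.divisors, sieveSign d * (δ / d) := by
    refine (mul_le_mul_of_nonneg_left (sum_sieveSign_div_ge hQ) hδ.le).trans (le_of_eq ?_)
    simp_rw [Finset.mul_sum]
    refine Finset.sum_congr rfl fun q _ => Finset.sum_congr rfl fun d _ => ?_
    ring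
  have hosc := sum_triCoeff_mul_le (H := Q ^ 5) hQ hδ
    (a := fun m => ‖spreadChar b (m / ((b : ℝ) + 1) ^ k)‖) (fun _ => norm_nonneg _)
    (D := C * (X : ℝ) ^ (1 / 16 : ℝ)) (by positivity) (fun m hm hmX => by
      refine (hC m (by omega)).trans ?_
      gcongr)
  have htail := sum_divisors_inv_le hQ hH hδ
  have hA := sum_range_norm_spreadChar_le hb hS k hX2
  have hosc2 : 6 * δ * (C * (X : ℝ) ^ (1 / 16 : ℝ) *
      ∑ m ∈ Finset.range X, ‖spreadChar b (m / ((b : ℝ) + 1) ^ k)‖) ≤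
      3 * c * M * (Q : ℝ) ^ (-(1 / 4) : ℝ) := by
    have hXX := natCast_rpow_sixteenth_mul_self_le hQ hX4
    calc _ ≤ 6 * δ * (C * (X : ℝ) ^ (1 / 16 : ℝ) *
          (((b : ℝ) + 1) ^ (k + 1) * (X : ℝ) ^ (1 / 16 : ℝ))) := by gcongr
      _ = 6 * δ * (C * ((b : ℝ) + 1) ^ (k + 1) *
          ((X : ℝ) ^ (1 / 16 : ℝ) * (X : ℝ) ^ (1 / 16 : ℝ))) := by ring
      _ ≤ 6 * δ * (C * ((b : ℝ) + 1) ^ (k + 1) * (4 * (Q : ℝ) ^ (3 / 4 : ℝ))) := by gcongr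
      _ = 6 * δ * (M * (Q * (Q : ℝ) ^ (-(1 / 4) : ℝ))) := by
          have : (Q : ℝ) * (Q : ℝ) ^ (-(1 / 4) : ℝ) = (Q : ℝ) ^ (3 / 4 : ℝ) := by
            rw [← Real.rpow_one_add' hQ0.le (by norm_num)]
            norm_num
          rw [this]
          ring
      _ = 6 * (δ * Q) * M * (Q : ℝ) ^ (-(1 / 4) : ℝ) := by ring
      _ = _ := by rw [hδQ]; ring
  have htail2 : 4 * (Q : ℝ) ^ 3 / ((Q ^ 5 : ℕ) * δ) = 8 / c * (1 / (Q : ℝ)) := by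
    rw [hδdef]
    push_cast
    field_simp
    ring
  have hmain2 : δ * ((Q : ℝ) / 4 - (1 + Real.log (2 * Q))) =
      c / 8 - c * (1 / (2 * Q) + Real.log (2 * Q) / (2 * Q)) := by
    rw [hδdef]
    field_simp
    ring
  rw [htail2] at htail
  rw [hmain2] at hmain
  linarith

/-- A set that misses a fixed proportion of every `b`-adic interval is null. -/
theorem ae_notMem_of_forall_measureReal_inter_le {b : ℕ} (hb : 2 ≤ b) {S : Set ℝ} {κ : ℝ}
    (hκ : 0 < κ)
    (h : ∀ k a : ℕ, volume.real (S ∩ Icc ((a : ℝ) / (b : ℝ) ^ k) ((a + 1) / (b : ℝ) ^ k)) ≤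
      ((b : ℝ) ^ k)⁻¹ * (1 - κ)) :
    ∀ᵐ x : ℝ, 0 ≤ x → x ∉ S := by
  have hb0 : (0 : ℝ) < b := by positivity
  have hb1 : (1 : ℝ) < b := by exact_mod_cast hb
  have hdens := ae_imp_of_ae_restrict
    (IsUnifLocDoublingMeasure.ae_tendsto_measure_inter_div (volume : Measure ℝ) S 1)
  filter_upwards [hdens] with x hx hx0 hxS
  have hlim0 : Tendsto (fun k : ℕ => ((b : ℝ) ^ k)⁻¹ / 2) atTop (nhdsWithin 0 (Ioi 0)) := by
    rw [tendsto_nhdsWithin_iff]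
    constructor
    · have := (tendsto_pow_atTop_nhds_zero_of_lt_one (r := (b : ℝ)⁻¹) (by positivity)
        (inv_lt_one_of_one_lt₀ hb1)).div_const 2
      simpa [inv_pow] using this
    · exact Eventually.of_forall fun k => by
        simp only [mem_Ioi]
        positivity
  set w : ℕ → ℝ := fun k => (⌊(b : ℝ) ^ k * x⌋₊ + 1 / 2 : ℝ) / (b : ℝ) ^ k with hw
  have hball : ∀ k, Metric.closedBall (w k) (((b : ℝ) ^ k)⁻¹ / 2) =
      Icc ((⌊(b : ℝ) ^ k * x⌋₊ : ℝ) / (b : ℝ) ^ k) ((⌊(b : ℝ) ^ k * x⌋₊ + 1) / (b : ℝ) ^ k) := by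
    intro k
    rw [Real.closedBall_eq_Icc, hw]
    congr 1 <;> field_simp <;> ring
  have hmem : ∀ k, x ∈ Metric.closedBall (w k) (1 * (((b : ℝ) ^ k)⁻¹ / 2)) := by
    intro k
    have hB : (0 : ℝ) < (b : ℝ) ^ k := by positivity
    rw [one_mul, hball, mem_Icc, div_le_iff₀ hB, le_div_iff₀ hB, mul_comm x]
    exact ⟨Nat.floor_le (by positivity), (Nat.lt_floor_add_one _).le⟩
  have hlim := hx hxS w _ hlim0 (Eventually.of_forall hmem)
  have hle : ∀ k, volume (S ∩ Metric.closedBall (w k) (((b : ℝ) ^ k)⁻¹ / 2)) /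
      volume (Metric.closedBall (w k) (((b : ℝ) ^ k)⁻¹ / 2)) ≤ ENNReal.ofReal (1 - κ) := by
    intro k
    have hB : (0 : ℝ) < (b : ℝ) ^ k := by positivity
    have hk := h k ⌊(b : ℝ) ^ k * x⌋₊
    rw [← hball] at hk
    have hfin : volume (S ∩ Metric.closedBall (w k) (((b : ℝ) ^ k)⁻¹ / 2)) ≠ ⊤ :=
      measure_ne_top_of_subset inter_subset_right measure_closedBall_lt_top.ne
    rw [Real.volume_closedBall, mul_div_cancel₀ _ (two_ne_zero' ℝ)]
    refine ENNReal.div_le_of_le_mul' ?_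
    rw [← ENNReal.ofReal_mul (by positivity), ← ofReal_measureReal hfin]
    exact ENNReal.ofReal_le_ofReal hk
  have h1 := le_of_tendsto' hlim hle
  rw [ENNReal.one_le_ofReal] at h1
  linarith

/-- Almost every point is mapped by `digitSpread b` to a well approximable number. -/
theorem ae_not_badlyApproximable_digitSpread {b : ℕ} (hb : 2 ≤ b)
    (hS : 4 + 2 * Real.log b ≤ ((b : ℝ) + 1) ^ (1 / 16 : ℝ)) :
    ∀ᵐ y : ℝ, 0 ≤ y → ¬ BadlyApproximable1 (digitSpread b y) := by
  have hb1 : 1 ≤ b := by omega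
  have hnull : ∀ j : ℕ, ∀ᵐ y : ℝ, 0 ≤ y → y ∉ {y : ℝ | ∀ (p : ℤ) (q : ℕ), 0 < q →
      1 / ((j : ℝ) + 4) / (q : ℝ) ^ 2 ≤ |digitSpread b y - (p : ℝ) / (q : ℝ)|} := by
    intro j
    set c := 1 / ((j : ℝ) + 4) with hcdef
    have hc : 0 < c := by positivity
    have hc' : c ≤ 1 / 4 := by
      rw [hcdef]
      gcongr
      linarith [Nat.cast_nonneg (α := ℝ) j]
    refine ae_notMem_of_forall_measureReal_inter_le hb (κ := c / 16) (by positivity)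
      fun k a => ?_
    have hB : (0 : ℝ) < (b : ℝ) ^ k := by positivity
    obtain ⟨Q, hQ, hint⟩ := exists_le_integral_dyadicApprox hb1 hS hc hc' k a
    have hQ0 : (0 : ℝ) < Q := by exact_mod_cast hQ
    set E := digitSpread b ⁻¹' dyadicApprox Q (c / (2 * Q)) with hE
    have hEm : MeasurableSet E := measurable_digitSpread hb1 (measurableSet_dyadicApprox _ _)
    set J := Icc ((a : ℝ) / (b : ℝ) ^ k) ((a + 1) / (b : ℝ) ^ k) with hJ
    have hle : (a : ℝ) / (b : ℝ) ^ k ≤ (a + 1) / (b : ℝ) ^ k := by gcongr; linarith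
    have hJfin : volume J ≠ ⊤ := by rw [hJ, Real.volume_Icc]; exact ENNReal.ofReal_ne_top
    have hEJ : ((b : ℝ) ^ k)⁻¹ * (c / 16) ≤ volume.real (J ∩ E) := by
      refine hint.trans ?_
      have e : ∫ y in ((a : ℝ) / (b : ℝ) ^ k)..((a + 1) / (b : ℝ) ^ k),
          (dyadicApprox Q (c / (2 * Q))).indicator (1 : ℝ → ℝ) (digitSpread b y) =
          ∫ y in ((a : ℝ) / (b : ℝ) ^ k)..((a + 1) / (b : ℝ) ^ k), E.indicator (1 : ℝ → ℝ) y := rfl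
      rw [e, intervalIntegral.integral_of_le hle, integral_indicator_one hEm,
        measureReal_restrict_apply hEm, inter_comm]
      exact measureReal_mono (inter_subset_inter_left _ Ioc_subset_Icc_self)
        (measure_ne_top_of_subset inter_subset_left hJfin)
    have hsub : {y : ℝ | ∀ (p : ℤ) (q : ℕ), 0 < q →
        c / (q : ℝ) ^ 2 ≤ |digitSpread b y - (p : ℝ) / (q : ℝ)|} ∩ J ⊆ J \ E := by
      rintro y ⟨hy, hyJ⟩
      refine ⟨hyJ, fun ⟨q, hq, hlt⟩ => ?_⟩
      have hQq := (Finset.mem_Ico.1 hq).1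
      have hq2 : (q : ℝ) < 2 * Q := by exact_mod_cast (Finset.mem_Ico.1 hq).2
      have hq0 : (0 : ℝ) < q := by exact_mod_cast (by omega : 0 < q)
      have h := hy (round ((q : ℝ) * digitSpread b y)) q (by omega)
      have e : digitSpread b y - (round ((q : ℝ) * digitSpread b y) : ℝ) / q =
          ((q : ℝ) * digitSpread b y - round ((q : ℝ) * digitSpread b y)) / q := by
        field_simp
      rw [e, abs_div, abs_of_pos hq0, sq, ← div_div, div_le_div_iff_of_pos_right hq0] at h
      have : c / (2 * Q) ≤ c / q := by gcongr
      linarith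
    calc _ ≤ volume.real (J \ E) :=
          measureReal_mono hsub (measure_ne_top_of_subset sdiff_subset hJfin)
      _ = volume.real J - volume.real (J ∩ E) := by
          have := measureReal_inter_add_sdiff (μ := volume) (s := J) hEm hJfin
          linarith
      _ ≤ ((b : ℝ) ^ k)⁻¹ - ((b : ℝ) ^ k)⁻¹ * (c / 16) := by
          have : volume.real J = ((b : ℝ) ^ k)⁻¹ := by
            rw [hJ, Real.volume_real_Icc_of_le hle]
            ring
          rw [this]
          gcongr
      _ = _ := by ring
  filter_upwards [ae_all_iff.2 hnull] with y hy hy0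
  rintro ⟨c, hc, hbad⟩
  obtain ⟨j, hj⟩ := exists_nat_gt (1 / c)
  refine hy j hy0 fun p q hq => le_trans ?_ (hbad p q hq)
  have hjc : 1 / ((j : ℝ) + 4) ≤ c := by
    rw [div_le_iff₀ (by positivity)]
    rw [div_lt_iff₀ hc] at hj
    nlinarith
  gcongr

theorem pow_zsmul_digitSpread {b : ℕ} (hb : 1 ≤ b) (i : ℕ) (y : ℝ) :
    ((b : ℤ) + 1) ^ i • (digitSpread b y : Circ) = (digitSpread b ((b : ℝ) ^ i * y) : Circ) := by
  induction i with
  | zero => simp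
  | succ i ih =>
    have hstep : ∀ z : ℝ, ((b : ℤ) + 1) • (digitSpread b z : Circ) = digitSpread b (b * z) := by
      intro z
      have e : ((b : ℤ) + 1) • digitSpread b z =
          ⌊(b : ℝ) * Int.fract z⌋ + digitSpread b (b * z) := by
        rw [zsmul_eq_mul]
        conv_lhs => rw [digitSpread_eq hb z]
        push_cast
        field_simp
      rw [← AddCircle.coe_zsmul, e, AddCircle.coe_add, add_eq_right, AddCircle.coe_eq_zero_iff]
      exact ⟨⌊(b : ℝ) * Int.fract z⌋, by simp⟩
    rw [pow_succ', mul_smul, ih, hstep, ← mul_assoc, ← pow_succ']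

/-- Numbers avoiding the digit `b` in base `b + 1 = n ^ m` have non-dense orbit under `T_n`. -/
theorem closure_orbit_digitSpread_ne_univ {n b m : ℕ} (hn : 2 ≤ n) (hb : 1 ≤ b)
    (hbn : b + 1 = n ^ m) (y : ℝ) :
    closure (Set.range fun k : ℕ => (fun x : Circ => (n : ℤ) • x)^[k] (digitSpread b y : Circ)) ≠
      Set.univ := by
  intro hclosure
  have hm : 0 < m := by
    rcases Nat.eq_zero_or_pos m with rfl | h
    · simp at hbn
      omega
    · exact h
  have hb0 : (0 : ℝ) < b := by exact_mod_cast hb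
  have hbn' : (b : ℝ) + 1 = (n : ℝ) ^ m := by exact_mod_cast hbn
  have hU : IsOpen ((fun x : ℝ => (x : Circ)) '' Ioo (-(1 / ((b : ℝ) + 1) ^ 2)) 0) :=
    QuotientAddGroup.isOpenMap_coe _ isOpen_Ioo
  obtain ⟨_, ⟨v, hv, rfl⟩, k, hk⟩ := (dense_iff_closure_eq.2 hclosure).inter_open_nonempty _ hU
    (Set.Nonempty.image _ (nonempty_Ioo.2 (by rw [neg_lt_zero]; positivity)))
  simp only at hk
  rw [smul_iterate] at hk
  simp only at hk
  obtain ⟨i, j, hjm, hij⟩ : ∃ i j, j ≤ m ∧ j + k = m * i := by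
    refine ⟨k / m + 1, m - k % m, Nat.sub_le _ _, ?_⟩
    have h1 := Nat.div_add_mod k m
    have h2 := Nat.mod_lt k hm
    rw [Nat.mul_add, mul_one]
    omega
  have h1 : (digitSpread b ((b : ℝ) ^ i * y) : Circ) = (((n : ℝ) ^ j * v : ℝ) : Circ) := by
    rw [← pow_zsmul_digitSpread hb]
    have e : ((b : ℤ) + 1) ^ i = (n : ℤ) ^ j * (n : ℤ) ^ k := by
      rw [← pow_add, hij, pow_mul]
      congr 1
      exact_mod_cast hbn
    rw [e, mul_smul, hk, ← AddCircle.coe_zsmul]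
    congr 1
    rw [zsmul_eq_mul]
    push_cast
    rfl
  rw [← sub_eq_zero, ← AddCircle.coe_sub, AddCircle.coe_eq_zero_iff] at h1
  obtain ⟨z, hz⟩ := h1
  rw [zsmul_eq_mul, mul_one] at hz
  have hψ0 := digitSpread_nonneg b ((b : ℝ) ^ i * y)
  have hψ1 := digitSpread_le hb ((b : ℝ) ^ i * y)
  have hnj0 : (0 : ℝ) < (n : ℝ) ^ j := by positivity
  have hnj : (n : ℝ) ^ j ≤ b + 1 := by
    rw [hbn']
    exact pow_le_pow_right₀ (by exact_mod_cast (by omega : 1 ≤ n)) hjm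
  have hneg : (n : ℝ) ^ j * v < 0 := mul_neg_of_pos_of_neg hnj0 hv.2
  have hlow : -(1 / (b : ℝ)) < (n : ℝ) ^ j * v := by
    have h2 : ((b : ℝ) + 1) * (1 / ((b : ℝ) + 1) ^ 2) = 1 / (b + 1) := by field_simp
    have h3 : 1 / ((b : ℝ) + 1) < 1 / b := by
      gcongr
      linarith
    have h4 : ((b : ℝ) + 1) * v ≤ (n : ℝ) ^ j * v := mul_le_mul_of_nonpos_right hnj hv.2.le
    have h5 : -(((b : ℝ) + 1) * (1 / ((b : ℝ) + 1) ^ 2)) < (b + 1) * v := by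
      rw [← mul_neg]
      exact mul_lt_mul_of_pos_left hv.1 (by positivity)
    linarith
  have hz0 : (0 : ℝ) < z := by linarith
  have hz1 : (z : ℝ) < 1 := by linarith
  have : 0 < z := by exact_mod_cast hz0
  have : z < 1 := by exact_mod_cast hz1
  omega

/-- Images under `digitSpread b` of full measure sets have large Hausdorff dimension. -/
theorem le_dimH_image_digitSpread {b : ℕ} (hb : 2 ≤ b) {P : ℝ → Prop}
    (hP : ∀ᵐ y : ℝ, 0 ≤ y → P y) :
    ENNReal.ofReal (Real.log b / Real.log (b + 1)) ≤
      dimH (digitSpread b '' {y ∈ Ico (0 : ℝ) 1 | P y}) := by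
  have hb1 : (1 : ℝ) < b := by exact_mod_cast hb
  have hα : 0 < Real.log b / Real.log (b + 1) :=
    div_pos (Real.log_pos hb1) (Real.log_pos (by linarith))
  set α := Real.log b / Real.log (b + 1)
  set G := {y ∈ Ico (0 : ℝ) 1 | P y} with hG
  have hinj : InjOn (digitSpread b) G := by
    intro y hy y' hy' h
    have := abs_sub_le_rpow_digitSpread hb hy.1 hy'.1
    rw [h, sub_self, abs_zero, mul_zero, Real.zero_rpow hα.ne'] at this
    exact sub_eq_zero.1 (abs_nonpos_iff.1 this)
  have hinv : LeftInvOn (Function.invFunOn (digitSpread b) G) (digitSpread b) G :=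
    hinj.leftInvOn_invFunOn
  have hholder : HolderOnWith (Real.toNNReal ((((b : ℝ) + 1) ^ 2) ^ α)) (Real.toNNReal α)
      (Function.invFunOn (digitSpread b) G) (digitSpread b '' G) := by
    rintro _ ⟨y, hy, rfl⟩ _ ⟨y', hy', rfl⟩
    rw [hinv hy, hinv hy', edist_dist, edist_dist, Real.coe_toNNReal _ hα.le,
      ENNReal.ofReal_rpow_of_nonneg dist_nonneg hα.le, ← ENNReal.ofReal_coe_nnreal,
      ← ENNReal.ofReal_mul (by positivity), Real.coe_toNNReal _ (by positivity),
      ← Real.mul_rpow (by positivity) dist_nonneg]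
    exact ENNReal.ofReal_le_ofReal (abs_sub_le_rpow_digitSpread hb hy.1 hy'.1)
  have hGdim : 1 ≤ dimH G := by
    have hvol : volume G = 1 := by
      have : G =ᵐ[volume] Ico (0 : ℝ) 1 := by
        rw [eventuallyEq_set]
        filter_upwards [hP] with y hy
        exact ⟨fun h => h.1, fun h => ⟨h, hy h.1⟩⟩
      rw [measure_congr this]
      simp
    have := le_dimH_of_hausdorffMeasure_ne_zero (s := G) (d := 1) (by
      rw [NNReal.coe_one, hausdorffMeasure_real, hvol]
      exact one_ne_zero)
    simpa using this
  have h := hholder.dimH_image_le (Real.toNNReal_pos.2 hα)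
  rw [hinv.image_image] at h
  have hα' : (ENNReal.ofReal α) ≠ 0 := (ENNReal.ofReal_pos.2 hα).ne'
  have h2 := hGdim.trans h
  change 1 ≤ _ / ENNReal.ofReal α at h2
  rwa [ENNReal.le_div_iff_mul_le (Or.inl hα') (Or.inl ENNReal.ofReal_ne_top), one_mul] at h2

theorem eventually_log_le_rpow_and_le_log_div_log {r : ℝ} (hr : r < 1) :
    ∀ᶠ x : ℝ in atTop, 4 + 2 * Real.log x ≤ (x + 1) ^ (1 / 16 : ℝ) ∧
      r ≤ Real.log x / Real.log (x + 1) := by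
  have h1 := (isLittleO_log_rpow_atTop (r := 1 / 16) (by norm_num)).def (c := 1 / 4) (by norm_num)
  have h2 := (tendsto_rpow_atTop (y := 1 / 16) (by norm_num)).eventually_ge_atTop 8
  have h3 := Real.tendsto_log_atTop.eventually_ge_atTop (|r| * Real.log 2 / (1 - r))
  filter_upwards [h1, h2, h3, eventually_gt_atTop 1] with x h1 h2 h3 hx
  have hlog : 0 < Real.log x := Real.log_pos hx
  have hlog' : 0 < Real.log (x + 1) := Real.log_pos (by linarith)
  constructor
  · rw [Real.norm_of_nonneg hlog.le, Real.norm_of_nonneg (by positivity)] at h1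
    have : x ^ (1 / 16 : ℝ) ≤ (x + 1) ^ (1 / 16 : ℝ) := by
      gcongr
      linarith
    linarith
  · rw [le_div_iff₀ hlog']
    rw [div_le_iff₀ (by linarith)] at h3
    rcases le_total r 0 with h | h
    · nlinarith
    · rw [abs_of_nonneg h] at h3
      have : Real.log (x + 1) ≤ Real.log 2 + Real.log x := by
        rw [← Real.log_mul (by norm_num) (by linarith)]
        exact Real.log_le_log (by linarith) (by linarith)
      nlinarith

theorem wellapproximable_nondense_times_n (n : ℤ) (hn : 2 ≤ n) :
    dimH {s : ℝ |
      closure (Set.range fun k : ℕ => (fun x : Circ => n • x)^[k] (s : Circ)) ≠ Set.univ ∧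
      ¬ BadlyApproximable1 s} = 1 := by
  refine le_antisymm ((dimH_mono (subset_univ _)).trans Real.dimH_univ.le) ?_
  lift n to ℕ using by omega
  have hn' : 2 ≤ n := by exact_mod_cast hn
  refine ENNReal.le_of_forall_nnreal_lt fun r hr => ?_
  have hr1 : (r : ℝ) < 1 := by exact_mod_cast hr
  have hpow : Tendsto (fun m : ℕ => ((n ^ m - 1 : ℕ) : ℝ)) atTop atTop :=
    tendsto_natCast_atTop_atTop.comp
      ((tendsto_sub_atTop_nat 1).comp (tendsto_pow_atTop_atTop_of_one_lt hn'))
  obtain ⟨m, ⟨hS, hα⟩, hm⟩ := ((hpow.eventually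
    (eventually_log_le_rpow_and_le_log_div_log hr1)).and (hpow.eventually_ge_atTop 2)).exists
  have hbn : n ^ m - 1 + 1 = n ^ m := Nat.sub_add_cancel (Nat.one_le_pow _ _ (by omega))
  set b := n ^ m - 1
  have hb : 2 ≤ b := by exact_mod_cast hm
  calc (r : ℝ≥0∞) = ENNReal.ofReal r := (ENNReal.ofReal_coe_nnreal).symm
    _ ≤ ENNReal.ofReal (Real.log b / Real.log (b + 1)) := ENNReal.ofReal_le_ofReal hα
    _ ≤ _ := le_dimH_image_digitSpread hb (ae_not_badlyApproximable_digitSpread hb hS)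
    _ ≤ _ := by
        refine dimH_mono ?_
        rintro _ ⟨y, hy, rfl⟩
        exact ⟨closure_orbit_digitSpread_ne_univ hn' (by omega) hbn y, hy.2⟩
end
end

section
/- Let n ∈ ℤ, n ≥ 2, and let S ⊆ 𝕋 be a finite set. Then the set {s ∈ 𝕋 : the closure of 𝒪^ℕ_{T_n}(s) in 𝕋 is disjoint from S} has Hausdorff dimension 1. -/
open MeasureTheory Matrix Filter Set
open scoped ENNReal

noncomputable section

/-- Given finitely many centres modulo `1`, at most `h * #R` of the base `n ^ h` digits `3 * g` allow
a point of the corresponding subinterval of `[c, c + 1]`, once divided by `n ^ h`, to come close to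
a centre under multiplication by some `n ^ t` with `t < h`. -/
theorem exists_avoiding_digits {n h : ℕ} (hn : 2 ≤ n) (R : Finset ℝ) (c : ℝ) :
    ∃ G : Finset ℕ, n ^ h / 3 - h * R.card ≤ G.card ∧ ∀ g ∈ G, 3 * g + 1 ≤ n ^ h ∧
      ∀ u ∈ Icc ((3 * g : ℝ) / n ^ h) ((3 * g + 1) / n ^ h), ∀ t < h, ∀ s ∈ R, ∀ j : ℤ,
        1 / ((n : ℝ) ^ h) ^ 2 ≤ |(c + u) * n ^ t / n ^ h - s - j| := by
  classical
  let P : ℕ → ℕ × ℝ → Prop := fun g q =>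
    ∃ u ∈ Icc ((3 * g : ℝ) / n ^ h) ((3 * g + 1) / n ^ h), ∃ j : ℤ,
      |(c + u) * n ^ q.1 / n ^ h - q.2 - j| < 1 / ((n : ℝ) ^ h) ^ 2
  let D := Finset.range (n ^ h / 3)
  let B := (Finset.range h ×ˢ R).biUnion fun q => D.filter fun g => P g q
  have hn' : (2 : ℝ) ≤ n := by exact_mod_cast hn
  have hD : ∀ g ∈ D, 3 * g + 1 ≤ n ^ h := by
    intro g hg
    have := Finset.mem_range.1 hg
    omega
  have hB : B.card ≤ h * R.card := by
    refine (Finset.card_biUnion_le_card_mul _ _ 1 ?_).trans (by simp)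
    rintro ⟨t, s⟩ hq
    have ht : t < h := by simpa using (Finset.mem_product.1 hq).1
    rw [Finset.card_le_one]
    intro g hg g' hg'
    obtain ⟨hgD, u, hu, j, hj⟩ := Finset.mem_filter.1 hg
    obtain ⟨hgD', u', hu', j', hj'⟩ := Finset.mem_filter.1 hg'
    have hM : (n : ℝ) ^ h = n ^ t * n ^ (h - t) := by rw [← pow_add]; congr 1; omega
    have h1 : (3 * g + 1 : ℝ) ≤ n ^ h := by exact_mod_cast hD g hgD
    have h1' : (3 * g' + 1 : ℝ) ≤ n ^ h := by exact_mod_cast hD g' hgD'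
    have hp : (2 : ℝ) ≤ n ^ (h - t) :=
      hn'.trans (le_self_pow₀ (by linarith) (by omega))
    have hA : (1 : ℝ) ≤ n ^ t := one_le_pow₀ (by linarith)
    simp only [mem_Icc] at hu hu' hj hj'
    generalize hMM : (n : ℝ) ^ h = M at *
    generalize (n : ℝ) ^ (h - t) = p at *
    generalize (n : ℝ) ^ t = A at *
    have hM2 : 2 ≤ M := by nlinarith
    have hpM : p ≤ M := by nlinarith
    have hM0 : 0 < M := by linarith
    have key : ∀ (v : ℝ) (i : ℤ), |(c + v) * A / M - s - i| < 1 / M ^ 2 →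
        |c + v - (s + i) * p| < 1 / M := by
      intro v i hv
      have hp0 : 0 < p := by linarith
      have hA0 : A ≠ 0 := by positivity
      have e : c + v - (s + i) * p = ((c + v) * A / M - s - i) * p := by
        rw [hM]; field_simp; ring
      rw [e, abs_mul, abs_of_pos hp0]
      calc _ < 1 / M ^ 2 * p := by gcongr
        _ ≤ 1 / M ^ 2 * M := by gcongr
        _ = 1 / M := by field_simp
    have k1 := abs_lt.1 (key u j hj)
    have k2 := abs_lt.1 (key u' j' hj')
    have hMi : 1 / M ≤ 1 / 2 := by gcongr
    have hu0 : 0 ≤ u := le_trans (by positivity) hu.1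
    have hu0' : 0 ≤ u' := le_trans (by positivity) hu'.1
    have hu1 : u ≤ 1 := hu.2.trans ((div_le_one hM0).2 h1)
    have hu1' : u' ≤ 1 := hu'.2.trans ((div_le_one hM0).2 h1')
    have hjj : j = j' := by
      by_contra hne
      rcases lt_or_gt_of_ne hne with hlt | hlt
      · have : (j : ℝ) + 1 ≤ j' := by exact_mod_cast hlt
        nlinarith [mul_nonneg (sub_nonneg.2 this) (by linarith : (0 : ℝ) ≤ p)]
      · have : (j' : ℝ) + 1 ≤ j := by exact_mod_cast hlt
        nlinarith [mul_nonneg (sub_nonneg.2 this) (by linarith : (0 : ℝ) ≤ p)]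
    subst hjj
    have d1 : u - u' < 2 / M := by
      have : 2 / M = 1 / M + 1 / M := by ring
      linarith
    have d2 : u' - u < 2 / M := by
      have : 2 / M = 1 / M + 1 / M := by ring
      linarith
    have f1 := (div_le_iff₀ hM0).1 hu.1
    have f2 := (le_div_iff₀ hM0).1 hu.2
    have f3 := (div_le_iff₀ hM0).1 hu'.1
    have f4 := (le_div_iff₀ hM0).1 hu'.2
    rw [lt_div_iff₀ hM0] at d1 d2
    have g1 : (3 * g : ℝ) < 3 * g' + 3 := by linarith
    have g2 : (3 * g' : ℝ) < 3 * g + 3 := by linarith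
    norm_cast at g1 g2
    omega
  refine ⟨D \ B, ?_, fun g hg => ?_⟩
  · have := Finset.le_card_sdiff B D
    have hc : D.card = n ^ h / 3 := Finset.card_range _
    omega
  · obtain ⟨hgD, hgB⟩ := Finset.mem_sdiff.1 hg
    refine ⟨hD g hgD, fun u hu t ht s hs j => ?_⟩
    by_contra! hlt
    exact hgB (Finset.mem_biUnion.2 ⟨(t, s), by simp [ht, hs],
      Finset.mem_filter.2 ⟨hgD, u, hu, j, hlt⟩⟩)

/-- Exponential growth beats any slower exponential together with a linear term. -/
theorem exists_pow_rpow_le {n : ℕ} (hn : 2 ≤ n) (m : ℕ) {r : ℝ} (hr0 : 0 < r) (hr1 : r < 1) :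
    ∃ h b : ℕ, 1 ≤ h ∧ 1 < b ∧ b ≤ n ^ h / 3 - h * m ∧ ((n : ℝ) ^ h) ^ r ≤ b := by
  have hn' : (1 : ℝ) < n := by exact_mod_cast hn
  have hlt : (n : ℝ) ^ r < (n : ℝ) := by
    simpa using Real.rpow_lt_rpow_of_exponent_lt hn' hr1
  have e1 := (isLittleO_pow_pow_of_lt_left (by positivity) hlt).def
    (show (0 : ℝ) < 1 / 10 by norm_num)
  have e2 := (isLittleO_coe_const_pow_of_one_lt (R := ℝ) hn').def
    (show (0 : ℝ) < 1 / (10 * (m + 1)) by positivity)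
  have e3 := (tendsto_pow_atTop_atTop_of_one_lt hn').eventually_ge_atTop 10
  obtain ⟨h, h1, h2, h3, h4⟩ := (e1.and (e2.and (e3.and (eventually_ge_atTop 1)))).exists
  rw [Real.norm_of_nonneg (by positivity), Real.norm_of_nonneg (by positivity)] at h1 h2
  have hcomm : ((n : ℝ) ^ h) ^ r = ((n : ℝ) ^ r) ^ h := by
    exact (Real.rpow_pow_comm (by positivity) r h).symm
  have h2' : (h : ℝ) * (m + 1) ≤ n ^ h / 10 := by
    calc (h : ℝ) * (m + 1) ≤ 1 / (10 * (m + 1)) * n ^ h * (m + 1) := by gcongr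
      _ = n ^ h / 10 := by field_simp
  have hdiv : (n : ℝ) ^ h ≤ 3 * (n ^ h / 3 : ℕ) + 2 := by
    have : n ^ h ≤ 3 * (n ^ h / 3) + 2 := by omega
    exact_mod_cast this
  have hsub : ((n ^ h / 3 : ℕ) : ℝ) ≤ (n ^ h / 3 - h * m : ℕ) + h * m := by
    have : n ^ h / 3 ≤ (n ^ h / 3 - h * m) + h * m := by omega
    exact_mod_cast this
  have hle : ((n : ℝ) ^ h) ^ r ≤ (n ^ h / 3 - h * m : ℕ) := by
    rw [hcomm]
    have : (0 : ℝ) ≤ h := by positivity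
    nlinarith
  have hone : (1 : ℝ) < ((n : ℝ) ^ h) ^ r :=
    Real.one_lt_rpow (by linarith) hr0
  exact ⟨h, _, h4, by exact_mod_cast hone.trans_le hle, le_rfl, hle⟩

/-- The index of the base `M` interval reached after `i` steps along the path `a`, when `E c`
selects the children of the interval of index `c`. -/
def treeIndex {b : ℕ} (M : ℕ) (E : ℕ → Fin b → ℕ) (a : ℕ → Fin b) : ℕ → ℕ
  | 0 => 0
  | i + 1 => M * treeIndex M E a i + E (treeIndex M E a i) (a i)

/-- The point of `[0, 1 / M]` determined by the path `a`. -/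
def treePoint {b : ℕ} (M : ℕ) (E : ℕ → Fin b → ℕ) (a : ℕ → Fin b) : ℝ :=
  ⨆ i, (treeIndex M E a i : ℝ) / (M : ℝ) ^ (i + 1)

section Tree

variable {b M : ℕ} {E : ℕ → Fin b → ℕ}

theorem treePoint_mem (hM : 0 < M) (hE : ∀ c x, E c x + 1 ≤ M) (a : ℕ → Fin b) (i : ℕ) :
    treePoint M E a ∈ Icc ((treeIndex M E a i : ℝ) / (M : ℝ) ^ (i + 1))
      ((treeIndex M E a i + 1 : ℝ) / (M : ℝ) ^ (i + 1)) := by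
  have hM' : (0 : ℝ) < M := by exact_mod_cast hM
  refine mem_iInter.1 (ciSup_mem_iInter_Icc_of_antitone_Icc
    (f := fun i => (treeIndex M E a i : ℝ) / (M : ℝ) ^ (i + 1))
    (g := fun i => (treeIndex M E a i + 1 : ℝ) / (M : ℝ) ^ (i + 1))
    (antitone_nat_of_succ_le fun i => ?_) fun i => by gcongr; linarith) i
  have hc : (treeIndex M E a (i + 1) : ℝ)
      = M * treeIndex M E a i + E (treeIndex M E a i) (a i) := by
    simp [treeIndex]
  have h1 : (E (treeIndex M E a i) (a i) + 1 : ℝ) ≤ M := by exact_mod_cast hE _ _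
  refine Icc_subset_Icc ?_ ?_
  · rw [hc, pow_succ _ (i + 1), div_le_div_iff₀ (by positivity) (by positivity)]
    have : (0 : ℝ) ≤ E (treeIndex M E a i) (a i) * (M : ℝ) ^ (i + 1) := by positivity
    nlinarith
  · rw [hc, pow_succ _ (i + 1), div_le_div_iff₀ (by positivity) (by positivity)]
    have : (0 : ℝ) ≤ (M : ℝ) ^ (i + 1) := by positivity
    nlinarith [mul_le_mul_of_nonneg_right h1 this]

theorem treeIndex_congr {a a' : ℕ → Fin b} {i : ℕ} (h : ∀ k < i, a k = a' k) :
    treeIndex M E a i = treeIndex M E a' i := by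
  induction i with
  | zero => rfl
  | succ i ih =>
    simp only [treeIndex]
    rw [ih fun k hk => h k (by omega), h i (by omega)]

theorem treePoint_separated (hM : 0 < M) (hE : ∀ c x, E c x + 1 ≤ M)
    (hsep : ∀ c x y, x ≠ y → E c x + 2 ≤ E c y ∨ E c y + 2 ≤ E c x)
    {a a' : ℕ → Fin b} {i : ℕ} (h : ∀ k < i, a k = a' k) (hi : a i ≠ a' i) :
    1 / (M : ℝ) ^ (i + 2) ≤ |treePoint M E a - treePoint M E a'| := by
  have key : ∀ a a' : ℕ → Fin b, treeIndex M E a (i + 1) + 2 ≤ treeIndex M E a' (i + 1) →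
      1 / (M : ℝ) ^ (i + 2) ≤ treePoint M E a' - treePoint M E a := by
    intro a a' hlt
    have h1 := (treePoint_mem hM hE a (i + 1)).2
    have h2 := (treePoint_mem hM hE a' (i + 1)).1
    have hlt' : (treeIndex M E a (i + 1) + 2 : ℝ) ≤ treeIndex M E a' (i + 1) := by
      exact_mod_cast hlt
    calc 1 / (M : ℝ) ^ (i + 2)
        ≤ (treeIndex M E a' (i + 1) - (treeIndex M E a (i + 1) + 1)) / (M : ℝ) ^ (i + 2) := by
          gcongr; linarith
      _ ≤ _ := by rw [sub_div]; linarith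
  have e := treeIndex_congr (M := M) (E := E) h
  rcases hsep (treeIndex M E a i) _ _ hi with h' | h'
  · rw [abs_sub_comm]
    refine (key a a' ?_).trans (le_abs_self _)
    simp only [treeIndex, ← e]
    omega
  · refine (key a' a ?_).trans (le_abs_self _)
    simp only [treeIndex, ← e]
    omega

theorem dist_coe_treePoint (hM : 2 ≤ M) (hE : ∀ c x, E c x + 1 ≤ M) (a a' : ℕ → Fin b) :
    dist (treePoint M E a : Circ) (treePoint M E a' : Circ)
      = |treePoint M E a - treePoint M E a'| := by
  rw [dist_eq_norm, ← AddCircle.coe_sub, AddCircle.norm_coe_eq_abs_iff _ one_ne_zero]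
  have h1 := treePoint_mem (by omega) hE a 0
  have h2 := treePoint_mem (by omega) hE a' 0
  have hM' : 1 / (M : ℝ) ≤ 1 / 2 := by gcongr; exact_mod_cast hM
  simp only [treeIndex, Nat.cast_zero, zero_div, zero_add, pow_one, mem_Icc] at h1 h2
  rw [abs_le, abs_one]
  constructor <;> linarith

/-- If each interval has `b ≥ M ^ r` separated children, the limit set has dimension at least
`r`. -/
theorem le_dimH_range_treePoint (hM : 2 ≤ M) (hE : ∀ c x, E c x + 1 ≤ M)
    (hsep : ∀ c x y, x ≠ y → E c x + 2 ≤ E c y ∨ E c y + 2 ≤ E c x)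
    (hb : 1 < b) {r : NNReal} (hr : 0 < r) (hrb : (M : ℝ) ^ (r : ℝ) ≤ b) :
    (r : ℝ≥0∞) ≤ dimH (range fun a : ℕ → Fin b => (treePoint M E a : Circ)) := by
  have : Nonempty (Fin b) := ⟨⟨0, by omega⟩⟩
  set F : (ℕ → Fin b) → Circ := fun a => (treePoint M E a : Circ)
  have hM0 : (0 : ℝ) < M := by exact_mod_cast (by omega : 0 < M)
  have hdist : ∀ a a', |Real.ofDigits a - Real.ofDigits a'|
      ≤ ((M : ℝ) ^ 2) ^ (r : ℝ) * dist (F a) (F a') ^ (r : ℝ) := by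
    intro a a'
    by_cases hne : a = a'
    · subst hne
      simp only [sub_self, abs_zero]
      positivity
    classical
    have hex : ∃ i, a i ≠ a' i := Function.ne_iff.1 hne
    have hlt : ∀ k < Nat.find hex, a k = a' k := fun k hk => not_not.1 (Nat.find_min hex hk)
    set i := Nat.find hex
    have hs := treePoint_separated (by omega) hE hsep hlt (Nat.find_spec hex)
    rw [← dist_coe_treePoint hM hE] at hs
    calc |Real.ofDigits a - Real.ofDigits a'| ≤ ((b : ℝ) ^ i)⁻¹ :=
          Real.abs_ofDigits_sub_ofDigits_le hlt
      _ ≤ (((M : ℝ) ^ (r : ℝ)) ^ i)⁻¹ := by gcongr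
      _ = ((M : ℝ) ^ 2) ^ (r : ℝ) * (1 / (M : ℝ) ^ (i + 2)) ^ (r : ℝ) := by
          rw [← Real.mul_rpow (by positivity) (by positivity), 
            Real.rpow_pow_comm hM0.le, ← Real.inv_rpow (by positivity)]
          congr 1
          field_simp
          ring
      _ ≤ _ := by gcongr
  have hinj : Function.Injective F := by
    intro a a' h
    by_contra hne
    classical
    have hex : ∃ i, a i ≠ a' i := Function.ne_iff.1 hne
    have hs := treePoint_separated (by omega) hE hsep
      (fun k hk => not_not.1 (Nat.find_min hex hk)) (Nat.find_spec hex)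
    rw [← dist_coe_treePoint hM hE, show dist (treePoint M E a : Circ) (treePoint M E a' : Circ) = 0
      from dist_eq_zero.2 h] at hs
    exact absurd hs (not_le.2 (by positivity))
  have hold : HolderOnWith (((M : NNReal) ^ 2) ^ (r : ℝ)) r
      (Real.ofDigits ∘ Function.invFun F) (range F) := by
    rintro _ ⟨a, rfl⟩ _ ⟨a', rfl⟩
    simp only [Function.comp_apply, Function.leftInverse_invFun hinj _]
    rw [edist_dist, edist_dist, ENNReal.ofReal_rpow_of_nonneg dist_nonneg r.coe_nonneg,
      ← ENNReal.ofReal_coe_nnreal, ← ENNReal.ofReal_mul (by positivity), Real.dist_eq]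
    refine ENNReal.ofReal_le_ofReal ((hdist a a').trans_eq ?_)
    simp
  have himg : Icc (0 : ℝ) 1 ⊆ (Real.ofDigits ∘ Function.invFun F) '' range F := by
    intro y hy
    obtain ⟨a, -, rfl⟩ := Real.ofDigits_SurjOn hb hy
    exact ⟨F a, ⟨a, rfl⟩, by simp [Function.leftInverse_invFun hinj a]⟩
  have hI : dimH (Icc (0 : ℝ) 1) = 1 := by
    simpa using Real.dimH_of_nonempty_interior (s := Icc (0 : ℝ) 1) (by simp)
  have h1 : 1 ≤ dimH (range F) / r := by
    rw [← hI]
    exact (dimH_mono himg).trans (hold.dimH_image_le hr)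
  rw [ENNReal.le_div_iff_mul_le (Or.inl (by simpa using hr.ne')) (Or.inl ENNReal.coe_ne_top),
    one_mul] at h1
  exact h1

end Tree

theorem dimH_circ_le_one (s : Set Circ) : dimH s ≤ 1 := by
  have hL : LipschitzWith 1 (fun x : ℝ => (x : Circ)) := by
    refine LipschitzWith.of_dist_le_mul fun x y => ?_
    rw [dist_eq_norm, dist_eq_norm, ← AddCircle.coe_sub, NNReal.coe_one, one_mul,
      UnitAddCircle.norm_eq, Real.norm_eq_abs]
    simpa using round_le (x - y) 0
  calc dimH s ≤ dimH (range fun x : ℝ => (x : Circ)) := dimH_mono fun x _ => by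
        obtain ⟨y, rfl⟩ := QuotientAddGroup.mk_surjective x
        exact ⟨y, rfl⟩
    _ ≤ dimH (univ : Set ℝ) := hL.dimH_range_le
    _ = 1 := Real.dimH_univ

/-- Points whose orbit stays away from `S` by a uniform distance have dimension at least any
`r < 1`. -/
theorem le_dimH_nondense {n : ℕ} (hn : 2 ≤ n) {S : Set Circ} (hS : S.Finite) {r : NNReal}
    (hr0 : 0 < r) (hr1 : r < 1) :
    (r : ℝ≥0∞) ≤ dimH {s : Circ |
      closure (Set.range fun k : ℕ => (fun x : Circ => (n : ℤ) • x)^[k] s) ∩ S = ∅} := by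
  classical
  obtain ⟨R, hR⟩ : ∃ R : Finset ℝ, ∀ s ∈ S, ∃ x ∈ R, (x : Circ) = s := by
    refine ⟨hS.toFinset.image Quotient.out, fun s hs =>
      ⟨Quotient.out s, Finset.mem_image_of_mem _ (hS.mem_toFinset.2 hs), Quotient.out_eq s⟩⟩
  obtain ⟨h, b, hh, hb, hbG, hrb⟩ := exists_pow_rpow_le hn R.card hr0 (by exact_mod_cast hr1)
  choose G hGc hG using fun c : ℕ => exists_avoiding_digits (h := h) hn R (c : ℝ)
  have hemb : ∀ c, ∃ e : Fin b → ℕ, Function.Injective e ∧ ∀ x, e x ∈ G c := by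
    intro c
    refine ⟨fun x => (G c).orderEmbOfCardLe (hbG.trans (hGc c)) x,
      ((G c).orderEmbOfCardLe (hbG.trans (hGc c))).injective,
      fun x => Finset.orderEmbOfCardLe_mem _ _ _⟩
  choose e hei heG using hemb
  set M := n ^ h with hMdef
  let E : ℕ → Fin b → ℕ := fun c x => 3 * e c x
  have hE : ∀ c x, E c x + 1 ≤ M := fun c x => (hG c _ (heG c x)).1
  have hsep : ∀ c x y, x ≠ y → E c x + 2 ≤ E c y ∨ E c y + 2 ≤ E c x := by
    intro c x y hxy
    have : e c x ≠ e c y := fun h => hxy (hei c h)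
    simp only [E]
    omega
  have hM2 : 2 ≤ M := hn.trans (Nat.le_self_pow (by omega) n)
  have hM0 : (0 : ℝ) < M := by exact_mod_cast (by omega : 0 < M)
  refine (le_dimH_range_treePoint hM2 hE hsep hb hr0 (by simpa [hMdef] using hrb)).trans
    (dimH_mono ?_)
  rintro _ ⟨a, rfl⟩
  have hfar : ∀ (k : ℕ), ∀ s ∈ R, ∀ j : ℤ,
      1 / (M : ℝ) ^ 2 ≤ |(n : ℝ) ^ k * treePoint M E a - s - j| := by
    intro k s hs j
    set i := k / h
    set c := treeIndex M E a i
    have hk : k = h * i + k % h := (Nat.div_add_mod k h).symm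
    have ht : k % h < h := Nat.mod_lt _ hh
    have hx := treePoint_mem (by omega) hE a (i + 1)
    set x := treePoint M E a
    have hc : (treeIndex M E a (i + 1) : ℝ) = M * c + 3 * e c (a i) := by
      simp [treeIndex, E, c]
    rw [hc, mem_Icc, div_le_iff₀ (by positivity), le_div_iff₀ (by positivity)] at hx
    have hu : x * (M : ℝ) ^ (i + 1) - c ∈
        Icc ((3 * e c (a i) : ℝ) / n ^ h) ((3 * e c (a i) + 1) / n ^ h) := by
      have : (n : ℝ) ^ h = M := by simp [hMdef]
      rw [this, mem_Icc, div_le_iff₀ hM0, le_div_iff₀ hM0]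
      have e1 : (x * (M : ℝ) ^ (i + 1) - c) * M = x * (M : ℝ) ^ (i + 1 + 1) - M * c := by ring
      rw [e1]
      constructor <;> linarith [hx.1, hx.2]
    have := (hG c _ (heG c (a i))).2 _ hu _ ht s hs j
    have hcast : (n : ℝ) ^ h = M := by simp [hMdef]
    rw [hcast] at this
    convert this using 4
    have hk' : (n : ℝ) ^ k = M ^ i * n ^ (k % h) := by
      rw [← hcast, ← pow_mul, ← pow_add, ← hk]
    rw [hk']
    field_simp
    ring
  rw [mem_ofPred_eq, ← disjoint_iff_inter_eq_empty, Set.disjoint_left]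
  intro z hz hzS
  obtain ⟨s, hsR, rfl⟩ := hR z hzS
  obtain ⟨_, ⟨k, rfl⟩, hk⟩ := Metric.mem_closure_iff.1 hz (1 / (M : ℝ) ^ 2) (by positivity)
  have hit : (fun x : Circ => (n : ℤ) • x)^[k] (treePoint M E a : Circ)
      = (((n : ℝ) ^ k * treePoint M E a : ℝ) : Circ) := by
    rw [smul_iterate_apply]
    rw [← AddCircle.coe_zsmul]
    congr 1
    simp
  have hd := hfar k s hsR (round ((n : ℝ) ^ k * treePoint M E a - s))
  simp only [hit] at hk
  rw [dist_comm, dist_eq_norm, ← AddCircle.coe_sub, UnitAddCircle.norm_eq] at hk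
  exact absurd hk (not_lt.2 hd)

theorem nondense_times_n_full_dim (n : ℤ) (hn : 2 ≤ n) (S : Set Circ) (hS : S.Finite) :
    dimH {s : Circ |
      closure (Set.range fun k : ℕ => (fun x : Circ => n • x)^[k] s) ∩ S = ∅} = 1 := by
  lift n to ℕ using by omega
  refine le_antisymm (dimH_circ_le_one _) (ENNReal.le_of_forall_nnreal_lt fun r hr => ?_)
  rcases eq_or_ne r 0 with rfl | hr0
  · simp
  · exact le_dimH_nondense (by exact_mod_cast hn) hS (pos_iff_ne_zero.2 hr0)
      (by exact_mod_cast hr)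
end
end

section
/- Let α ∈ SL₂(ℤ) be hyperbolic and let S ⊆ 𝕋² be a finite set. Then the set {s ∈ 𝕋² : the closure of 𝒪^ℤ_{T_α}(s) in 𝕋² is disjoint from S} has Hausdorff dimension 2. -/
open MeasureTheory Matrix Filter Set
open scoped ENNReal

noncomputable section

abbrev SL2Z := Matrix.SpecialLinearGroup (Fin 2) ℤ

/-- The `2`-torus `𝕋² = ℝ²/ℤ²`. -/
abbrev Torus2 := Circ × Circ

/-- The endomorphism of `𝕋²` induced by an integer matrix `β`. -/
def torusEndo (β : Matrix (Fin 2) (Fin 2) ℤ) (x : Torus2) : Torus2 :=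
  (β 0 0 • x.1 + β 0 1 • x.2, β 1 0 • x.1 + β 1 1 • x.2)

/-- The automorphism `T_β` of `𝕋²` induced by `β ∈ SL₂(ℤ)`. -/
def Tmat (β : SL2Z) : Torus2 → Torus2 := torusEndo (β : Matrix (Fin 2) (Fin 2) ℤ)

/-- A matrix `α ∈ SL₂(ℤ)` is hyperbolic iff `|tr α| > 2`. -/
def IsHyperbolic (α : SL2Z) : Prop := 2 < |Matrix.trace (α : Matrix (Fin 2) (Fin 2) ℤ)|

open scoped Topology NNReal

/-- Among the even slots of length `1 / Λ` in `[a, a + 1]`, at least `k` avoid the sets `B i`. -/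
lemma exists_injective_slots_avoiding {ι : Type*} [Fintype ι] {Λ : ℝ} (hΛ : 0 < Λ) {B : ι → Set ℝ}
    (hB : ∀ i, ∀ x ∈ B i, ∀ y ∈ B i, |x - y| ≤ 1 → |x - y| < 1 / Λ) {k : ℕ}
    (hk : 2 * ((k : ℝ) + Fintype.card ι) ≤ Λ) (a : ℝ) :
    ∃ σ : Fin k → ℕ, Function.Injective σ ∧ (∀ r, 2 * (σ r : ℝ) + 2 ≤ Λ) ∧
      ∀ r, ∀ v ∈ Icc (Λ * a + 2 * σ r) (Λ * a + 2 * σ r + 1), ∀ i, v / Λ ∉ B i := by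
  classical
  set n := k + Fintype.card ι with hn
  let P : ℕ → Prop := fun r ↦
    ∀ v ∈ Icc (Λ * a + 2 * (r : ℝ)) (Λ * a + 2 * r + 1), ∀ i, v / Λ ∉ B i
  have hlt : ∀ r ∈ Finset.range n, 2 * (r : ℝ) + 2 ≤ Λ := by
    intro r hr
    have h1 : (r : ℝ) + 1 ≤ k + Fintype.card ι := by
      exact_mod_cast Finset.mem_range.1 hr
    linarith
  have hbad : ((Finset.range n).filter (fun r ↦ ¬ P r)).card ≤ Fintype.card ι := by
    have hex : ∀ r : (Finset.range n).filter (fun r ↦ ¬ P r), ∃ i, ∃ v : ℝ,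
        v ∈ Icc (Λ * a + 2 * (r : ℝ)) (Λ * a + 2 * r + 1) ∧ v / Λ ∈ B i := by
      intro r
      have := (Finset.mem_filter.1 r.2).2
      simp only [P] at this
      push Not at this
      obtain ⟨v, hv, i, hi⟩ := this
      exact ⟨i, v, hv, hi⟩
    choose f v hv hf using hex
    have key : ∀ r r', f r = f r' → ¬ r < r' := by
      intro r r' h hlt'
      have h1 := hv r
      have h2 := hv r'
      have h3 := hlt r' (Finset.mem_filter.1 r'.2).1
      have hle : ((r : ℕ) : ℝ) + 1 ≤ (r' : ℕ) := by exact_mod_cast hlt'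
      have hr0 : (0 : ℝ) ≤ (r : ℕ) := Nat.cast_nonneg _
      have e : |v r' / Λ - v r / Λ| = (v r' - v r) / Λ := by
        rw [← sub_div, abs_of_nonneg]
        exact div_nonneg (by linarith [h1.2, h2.1]) hΛ.le
      have h4 := hB _ _ (h ▸ hf r') _ (hf r) (by
        rw [e, div_le_one hΛ]; linarith [h1.1, h2.2])
      rw [e, div_lt_div_iff_of_pos_right hΛ] at h4
      linarith [h1.2, h2.1]
    rw [← Fintype.card_coe]
    refine Fintype.card_le_of_injective f fun r r' h ↦ ?_
    exact le_antisymm (not_lt.1 (key r' r h.symm)) (not_lt.1 (key r r' h))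
  have hgood : k ≤ ((Finset.range n).filter P).card := by
    have := Finset.card_filter_add_card_filter_not (s := Finset.range n) P
    rw [Finset.card_range] at this
    omega
  obtain ⟨t, ht, htk⟩ := Finset.exists_subset_card_eq hgood
  refine ⟨t.orderEmbOfFin htk, (t.orderEmbOfFin htk).injective, fun r ↦ ?_, fun r ↦ ?_⟩
  · exact hlt _ (Finset.mem_filter.1 (ht (t.orderEmbOfFin_mem htk r))).1
  · exact (Finset.mem_filter.1 (ht (t.orderEmbOfFin_mem htk r))).2

/-- A Cantor set, coded by digit sequences, all of whose dilates by powers of `Λ` avoid the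
sets `B i`. -/
lemma exists_separated_coding_avoiding {ι : Type*} [Fintype ι] {Λ : ℝ} (hΛ : 0 < Λ)
    {B : ι → Set ℝ}
    (hB : ∀ i, ∀ x ∈ B i, ∀ y ∈ B i, |x - y| ≤ 1 → |x - y| < 1 / Λ) {k : ℕ}
    (hk : 2 * ((k : ℝ) + Fintype.card ι) ≤ Λ) :
    ∃ x : (ℕ → Fin k) → ℝ, (∀ w, x w ∈ Icc (0 : ℝ) 1) ∧ (∀ w n i, Λ ^ n * x w ∉ B i) ∧
      ∀ w w' n, (∀ j < n, w j = w' j) → w n ≠ w' n → 1 ≤ Λ ^ (n + 1) * |x w - x w'| := by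
  choose σ hinj hσ hav using exists_injective_slots_avoiding hΛ hB hk
  let a : (ℕ → Fin k) → ℕ → ℝ := fun w n ↦ Nat.rec 0 (fun n b ↦ Λ * b + 2 * σ b (w n)) n
  have a0 : ∀ w, a w 0 = 0 := fun w ↦ rfl
  have as : ∀ w n, a w (n + 1) = Λ * a w n + 2 * σ (a w n) (w n) := fun w n ↦ rfl
  have hmono : ∀ w, Monotone fun n ↦ a w n / Λ ^ n := by
    refine fun w ↦ monotone_nat_of_le_succ fun n ↦ ?_
    rw [div_le_div_iff₀ (by positivity) (by positivity), as, pow_succ]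
    have : (0 : ℝ) ≤ 2 * σ (a w n) (w n) * Λ ^ n := by positivity
    linarith
  have hanti : ∀ w, Antitone fun n ↦ (a w n + 1) / Λ ^ n := by
    refine fun w ↦ antitone_nat_of_succ_le fun n ↦ ?_
    rw [div_le_div_iff₀ (by positivity) (by positivity), as, pow_succ]
    have h := hσ (a w n) (w n)
    have : (2 * (σ (a w n) (w n) : ℝ) + 1) * Λ ^ n ≤ Λ * Λ ^ n := by gcongr; linarith
    linarith
  have hmem : ∀ w n, Λ ^ n * (⨆ n, a w n / Λ ^ n) ∈ Icc (a w n) (a w n + 1) := by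
    intro w n
    have h := (hmono w).ciSup_mem_iInter_Icc_of_antitone (hanti w)
      (fun n ↦ by dsimp only; gcongr; linarith)
    have h := mem_iInter.1 h n
    have hp : 0 < Λ ^ n := by positivity
    exact ⟨by have := (div_le_iff₀ hp).1 h.1; linarith, by
      have := (le_div_iff₀ hp).1 h.2; linarith⟩
  refine ⟨fun w ↦ ⨆ n, a w n / Λ ^ n, fun w ↦ by simpa [a0] using hmem w 0, ?_, ?_⟩
  · intro w n i
    have h := hmem w (n + 1)
    rw [as] at h
    have := hav _ _ _ h i
    rwa [pow_succ, mul_right_comm, mul_div_assoc, div_self hΛ.ne', mul_one] at this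
  · intro w w' n hagree hne
    have haa : ∀ m ≤ n, a w m = a w' m := by
      intro m
      induction m with
      | zero => intro; rfl
      | succ m ih =>
        intro hm
        rw [as, as, ih (by omega), hagree m (by omega)]
    have h := hmem w (n + 1)
    have h' := hmem w' (n + 1)
    rw [as, haa n le_rfl] at h
    rw [as] at h'
    have hne' : σ (a w' n) (w n) ≠ σ (a w' n) (w' n) := fun h ↦ hne (hinj _ h)
    dsimp only
    rw [← abs_of_pos (show 0 < Λ ^ (n + 1) by positivity), ← abs_mul, mul_sub, le_abs]
    rcases lt_or_gt_of_ne hne' with hl | hl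
    · have : (σ (a w' n) (w n) : ℝ) + 1 ≤ σ (a w' n) (w' n) := by exact_mod_cast hl
      right
      linarith [h.2, h'.1]
    · have : (σ (a w' n) (w' n) : ℝ) + 1 ≤ σ (a w' n) (w n) := by exact_mod_cast hl
      left
      linarith [h'.2, h.1]

/-- The avoiding Cantor set is mapped onto `[0, 1]` by a Hölder function of exponent `d`. -/
lemma exists_holder_surjection_avoiding {ι : Type*} [Fintype ι] {Λ : ℝ} (hΛ : 0 < Λ)
    {B : ι → Set ℝ}
    (hB : ∀ i, ∀ x ∈ B i, ∀ y ∈ B i, |x - y| ≤ 1 → |x - y| < 1 / Λ) {k : ℕ}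
    (hk : 2 * ((k : ℝ) + Fintype.card ι) ≤ Λ) (hk1 : 1 < k) {d : ℝ≥0} (hd : 0 < d)
    (hkd : Λ ^ (d : ℝ) ≤ k) :
    ∃ (A : Set ℝ) (f : ℝ → ℝ) (C : ℝ≥0), A ⊆ Icc 0 1 ∧ (∀ x ∈ A, ∀ n i, Λ ^ n * x ∉ B i) ∧
      HolderOnWith C d f A ∧ Icc 0 1 ⊆ f '' A := by
  have : NeZero k := ⟨by omega⟩
  obtain ⟨x, hx, hxB, hsep⟩ := exists_separated_coding_avoiding hΛ hB hk
  have hfirst : ∀ w w' : ℕ → Fin k, w ≠ w' → ∃ n, (∀ j < n, w j = w' j) ∧ w n ≠ w' n := by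
    intro w w' h
    classical
    have h := Function.ne_iff.1 h
    exact ⟨Nat.find h, fun j hj ↦ not_not.1 (Nat.find_min h hj), Nat.find_spec h⟩
  have hxinj : Function.Injective x := by
    intro w w' h
    by_contra hne
    obtain ⟨n, h1, h2⟩ := hfirst w w' hne
    have := hsep w w' n h1 h2
    simp [h] at this
    linarith
  have hinv : ∀ w, Function.invFun x (x w) = w := Function.leftInverse_invFun hxinj
  refine ⟨range x, fun t ↦ Real.ofDigits (Function.invFun x t), Real.toNNReal (Λ ^ (d : ℝ)),
    range_subset_iff.2 hx, ?_, ?_, ?_⟩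
  · rintro _ ⟨w, rfl⟩
    exact hxB w
  · rintro _ ⟨w, rfl⟩ _ ⟨w', rfl⟩
    simp only [hinv]
    rw [edist_nndist, edist_nndist, ← ENNReal.coe_rpow_of_nonneg _ d.coe_nonneg, ← ENNReal.coe_mul,
      ENNReal.coe_le_coe, ← NNReal.coe_le_coe]
    push_cast
    rw [Real.coe_toNNReal (Λ ^ (d : ℝ)) (by positivity), Real.dist_eq, Real.dist_eq]
    rcases eq_or_ne w w' with rfl | hne
    · simp only [sub_self, abs_zero]; positivity
    obtain ⟨n, h1, h2⟩ := hfirst w w' hne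
    have hs := hsep w w' n h1 h2
    refine (Real.abs_ofDigits_sub_ofDigits_le h1).trans ?_
    rw [← Real.mul_rpow hΛ.le (abs_nonneg _)]
    have h3 : (Λ ^ n)⁻¹ ≤ Λ * |x w - x w'| := by
      rw [inv_le_iff_one_le_mul₀ (by positivity)]
      rw [pow_succ] at hs; linarith
    calc ((k : ℝ) ^ n)⁻¹ ≤ ((Λ ^ (d : ℝ)) ^ n)⁻¹ := by gcongr
      _ = ((Λ ^ n)⁻¹) ^ (d : ℝ) := by
        rw [Real.inv_rpow (by positivity), ← Real.rpow_natCast, ← Real.rpow_natCast,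
          ← Real.rpow_mul hΛ.le, ← Real.rpow_mul hΛ.le, mul_comm]
      _ ≤ _ := by gcongr
  · intro y hy
    obtain ⟨w, -, hw⟩ := Real.ofDigits_SurjOn hk1 hy
    exact ⟨x w, mem_range_self w, by simp only [hinv, hw]⟩

lemma exists_even_power_branching {l : ℝ} (hl : 1 < |l|) {d : ℝ} (hd0 : 0 < d) (hd1 : d < 1)
    (c : ℕ) : ∃ N k : ℕ, 0 < N ∧ 0 < l ^ N ∧ 1 < k ∧ (l ^ N) ^ d ≤ k ∧
      2 * ((k : ℝ) + (N * c : ℕ)) ≤ l ^ N := by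
  have hμ : 1 < l ^ 2 := (one_lt_sq_iff_one_lt_abs l).2 hl
  set μ := l ^ 2 with hμdef
  have hμ0 : 0 < μ := by linarith
  have h1 : Tendsto (fun m : ℕ ↦ (μ ^ (d - 1)) ^ m) atTop (𝓝 0) :=
    tendsto_pow_atTop_nhds_zero_of_lt_one (by positivity)
      (Real.rpow_lt_one_of_one_lt_of_neg hμ (by linarith))
  have h2 := tendsto_pow_const_div_const_pow_of_one_lt 0 hμ
  have h3 := tendsto_pow_const_div_const_pow_of_one_lt 1 hμ
  have h4 := ((h1.const_mul 2).add (h2.const_mul 2)).add (h3.const_mul (4 * c : ℝ))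
  simp only [mul_zero, add_zero] at h4
  obtain ⟨m, hm, hm1⟩ := ((h4.eventually_lt_const one_pos).and (eventually_ge_atTop 1)).exists
  have hpos : 0 < μ ^ m := by positivity
  have hN : l ^ (2 * m) = μ ^ m := by rw [hμdef, pow_mul]
  have e1 : (μ ^ (d - 1)) ^ m = (μ ^ m) ^ d / μ ^ m := by
    rw [← Real.rpow_natCast, ← Real.rpow_mul hμ0.le, ← Real.rpow_natCast, ← Real.rpow_mul hμ0.le,
      ← Real.rpow_sub hμ0]
    ring_nf
  refine ⟨2 * m, ⌈(μ ^ m) ^ d⌉₊, by omega, hN ▸ hpos, ?_, hN ▸ Nat.le_ceil _, ?_⟩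
  · rw [Nat.lt_ceil]
    exact_mod_cast Real.one_lt_rpow (one_lt_pow₀ hμ (by omega)) hd0
  · have h5 := (Nat.ceil_lt_add_one (a := (μ ^ m) ^ d) (by positivity)).le
    rw [e1] at hm
    have h6 : 2 * ((μ ^ m) ^ d + 1 + 2 * m * c) ≤ μ ^ m := by
      rw [← div_le_one hpos]
      calc _ = _ := by field_simp; ring
        _ ≤ _ := hm.le
    rw [hN]
    push_cast
    linarith

/-- One-dimensional avoidance along an injective one-parameter subgroup. -/
lemma exists_holder_surjection_orbit_avoiding {G : Type*} [NormedAddCommGroup G] (φ : ℝ →+ G)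
    (hφc : Continuous φ) (hφi : Function.Injective φ) {l : ℝ} (hl : 1 < |l|) {S : Set G}
    (hS : S.Finite) {d : ℝ≥0} (hd0 : 0 < d) (hd1 : d < 1) :
    ∃ (A : Set ℝ) (f : ℝ → ℝ) (C : ℝ≥0) (ε : ℝ), A ⊆ Icc 0 1 ∧ 0 < ε ∧
      (∀ x ∈ A, ∀ m : ℕ, ∀ s ∈ S, ε ≤ dist (φ (l ^ m * x)) s) ∧
      HolderOnWith C d f A ∧ Icc 0 1 ⊆ f '' A := by
  have := hS.fintype
  obtain ⟨N, k, hN, hΛ, hk1, hkd, hk⟩ := exists_even_power_branching hl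
    (NNReal.coe_pos.2 hd0) (by exact_mod_cast hd1) (Fintype.card S)
  set Λ := l ^ N with hΛdef
  have habs : |l| ^ N = Λ := by rw [← abs_pow, abs_of_pos hΛ]
  obtain ⟨ε, hε, hmin⟩ : ∃ ε > 0, ∀ t : ℝ, |t| ≤ Λ → ‖φ t‖ < 2 * ε → |t| < 1 / Λ := by
    have hcomp : IsCompact {t : ℝ | |t| ≤ Λ ∧ 1 / Λ ≤ |t|} := by
      refine (isCompact_Icc (a := -Λ) (b := Λ)).of_isClosed_subset ?_ fun t ht ↦ abs_le.1 ht.1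
      exact (isClosed_le continuous_abs continuous_const).inter
        (isClosed_le continuous_const continuous_abs)
    obtain hemp | hne := {t : ℝ | |t| ≤ Λ ∧ 1 / Λ ≤ |t|}.eq_empty_or_nonempty
    · refine ⟨1, one_pos, fun t ht _ ↦ ?_⟩
      by_contra h
      exact (hemp ▸ (⟨ht, not_lt.1 h⟩ : t ∈ {t : ℝ | |t| ≤ Λ ∧ 1 / Λ ≤ |t|}) : t ∈ (∅ : Set ℝ))
    · obtain ⟨t₀, ht₀, hmin⟩ := hcomp.exists_isMinOn hne hφc.norm.continuousOn
      have ht0 : t₀ ≠ 0 := by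
        rintro rfl
        have : 0 < 1 / Λ := by positivity
        have := ht₀.2
        simp only [abs_zero] at this
        linarith
      have hp : 0 < ‖φ t₀‖ := norm_pos_iff.2 fun h ↦ ht0 (hφi (h.trans (map_zero φ).symm))
      refine ⟨‖φ t₀‖ / 2, by positivity, fun t ht h ↦ ?_⟩
      by_contra h'
      have := hmin (show t ∈ {t : ℝ | |t| ≤ Λ ∧ 1 / Λ ≤ |t|} from ⟨ht, not_lt.1 h'⟩)
      simp only [mem_ofPred_eq] at this
      linarith
  let B : Fin N × S → Set ℝ := fun i ↦ {v | dist (φ (l ^ (i.1 : ℕ) * v)) i.2 < ε}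
  have hB : ∀ i, ∀ x ∈ B i, ∀ y ∈ B i, |x - y| ≤ 1 → |x - y| < 1 / Λ := by
    rintro ⟨j, s⟩ x hx y hy hxy
    have h1 : 1 ≤ |l| ^ (j : ℕ) := one_le_pow₀ hl.le
    have h2 : |l| ^ (j : ℕ) ≤ Λ := habs ▸ pow_le_pow_right₀ hl.le j.2.le
    have h3 : |l ^ (j : ℕ) * (x - y)| = |l| ^ (j : ℕ) * |x - y| := by rw [abs_mul, abs_pow]
    have h4 := hmin (l ^ (j : ℕ) * (x - y)) (by
      rw [h3]
      calc _ ≤ Λ * 1 := by gcongr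
        _ = Λ := mul_one _) (by
      rw [mul_sub, map_sub, ← dist_eq_norm]
      calc _ ≤ _ := dist_triangle_right _ _ (s : G)
        _ < 2 * ε := by
          simp only [B, mem_ofPred_eq] at hx hy
          linarith)
    rw [h3] at h4
    exact (le_mul_of_one_le_left (abs_nonneg _) h1).trans_lt h4
  obtain ⟨A, f, C, hA, hAB, hf, hsurj⟩ := exists_holder_surjection_avoiding hΛ hB (k := k)
    (by simpa using hk) hk1 hd0 hkd
  refine ⟨A, f, C, ε, hA, hε, fun x hx m s hs ↦ ?_, hf, hsurj⟩
  have h := hAB x hx (m / N) (⟨m % N, Nat.mod_lt _ hN⟩, ⟨s, hs⟩)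
  simp only [B, mem_ofPred_eq, not_lt] at h
  rwa [hΛdef, ← pow_mul, ← mul_assoc, ← pow_add, Nat.mod_add_div] at h

lemma HolderOnWith.prodMap {C₁ C₂ d : ℝ≥0} {f g : ℝ → ℝ} {A B : Set ℝ}
    (hf : HolderOnWith C₁ d f A) (hg : HolderOnWith C₂ d g B) :
    HolderOnWith (max C₁ C₂) d (Prod.map f g) (A ×ˢ B) := by
  rintro ⟨x, y⟩ ⟨hx, hy⟩ ⟨x', y'⟩ ⟨hx', hy'⟩
  rw [Prod.edist_eq]
  refine max_le ((hf x hx x' hx').trans ?_) ((hg y hy y' hy').trans ?_)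
  · gcongr
    · exact le_max_left _ _
    · exact le_max_left _ _
  · gcongr
    · exact le_max_right _ _
    · exact le_max_right _ _

lemma two_mul_le_dimH_prod {C₁ C₂ d : ℝ≥0} (hd : 0 < d) {f g : ℝ → ℝ} {A B : Set ℝ}
    (hf : HolderOnWith C₁ d f A) (hg : HolderOnWith C₂ d g B)
    (hfA : Icc 0 1 ⊆ f '' A) (hgB : Icc 0 1 ⊆ g '' B) :
    2 * (d : ℝ≥0∞) ≤ dimH (A ×ˢ B) := by
  have h := (hf.prodMap hg).dimH_image_le hd
  have hsub : Icc (0 : ℝ) 1 ×ˢ Icc (0 : ℝ) 1 ⊆ Prod.map f g '' (A ×ˢ B) := by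
    rw [prodMap_image_prod]
    exact prod_mono hfA hgB
  have h2 : dimH (Icc (0 : ℝ) 1 ×ˢ Icc (0 : ℝ) 1) = 2 := by
    rw [Real.dimH_of_nonempty_interior]
    · simp
    · rw [interior_prod_eq, interior_Icc]
      exact ⟨(1 / 2, 1 / 2), by norm_num⟩
  have h3 := (h2 ▸ dimH_mono hsub).trans h
  rwa [ENNReal.le_div_iff_mul_le (Or.inl (by simpa using hd.ne')) (Or.inl ENNReal.coe_ne_top)] at h3

lemma dimH_le_dimH_image_of_antilipschitzOn {X Y : Type*} [EMetricSpace X] [EMetricSpace Y]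
    {K : ℝ≥0} {F : X → Y} {P : Set X}
    (h : ∀ p ∈ P, ∀ q ∈ P, edist p q ≤ K * edist (F p) (F q)) : dimH P ≤ dimH (F '' P) := by
  have ha : AntilipschitzWith K (P.domRestrict F) := fun p q ↦ h p p.2 q q.2
  have h1 := ha.le_dimH_image univ
  rw [image_univ, range_domRestrict] at h1
  have h2 := (isometry_subtype_coe (s := P)).dimH_image univ
  rw [image_univ, Subtype.range_coe] at h2
  rwa [h2]

lemma dimH_univ_torus_le : dimH (univ : Set Torus2) ≤ 2 := by
  let π : ℝ × ℝ → Torus2 := Prod.map (fun t ↦ (t : Circ)) (fun t ↦ (t : Circ))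
  have h1 : LipschitzWith 1 (fun t : ℝ ↦ (t : Circ)) := by
    refine LipschitzWith.of_dist_le_mul fun x y ↦ ?_
    rw [dist_eq_norm, ← AddCircle.coe_sub, NNReal.coe_one, one_mul, Real.dist_eq,
      UnitAddCircle.norm_eq]
    simpa using round_le (x - y) 0
  have h2 : LipschitzWith 1 π := by
    intro p q
    rw [Prod.edist_eq, Prod.edist_eq, ENNReal.coe_one, one_mul]
    have e1 := h1 p.1 q.1
    have e2 := h1 p.2 q.2
    rw [ENNReal.coe_one, one_mul] at e1 e2
    exact max_le_max e1 e2
  have h3 : range π = univ := by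
    refine Function.Surjective.range_eq ?_
    exact Function.Surjective.prodMap QuotientAddGroup.mk_surjective
      QuotientAddGroup.mk_surjective
  rw [← h3]
  refine h2.dimH_range_le.trans ?_
  rw [Real.dimH_univ_eq_finrank]
  simp

lemma UnitAddCircle.norm_coe_eq_abs {x : ℝ} (hx : |x| ≤ 1 / 2) : ‖(x : Circ)‖ = |x| :=
  (AddCircle.norm_coe_eq_abs_iff 1 one_ne_zero).2 (by simpa using hx)

/-- The one-parameter subgroup of the torus in the direction `(b, c)`. -/
def leafHom (b c : ℝ) : ℝ →+ Torus2 where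
  toFun t := (((t * b : ℝ) : Circ), ((t * c : ℝ) : Circ))
  map_zero' := by simp
  map_add' s t := by simp [add_mul]

lemma leafHom_apply (b c t : ℝ) :
    leafHom b c t = (((t * b : ℝ) : Circ), ((t * c : ℝ) : Circ)) := rfl

lemma continuous_leafHom (b c : ℝ) : Continuous (leafHom b c) :=
  ((AddCircle.continuous_mk' 1).comp (continuous_id.mul continuous_const)).prodMk
    ((AddCircle.continuous_mk' 1).comp (continuous_id.mul continuous_const))

lemma leafHom_injective_of_contraction {b c r : ℝ} (hb : b ≠ 0) (hr0 : r ≠ 0) (hr : |r| < 1)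
    (h : ∀ t, leafHom b c t = 0 → leafHom b c (r * t) = 0) :
    Function.Injective (leafHom b c) := by
  rw [injective_iff_map_eq_zero]
  intro t ht
  have hn : ∀ n : ℕ, leafHom b c (r ^ n * t) = 0 := by
    intro n
    induction n with
    | zero => simpa using ht
    | succ n ih => rw [pow_succ', mul_assoc]; exact h _ ih
  have hlim : Tendsto (fun n : ℕ ↦ |r ^ n * t * b|) atTop (𝓝 0) := by
    have := (((tendsto_pow_atTop_nhds_zero_of_abs_lt_one hr).mul_const t).mul_const b).abs
    simpa using this
  obtain ⟨n, hlt⟩ := (hlim.eventually_lt_const (show (0 : ℝ) < 1 / 2 by norm_num)).exists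
  have h0 := congrArg (fun p : Torus2 ↦ ‖p.1‖) (hn n)
  simp only [leafHom_apply, UnitAddCircle.norm_coe_eq_abs hlt.le, Prod.fst_zero, norm_zero,
    abs_eq_zero] at h0
  simpa [hb, hr0] using h0

lemma exists_antilipschitz_leaf_chart {b c c' : ℝ} (hb : b ≠ 0) (hc : c ≠ c') :
    ∃ η : ℝ, η ≠ 0 ∧ ∃ K : ℝ≥0, ∀ p ∈ Icc (0 : ℝ) 1 ×ˢ Icc (0 : ℝ) 1,
      ∀ q ∈ Icc (0 : ℝ) 1 ×ˢ Icc (0 : ℝ) 1,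
      edist p q ≤ K * edist (leafHom b c (η * p.1) + leafHom b c' (η * p.2))
        (leafHom b c (η * q.1) + leafHom b c' (η * q.2)) := by
  set M := |b| + |c| + |c'| with hM
  have hb0 : 0 < |b| := abs_pos.2 hb
  have hcc : 0 < |c - c'| := abs_pos.2 (sub_ne_zero.2 hc)
  have hM0 : 0 < M := by positivity
  have hη : 0 < 1 / (4 * M) := by positivity
  set η := 1 / (4 * M) with hηdef
  have hηM : η * M = 1 / 4 := by rw [hηdef]; field_simp
  refine ⟨η, hη.ne', Real.toNNReal (M / (η * (|c - c'| * |b|))), ?_⟩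
  rintro ⟨x, y⟩ ⟨hx, hy⟩ ⟨x', y'⟩ ⟨hx', hy'⟩
  simp only at hx hy hx' hy'
  rw [edist_nndist, edist_nndist, ← ENNReal.coe_mul, ENNReal.coe_le_coe, ← NNReal.coe_le_coe]
  push_cast
  rw [Real.coe_toNNReal _ (by positivity), dist_eq_norm, dist_eq_norm]
  have e1 : leafHom b c (η * x) + leafHom b c' (η * y) -
      (leafHom b c (η * x') + leafHom b c' (η * y')) =
      (((η * (b * ((x - x') + (y - y'))) : ℝ) : Circ),
        ((η * (c * (x - x') + c' * (y - y')) : ℝ) : Circ)) := by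
    rw [add_sub_add_comm, ← map_sub, ← map_sub, leafHom_apply, leafHom_apply, Prod.mk_add_mk,
      ← AddCircle.coe_add, ← AddCircle.coe_add]
    congr 3 <;> ring
  rw [e1]
  have hu : |x - x'| ≤ 1 := abs_sub_le_of_le_of_le hx.1 hx.2 hx'.1 hx'.2 |>.trans (by norm_num)
  have hv : |y - y'| ≤ 1 := abs_sub_le_of_le_of_le hy.1 hy.2 hy'.1 hy'.2 |>.trans (by norm_num)
  rw [Prod.norm_def, Prod.norm_def]
  simp only [Prod.mk_sub_mk, Real.norm_eq_abs]
  set u := x - x'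
  set v := y - y'
  have h1 : |b * (u + v)| ≤ 2 * M := by
    rw [abs_mul]
    calc |b| * |u + v| ≤ M * (1 + 1) := by
          gcongr
          · rw [hM]; linarith [abs_nonneg c, abs_nonneg c']
          · exact (abs_add_le _ _).trans (add_le_add hu hv)
      _ = 2 * M := by ring
  have h2 : |c * u + c' * v| ≤ 2 * M := by
    refine (abs_add_le _ _).trans ?_
    rw [abs_mul, abs_mul]
    have := mul_le_of_le_one_right (abs_nonneg c) hu
    have := mul_le_of_le_one_right (abs_nonneg c') hv
    linarith [abs_nonneg c, abs_nonneg c']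
  have h1' : |η * (b * (u + v))| ≤ 1 / 2 := by
    rw [abs_mul, abs_of_pos hη]; nlinarith
  have h2' : |η * (c * u + c' * v)| ≤ 1 / 2 := by
    rw [abs_mul, abs_of_pos hη]; nlinarith
  rw [UnitAddCircle.norm_coe_eq_abs h1', UnitAddCircle.norm_coe_eq_abs h2', abs_mul η,
    abs_mul η, abs_of_pos hη, ← mul_max_of_nonneg _ _ hη.le]
  set R := max |b * (u + v)| |c * u + c' * v| with hR
  have hR1 : |b * (u + v)| ≤ R := le_max_left _ _
  have hR2 : |c * u + c' * v| ≤ R := le_max_right _ _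
  have hR0 : 0 ≤ R := (abs_nonneg _).trans hR1
  have e2 : M / (η * (|c - c'| * |b|)) * (η * R) = M * R / (|c - c'| * |b|) := by
    field_simp
  rw [e2, le_div_iff₀ (by positivity), max_mul_of_nonneg _ _ (by positivity)]
  have key : ∀ (e w : ℝ), |e| + |b| ≤ M →
      (c - c') * b * w = b * (c * u + c' * v) - e * (b * (u + v)) ∨
      (c - c') * b * w = e * (b * (u + v)) - b * (c * u + c' * v) →
      |w| * (|c - c'| * |b|) ≤ M * R := by
    intro e w he hw
    have h3 : |w| * (|c - c'| * |b|) = |b * (c * u + c' * v) - e * (b * (u + v))| := by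
      rw [← abs_mul, ← abs_mul, mul_comm]
      rcases hw with hw | hw
      · rw [hw]
      · rw [hw, abs_sub_comm]
    rw [h3]
    refine (abs_sub _ _).trans ?_
    rw [abs_mul b (c * u + c' * v), abs_mul e]
    calc _ ≤ |b| * R + |e| * R := by gcongr
      _ = (|e| + |b|) * R := by ring
      _ ≤ M * R := by gcongr
  refine max_le (key c' u ?_ ?_) (key c v ?_ ?_)
  · rw [hM]; linarith [abs_nonneg c]
  · left; ring
  · rw [hM]; linarith [abs_nonneg c']
  · right; ring

lemma notMem_closure_range_of_eventually_far {X : Type*} [MetricSpace X] {z : ℤ → X} {s : X} {δ : ℝ}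
    (hδ : 0 < δ) {N : ℕ} (hfar : ∀ k : ℤ, (N : ℤ) ≤ |k| → δ ≤ dist (z k) s)
    (hne : ∀ k, z k ≠ s) : s ∉ closure (range z) := by
  have hcl : IsClosed (z '' (Icc (-(N : ℤ)) N) ∪ {q | δ ≤ dist q s}) :=
    ((finite_Icc _ _).image z).isClosed.union
      (isClosed_le continuous_const (continuous_id.dist continuous_const))
  have hsub : range z ⊆ z '' (Icc (-(N : ℤ)) N) ∪ {q | δ ≤ dist q s} := by
    rintro _ ⟨k, rfl⟩
    rcases le_or_gt (N : ℤ) |k| with h | h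
    · exact Or.inr (hfar k h)
    · exact Or.inl ⟨k, abs_le.1 h.le, rfl⟩
  intro hs
  rcases closure_minimal hsub hcl hs with ⟨k, -, hk⟩ | h
  · exact hne k hk
  · have h : δ ≤ dist s s := h
    rw [dist_self] at h
    linarith

lemma Tmat_mul (α β : SL2Z) (x : Torus2) : Tmat (α * β) x = Tmat α (Tmat β x) := by
  simp only [Tmat, torusEndo, Matrix.SpecialLinearGroup.coe_mul, Matrix.mul_apply,
    Fin.sum_univ_two, smul_add, add_smul, mul_smul]
  ext1 <;> abel_nf

lemma Tmat_one (x : Torus2) : Tmat 1 x = x := by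
  simp [Tmat, torusEndo]

lemma Tmat_add (α : SL2Z) (x y : Torus2) : Tmat α (x + y) = Tmat α x + Tmat α y := by
  simp only [Tmat, torusEndo, Prod.fst_add, Prod.snd_add, smul_add]
  ext1 <;> simp only [Prod.fst_add, Prod.snd_add] <;> abel

lemma Tmat_injective (α : SL2Z) : Function.Injective (Tmat α) := by
  refine Function.LeftInverse.injective (g := Tmat α⁻¹) fun x ↦ ?_
  rw [← Tmat_mul, inv_mul_cancel, Tmat_one]

lemma Tmat_zpow_equivariant {α : SL2Z} {φ : ℝ → Torus2} {μ : ℝ} (hμ : μ ≠ 0)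
    (h : ∀ t, Tmat α (φ t) = φ (μ * t)) (k : ℤ) (t : ℝ) :
    Tmat (α ^ k) (φ t) = φ (μ ^ k * t) := by
  have hnat : ∀ (n : ℕ) (t : ℝ), Tmat (α ^ n) (φ t) = φ (μ ^ n * t) := by
    intro n
    induction n with
    | zero => intro t; simp [Tmat_one]
    | succ n ih => intro t; rw [pow_succ', Tmat_mul, ih, h, pow_succ', mul_assoc]
  obtain ⟨n, rfl | rfl⟩ := k.eq_nat_or_neg
  · simpa using hnat n t
  · have e : φ t = Tmat (α ^ n) (φ (μ ^ (-(n : ℤ)) * t)) := by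
      rw [hnat, _root_.zpow_neg, zpow_natCast, mul_inv_cancel_left₀ (pow_ne_zero _ hμ)]
    rw [e, ← Tmat_mul, _root_.zpow_neg, zpow_natCast, inv_mul_cancel, Tmat_one]

lemma Tmat_leafHom {α : SL2Z} {b c μ : ℝ} (h0 : (α 0 0 : ℝ) * b + (α 0 1 : ℝ) * c = μ * b)
    (h1 : (α 1 0 : ℝ) * b + (α 1 1 : ℝ) * c = μ * c) (t : ℝ) :
    Tmat α (leafHom b c t) = leafHom b c (μ * t) := by
  simp only [Tmat, torusEndo, leafHom_apply, ← AddCircle.coe_zsmul, ← AddCircle.coe_add]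
  congr 2
  · rw [zsmul_eq_mul, zsmul_eq_mul]; linear_combination t * h0
  · rw [zsmul_eq_mul, zsmul_eq_mul]; linear_combination t * h1

/-- A hyperbolic element of `SL₂(ℤ)` expands one transversal direction and contracts another. -/
lemma IsHyperbolic.exists_eigenvectors {α : SL2Z} (hα : _root_.IsHyperbolic α) :
    ∃ l b c c' : ℝ, 1 < |l| ∧ b ≠ 0 ∧ c ≠ c' ∧
      (∀ t, Tmat α (leafHom b c t) = leafHom b c (l * t)) ∧
      ∀ t, Tmat α (leafHom b c' t) = leafHom b c' (l⁻¹ * t) := by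
  have hdet : (α 0 0) * (α 1 1) - (α 0 1) * (α 1 0) = 1 := by
    have := α.det_coe
    rwa [Matrix.det_fin_two] at this
  have htr : 2 < |α 0 0 + α 1 1| := by
    rw [← Matrix.trace_fin_two]
    exact hα
  have hb : α 0 1 ≠ 0 := by
    intro h
    rw [h, zero_mul, sub_zero] at hdet
    rcases Int.eq_one_or_neg_one_of_mul_eq_one' hdet with h | h <;>
      rw [h.1, h.2] at htr <;> norm_num at htr
  have hdetR : (α 0 0 : ℝ) * (α 1 1) - (α 0 1) * (α 1 0) = 1 := by exact_mod_cast hdet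
  have htrR : 2 < |(α 0 0 + α 1 1 : ℝ)| := by exact_mod_cast htr
  obtain ⟨l, hl, hroot⟩ : ∃ l : ℝ, 1 < |l| ∧ l ^ 2 - (α 0 0 + α 1 1) * l + 1 = 0 := by
    set τ : ℝ := α 0 0 + α 1 1
    have hsq : 0 ≤ τ ^ 2 - 4 := by nlinarith [sq_abs τ]
    have hs := Real.sq_sqrt hsq
    have hs0 := Real.sqrt_nonneg (τ ^ 2 - 4)
    rcases lt_abs.1 htrR with h | h
    · refine ⟨(τ + √(τ ^ 2 - 4)) / 2, lt_abs.2 (Or.inl (by linarith)), by linarith⟩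
    · refine ⟨(τ - √(τ ^ 2 - 4)) / 2, lt_abs.2 (Or.inr (by linarith)), by linarith⟩
  have hl0 : l ≠ 0 := by rintro rfl; norm_num at hl
  have hroot' : l⁻¹ ^ 2 - (α 0 0 + α 1 1) * l⁻¹ + 1 = 0 := by
    field_simp
    linarith
  refine ⟨l, α 0 1, l - α 0 0, l⁻¹ - α 0 0, hl, by exact_mod_cast hb, ?_,
    Tmat_leafHom (by ring) (by linear_combination -hdetR - hroot),
    Tmat_leafHom (by ring) (by linear_combination -hdetR - hroot')⟩
  intro h
  have h1 : l = l⁻¹ := by linarith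
  have h2 := congrArg abs h1
  rw [abs_inv] at h2
  exact absurd (h2.trans_lt (inv_lt_one_of_one_lt₀ hl)) (not_lt.2 hl.le)

lemma countable_setOf_orbit_meets (α : SL2Z) {S : Set Torus2} (hS : S.Finite) :
    {p : Torus2 | ∃ k : ℤ, Tmat (α ^ k) p ∈ S}.Countable := by
  have : {p : Torus2 | ∃ k : ℤ, Tmat (α ^ k) p ∈ S} = ⋃ k : ℤ, Tmat (α ^ k) ⁻¹' S := by
    ext; simp
  rw [this]
  exact countable_iUnion fun k ↦ hS.countable.preimage_of_injOn (Tmat_injective _).injOn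

lemma eventually_far_add {l ε : ℝ} (hl : 1 < |l|) (hε : 0 < ε) {φ ψ : ℝ →+ Torus2}
    (hψ : Continuous ψ) {x y : ℝ} {S : Set Torus2}
    (h : ∀ m : ℕ, ∀ s ∈ S, ε ≤ dist (φ (l ^ m * x)) s) :
    ∀ᶠ m : ℕ in atTop, ∀ s ∈ S, ε / 2 ≤ dist (φ (l ^ m * x) + ψ (l⁻¹ ^ m * y)) s := by
  have hl' : |l⁻¹| < 1 := by rw [abs_inv]; exact inv_lt_one_of_one_lt₀ hl
  have hlim : Tendsto (fun m : ℕ ↦ ‖ψ (l⁻¹ ^ m * y)‖) atTop (𝓝 0) := by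
    have h1 := (tendsto_pow_atTop_nhds_zero_of_abs_lt_one hl').mul_const y
    rw [zero_mul] at h1
    have h2 := ((hψ.tendsto 0).comp h1).norm
    rwa [map_zero, norm_zero] at h2
  filter_upwards [hlim.eventually_lt_const (half_pos hε)] with m hm s hs
  have h1 := h m s hs
  have h2 := dist_triangle_left (φ (l ^ m * x)) s (φ (l ^ m * x) + ψ (l⁻¹ ^ m * y))
  rw [dist_eq_norm (φ (l ^ m * x) + ψ (l⁻¹ ^ m * y)) (φ (l ^ m * x)), add_sub_cancel_left] at h2
  linarith

lemma two_mul_le_dimH_orbit_closure_avoiding {α : SL2Z} (hα : IsHyperbolic α)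
    {S : Set Torus2} (hS : S.Finite) {d : ℝ≥0} (hd0 : 0 < d) (hd1 : d < 1) :
    2 * (d : ℝ≥0∞) ≤ dimH {s : Torus2 |
      closure (Set.range fun k : ℤ => Tmat (α ^ k) s) ∩ S = ∅} := by
  obtain ⟨l, b, c, c', hl, hb, hc, hφ, hψ⟩ := hα.exists_eigenvectors
  have hl0 : l ≠ 0 := by rintro rfl; norm_num at hl
  have hl' : |l⁻¹| < 1 := by rw [abs_inv]; exact inv_lt_one_of_one_lt₀ hl
  have hφk := Tmat_zpow_equivariant hl0 hφ
  have hψk := Tmat_zpow_equivariant (inv_ne_zero hl0) hψ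
  have hφi : Function.Injective (leafHom b c) := by
    refine leafHom_injective_of_contraction hb (inv_ne_zero hl0) hl' fun t ht ↦ ?_
    have := hφk (-1) t
    rw [ht, zpow_neg_one l] at this
    rw [← this]
    simp [Tmat, torusEndo]
  have hψi : Function.Injective (leafHom b c') := by
    refine leafHom_injective_of_contraction hb (inv_ne_zero hl0) hl' fun t ht ↦ ?_
    rw [← hψ, ht]
    simp [Tmat, torusEndo]
  obtain ⟨η, hη, K, hK⟩ := exists_antilipschitz_leaf_chart hb hc
  let φ' := (leafHom b c).comp (AddMonoidHom.mulLeft η)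
  let ψ' := (leafHom b c').comp (AddMonoidHom.mulLeft η)
  have hφ'c : Continuous φ' := (continuous_leafHom b c).comp (continuous_const.mul continuous_id)
  have hψ'c : Continuous ψ' := (continuous_leafHom b c').comp (continuous_const.mul continuous_id)
  obtain ⟨A, f, C₁, ε₁, hA, hε₁, hAS, hf, hfA⟩ := exists_holder_surjection_orbit_avoiding φ'
    hφ'c (hφi.comp (mul_right_injective₀ hη)) hl hS hd0 hd1
  obtain ⟨B, g, C₂, ε₂, hB, hε₂, hBS, hg, hgB⟩ := exists_holder_surjection_orbit_avoiding ψ'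
    hψ'c (hψi.comp (mul_right_injective₀ hη)) hl hS hd0 hd1
  let F : ℝ × ℝ → Torus2 := fun p ↦ φ' p.1 + ψ' p.2
  have hsub : F '' (A ×ˢ B) ⊆
      {s : Torus2 | closure (Set.range fun k : ℤ => Tmat (α ^ k) s) ∩ S = ∅} ∪
        {p : Torus2 | ∃ k : ℤ, Tmat (α ^ k) p ∈ S} := by
    rintro _ ⟨⟨x, y⟩, ⟨hx, hy⟩, rfl⟩
    rw [mem_union, or_iff_not_imp_right]
    intro hne
    simp only [mem_ofPred_eq, not_exists] at hne
    have horb : ∀ k : ℤ, Tmat (α ^ k) (F (x, y)) = φ' (l ^ k * x) + ψ' (l⁻¹ ^ k * y) := by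
      intro k
      simp only [F, φ', ψ', AddMonoidHom.comp_apply, AddMonoidHom.coe_mulLeft]
      rw [Tmat_add, hφk, hψk, mul_left_comm, mul_left_comm _ η y]
    have h1 := eventually_far_add hl hε₁ hψ'c (y := y) (hAS x hx)
    have h2 := eventually_far_add hl hε₂ hφ'c (y := x) (hBS y hy)
    obtain ⟨N, hN⟩ := eventually_atTop.1 (h1.and h2)
    refine eq_empty_of_forall_notMem fun s hs ↦ ?_
    refine notMem_closure_range_of_eventually_far (δ := min (ε₁ / 2) (ε₂ / 2)) (N := N)
      (by positivity) (fun k hk ↦ ?_) (fun k hk ↦ hne k ?_) hs.1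
    rotate_left
    · have hk : Tmat (α ^ k) (F (x, y)) = s := hk
      rw [hk]
      exact hs.2
    rw [horb]
    obtain ⟨n, rfl | rfl⟩ := k.eq_nat_or_neg
    · have := (hN n (by simpa using hk)).1 s hs.2
      rw [zpow_natCast, zpow_natCast]
      exact (min_le_left _ _).trans this
    · have := (hN n (by simpa using hk)).2 s hs.2
      rw [_root_.inv_zpow', neg_neg, _root_.zpow_neg, zpow_natCast, ← inv_pow, add_comm]
      exact (min_le_right _ _).trans this
  calc 2 * (d : ℝ≥0∞) ≤ dimH (A ×ˢ B) := two_mul_le_dimH_prod hd0 hf hg hfA hgB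
    _ ≤ dimH (F '' (A ×ˢ B)) := dimH_le_dimH_image_of_antilipschitzOn fun p hp q hq ↦
      hK p (prod_mono hA hB hp) q (prod_mono hA hB hq)
    _ ≤ _ := dimH_mono hsub
    _ = _ := by
      rw [dimH_union, dimH_countable (countable_setOf_orbit_meets α hS)]
      exact max_eq_left zero_le

theorem nondense_toral_automorphism_full_dim (α : SL2Z) (hα : IsHyperbolic α)
    (S : Set Torus2) (hS : S.Finite) :
    dimH {s : Torus2 |
      closure (Set.range fun k : ℤ => Tmat (α ^ k) s) ∩ S = ∅} = 2 := by
  refine le_antisymm ((dimH_mono (subset_univ _)).trans dimH_univ_torus_le) ?_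
  refine le_of_forall_lt fun a ha ↦ ?_
  have h1 : a / 2 < ((1 : ℝ≥0) : ℝ≥0∞) := by
    rw [ENNReal.div_lt_iff (by simp) (by simp)]
    simpa using ha
  obtain ⟨d, hd, hd1⟩ := ENNReal.lt_iff_exists_nnreal_btwn.1 h1
  have hd0 : 0 < d := by exact_mod_cast zero_le.trans_lt hd
  refine lt_of_lt_of_le ?_ (two_mul_le_dimH_orbit_closure_avoiding hα hS hd0
    (by exact_mod_cast hd1))
  rw [ENNReal.div_lt_iff (by simp) (by simp)] at hd
  rwa [mul_comm]
end
end

section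
/- Let n ∈ ℤ, n ≥ 2, let t₀ > 0 and g = diag(e^{t₀}, e^{−t₀}) ∈ SL₂(ℝ). If s ∈ ℝ is such that the closure of {gᵏ·h₂(s) : k ∈ ℕ} equals X₂, then the closure of {gᵏ·h₂(n·s) : k ∈ ℕ} also equals X₂. (That is, the set D(g, X₂) := {s ∈ ℝ : the forward g-orbit of h₂(s) is dense in X₂} is invariant under multiplication by n.) -/
open MeasureTheory Matrix Filter Set
open scoped ENNReal

noncomputable section

/-- Topology on special linear groups (induced from the matrix topology). -/
instance (n : Type*) [DecidableEq n] [Fintype n] (R : Type*) [CommRing R] [TopologicalSpace R] :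
    TopologicalSpace (Matrix.SpecialLinearGroup n R) :=
  TopologicalSpace.induced (fun A => (A : Matrix n n R)) inferInstance

abbrev SL2R := Matrix.SpecialLinearGroup (Fin 2) ℝ
/-- The image of `SL₂(ℤ)` in `SL₂(ℝ)`. -/
def SL2Zsub : Subgroup SL2R :=
  MonoidHom.range (Matrix.SpecialLinearGroup.map (n := Fin 2) (Int.castRingHom ℝ))

/-- The space of unimodular lattices `X₂ = SL₂(ℝ)/SL₂(ℤ)`. -/
abbrev X2 := SL2R ⧸ SL2Zsub

/-- `h₂(s)` is the class of the matrix `[[1, s], [0, 1]]` in `X₂`. -/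
def h2 (s : ℝ) : X2 :=
  QuotientGroup.mk ⟨!![(1:ℝ), s; 0, 1], by simp [Matrix.det_fin_two_of]⟩

/-- The diagonal matrix `diag(e^t, e^{-t}) ∈ SL₂(ℝ)`. -/
def g2 (t : ℝ) : SL2R :=
  ⟨!![Real.exp t, 0; 0, Real.exp (-t)], by
    simp [Matrix.det_fin_two_of, ← Real.exp_add]⟩

instance : IsTopologicalGroup SL2R := by
  have h : (inferInstance : TopologicalSpace SL2R) =
    Matrix.SpecialLinearGroup.instTopologicalSpace := rfl
  change @IsTopologicalGroup SL2R inferInstance _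
  rw [h]
  infer_instance

theorem SL2R.mul_apply (A B : SL2R) (i j : Fin 2) :
    (A * B) i j = A i 0 * B 0 j + A i 1 * B 1 j := by
  simp [Matrix.mul_apply]

/-- The homomorphism `SL₂(ℤ) → SL₂(ℝ)`. -/
abbrev toSL2R : SL2Z →* SL2R :=
  Matrix.SpecialLinearGroup.map (n := Fin 2) (Int.castRingHom ℝ)

/-- The upper unipotent matrix `[[1, s], [0, 1]]`. -/
def upperUnipotent {R : Type*} [CommRing R] (s : R) : Matrix.SpecialLinearGroup (Fin 2) R :=
  ⟨!![1, s; 0, 1], by simp [Matrix.det_fin_two_of]⟩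

/-- The set of matrices `gᵏ x γ` with `k ∈ ℕ` and `γ ∈ Γ`. -/
def orbitSet (Γ : Subgroup SL2Z) (t : ℝ) (x : SL2R) : Set SL2R :=
  {M | ∃ k : ℕ, ∃ γ ∈ Γ, M = g2 t ^ k * x * toSL2R γ}

theorem SL2R.tendsto_iff {α : Type*} {l : Filter α} {f : α → SL2R} {A : SL2R} :
    Tendsto f l (nhds A) ↔ ∀ i j, Tendsto (fun a => f a i j) l (nhds (A i j)) := by
  have h : Topology.IsInducing (fun A : SL2R => (A : Matrix (Fin 2) (Fin 2) ℝ)) := ⟨rfl⟩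
  rw [h.tendsto_nhds_iff]
  exact tendsto_pi_nhds.trans (forall_congr' fun i => tendsto_pi_nhds)

theorem toSL2R_apply (γ : SL2Z) (i j : Fin 2) : toSL2R γ i j = (γ i j : ℝ) := by
  simp

theorem g2_pow (t : ℝ) (k : ℕ) : g2 t ^ k = g2 (k * t) := by
  induction k with
  | zero =>
    ext i j
    rw [pow_zero]
    fin_cases i <;> fin_cases j <;> simp [g2]
  | succ k ih =>
    rw [pow_succ, ih]
    ext i j
    rw [SL2R.mul_apply]
    fin_cases i <;> fin_cases j <;>
      simp [g2, ← Real.exp_add] <;> ring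

theorem tendsto_fract_mul_zero {α : Type*} {l : Filter α} (a : α → ℝ) {c : α → ℝ}
    (hc : Tendsto c l (nhds 0)) : Tendsto (fun k => Int.fract (a k) * c k) l (nhds 0) := by
  refine squeeze_zero_norm (a := fun k => ‖c k‖) (fun k => ?_) (by simpa using hc.norm)
  rw [norm_mul]
  refine mul_le_of_le_one_left (norm_nonneg _) ?_
  rw [Real.norm_of_nonneg (Int.fract_nonneg _)]
  exact (Int.fract_lt_one _).le

theorem tendsto_floor_div_pow {N : ℕ} (hN : 2 ≤ N) (y : ℝ) :
    Tendsto (fun j : ℕ => ((N * ⌊(N : ℝ) ^ j * y⌋ + 1 : ℤ) : ℝ) / (N : ℝ) ^ (j + 1)) atTop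
      (nhds y) := by
  have hN1 : (1 : ℝ) < N := by exact_mod_cast hN
  have hN0 : (N : ℝ) ≠ 0 := by positivity
  have hpow : Tendsto (fun j : ℕ => (N : ℝ) ^ j) atTop atTop :=
    tendsto_pow_atTop_atTop_of_one_lt hN1
  have h1 := (tendsto_fract_mul_zero (fun j : ℕ => (N : ℝ) ^ j * y)
    hpow.inv_tendsto_atTop).const_sub y
  have h2 : Tendsto (fun j : ℕ => ((N : ℝ) ^ (j + 1))⁻¹) atTop (nhds 0) :=
    (hpow.comp (tendsto_add_atTop_nat 1)).inv_tendsto_atTop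
  have h3 := h1.add h2
  rw [sub_zero, add_zero] at h3
  refine h3.congr fun j => ?_
  simp only [Int.fract, Pi.inv_apply]
  push_cast
  field_simp
  ring

/-- The matrices sent by `Γ₀(N)` to upper triangular ones are dense. -/
theorem dense_upperTriangular_mul_Gamma0 {N : ℕ} (hN : 2 ≤ N) :
    Dense {M : SL2R | ∃ γ ∈ CongruenceSubgroup.Gamma0 N, (M * toSL2R γ) 1 0 = 0} := by
  intro M
  by_cases hc : M 1 0 = 0
  · exact subset_closure ⟨1, one_mem _, by simpa using hc⟩
  have hlim := tendsto_floor_div_pow hN (-(M 1 1 / M 1 0))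
  set y : ℝ := -(M 1 1 / M 1 0) with hy
  set α : ℕ → ℤ := fun j => N * ⌊(N : ℝ) ^ j * y⌋ + 1 with hα
  have hN0 : (N : ℝ) ≠ 0 := by positivity
  refine mem_closure_of_tendsto (b := atTop)
    (f := fun j : ℕ => M * upperUnipotent (y - (α j : ℝ) / (N : ℝ) ^ (j + 1))) ?_
    (Eventually.of_forall fun j => ?_)
  · have hu : Tendsto (fun j : ℕ => (upperUnipotent (y - (α j : ℝ) / (N : ℝ) ^ (j + 1)) : SL2R))
        atTop (nhds 1) := by
      rw [SL2R.tendsto_iff]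
      intro i j
      fin_cases i <;> fin_cases j <;> simp [upperUnipotent]
      simpa [hα] using (tendsto_const_nhds (x := y)).sub hlim
    simpa using tendsto_const_nhds.mul hu
  · have hcop : IsCoprime (α j) ((N : ℤ) ^ (j + 1)) := by
      apply IsCoprime.pow_right
      exact ⟨1, -⌊(N : ℝ) ^ j * y⌋, by simp only [hα]; ring⟩
    obtain ⟨γ, h0, h1⟩ := hcop.exists_SL2_col 0
    refine ⟨γ, ?_, ?_⟩
    · rw [CongruenceSubgroup.Gamma0_mem, h1]
      simp
    · simp only [SL2R.mul_apply]
      simp [upperUnipotent, h0, h1]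
      simp only [hy]
      field_simp
      ring

/-- Matrices with vanishing upper left entry are connected to upper triangular matrices by
the flow, up to integral upper unipotent matrices. -/
theorem exists_tendsto_g2_pow {t : ℝ} (ht : 0 < t) {u v : SL2R} (hu : u 0 0 = 0)
    (hv : v 1 0 = 0) :
    ∃ (f : ℕ → SL2R) (m : ℕ → ℤ), Tendsto f atTop (nhds u) ∧
      Tendsto (fun k => g2 t ^ k * f k * upperUnipotent (m k : ℝ)) atTop (nhds v) := by
  have hud : u 0 1 * u 1 0 = -1 := by
    have := u.det_coe
    rw [Matrix.det_fin_two, hu] at this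
    linarith
  have hvd : v 0 0 * v 1 1 = 1 := by
    have := v.det_coe
    rw [Matrix.det_fin_two, hv] at this
    linarith
  set p := u 0 1 with hp
  set q := u 1 1 with hq
  set r := v 0 0 with hr
  set b := v 0 1 with hb
  have hp0 : p ≠ 0 := by rintro h; simp [h] at hud
  have hr0 : r ≠ 0 := by rintro h; simp [h] at hvd
  set L : ℕ → ℝ := fun k => Real.exp (k * t) with hL
  have hLpos : ∀ k, 0 < L k := fun k => Real.exp_pos _
  have hLtop : Tendsto L atTop atTop :=
    Real.tendsto_exp_atTop.comp (tendsto_natCast_atTop_atTop.atTop_mul_const ht)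
  have hLinv : Tendsto (fun k => (L k)⁻¹) atTop (nhds 0) := hLtop.inv_tendsto_atTop
  set m : ℕ → ℤ := fun k => ⌊(b - p * L k) / r⌋ with hm
  set y : ℕ → ℝ := fun k => (b - m k * r) / L k with hy
  have hylim : Tendsto y atTop (nhds p) := by
    have h0 : Tendsto (fun k => r * (L k)⁻¹) atTop (nhds 0) := by
      simpa using hLinv.const_mul r
    have hz := tendsto_fract_mul_zero (fun k => (b - p * L k) / r) h0
    have h1 := hz.const_add p
    rw [add_zero] at h1
    refine h1.congr fun k => ?_
    have := (hLpos k).ne'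
    simp only [hy, hm, Int.fract]
    field_simp
    ring
  have hy0 : ∀ᶠ k in atTop, y k ≠ 0 := hylim.eventually_ne hp0
  set e : ℕ → ℝ := fun k => (r * q * (L k)⁻¹ - 1) / y k * (L k)⁻¹ with he
  have hLe : Tendsto (fun k => (r * q * (L k)⁻¹ - 1) / y k) atTop (nhds (u 1 0)) := by
    have h1 : Tendsto (fun k => (r * q * (L k)⁻¹ - 1) / y k) atTop
        (nhds ((r * q * 0 - 1) / p)) := ((hLinv.const_mul (r * q)).sub_const 1).div hylim hp0
    convert h1 using 2
    field_simp
    linarith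
  have helim : Tendsto e atTop (nhds 0) := by simpa using hLe.mul hLinv
  let w : ℕ → SL2R := fun k => ⟨!![r, b; e k, (1 + b * e k) / r], by
    rw [Matrix.det_fin_two_of]; field_simp; ring⟩
  have hw : Tendsto w atTop (nhds v) := by
    rw [SL2R.tendsto_iff]
    intro i j
    fin_cases i <;> fin_cases j <;> simp [w, ← hr, ← hb, hv, helim]
    have h1 : Tendsto (fun k => (1 + b * e k) / r) atTop (nhds ((1 + b * 0) / r)) :=
      ((helim.const_mul b).const_add 1).div_const r
    convert h1 using 2
    field_simp
    linarith
  refine ⟨fun k => g2 (-(k * t)) * w k * upperUnipotent (-(m k : ℝ)), m, ?_, ?_⟩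
  · rw [SL2R.tendsto_iff]
    intro i j
    simp only [SL2R.mul_apply]
    fin_cases i <;> fin_cases j <;>
      simp [w, g2, upperUnipotent, hu, ← hp, ← hq]
    · simpa [hL, Real.exp_neg] using hLinv.mul_const r
    · refine hylim.congr fun k => ?_
      simp only [hy, hL, Real.exp_neg]
      field_simp
      ring
    · refine hLe.congr fun k => ?_
      have := (hLpos k).ne'
      simp only [he]
      change _ = L k * _
      field_simp
    · refine (tendsto_const_nhds (x := q)).congr' ?_
      filter_upwards [hy0] with k hk
      have hLk := (hLpos k).ne'
      change _ = -(L k * e k * m k) + L k * _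
      have hey : e k * (b - m k * r) = r * q * (L k)⁻¹ - 1 := by
        have : b - m k * r = y k * L k := by simp only [hy]; field_simp
        rw [this]
        simp only [he]
        field_simp
      have h2 : -(L k * e k * m k) + L k * ((1 + b * e k) / r)
          = L k * (1 + e k * (b - m k * r)) / r := by
        field_simp
        ring
      rw [h2, hey]
      field_simp
      ring
  · refine hw.congr fun k => ?_
    rw [g2_pow]
    have h1 : g2 (k * t) * g2 (-(k * t)) = 1 := by
      ext i j
      rw [SL2R.mul_apply]
      fin_cases i <;> fin_cases j <;> simp [g2, ← Real.exp_add]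
    have h2 : (upperUnipotent (-(m k : ℝ)) * upperUnipotent (m k : ℝ) : SL2R) = 1 := by
      ext i j
      rw [SL2R.mul_apply]
      fin_cases i <;> fin_cases j <;> simp [upperUnipotent]
    rw [mul_assoc, mul_assoc, mul_assoc, h2, mul_one, ← mul_assoc, h1, one_mul]

/-- Topological transitivity of the forward diagonal flow on `SL₂(ℝ) / Γ₀(N)`. -/
theorem exists_g2_pow_mul_mem {N : ℕ} (hN : 2 ≤ N) {t : ℝ} (ht : 0 < t) {U V : Set SL2R}
    (hU : IsOpen U) (hU' : U.Nonempty) (hV : IsOpen V) (hV' : V.Nonempty) :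
    ∃ k : ℕ, ∃ u ∈ U, ∃ γ ∈ CongruenceSubgroup.Gamma0 N, g2 t ^ k * u * toSL2R γ ∈ V := by
  let J : SL2R := ⟨!![0, -1; 1, 0], by simp [Matrix.det_fin_two_of]⟩
  have hJ : ∀ M : SL2R, (J * M) 1 0 = M 0 0 := fun M => by
    rw [SL2R.mul_apply]; simp [J]
  have hD := dense_upperTriangular_mul_Gamma0 hN
  obtain ⟨v, hvV, γ₂, hγ₂, hv⟩ := hD.inter_open_nonempty V hV hV'
  obtain ⟨u, huU, γ₁, hγ₁, hu⟩ := (hD.preimage (isOpenMap_mul_left J)).inter_open_nonempty U hU hU'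
  rw [mul_assoc, hJ] at hu
  obtain ⟨f, m, hf, hg⟩ := exists_tendsto_g2_pow ht hu hv
  have hf' := (hf.mul_const (toSL2R γ₁)⁻¹).eventually_mem (hU.mem_nhds (by simpa using huU))
  have hg' := (hg.mul_const (toSL2R γ₂)⁻¹).eventually_mem (hV.mem_nhds (by simpa using hvV))
  obtain ⟨k, hk, hk'⟩ := (hf'.and hg').exists
  refine ⟨k, _, hk, γ₁ * upperUnipotent (m k) * γ₂⁻¹, ?_, ?_⟩
  · refine mul_mem (mul_mem hγ₁ ?_) (inv_mem hγ₂)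
    rw [CongruenceSubgroup.Gamma0_mem]
    simp [upperUnipotent]
  · have h : toSL2R (upperUnipotent (m k)) = upperUnipotent (m k : ℝ) := by
      ext i j
      rw [toSL2R_apply]
      fin_cases i <;> fin_cases j <;> simp [upperUnipotent]
    rw [map_mul, map_mul, map_inv, h]
    convert hk' using 1
    group

theorem exists_interior_nonempty_of_finite_iUnion {X ι : Type*} [TopologicalSpace X] [Nonempty X]
    [Finite ι] {s : ι → Set X} (hc : ∀ i, IsClosed (s i)) (h : ⋃ i, s i = univ) :
    ∃ i, (interior (s i)).Nonempty := by
  by_contra! hs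
  have key : ∀ T : Set ι, T.Finite → interior (⋃ i ∈ T, s i) = ∅ := by
    intro T hT
    induction T, hT using Set.Finite.induction_on with
    | empty => simp
    | insert _ _ ih =>
      rw [biUnion_insert, interior_union_isClosed_of_interior_empty (hc _) ih, hs]
  have h1 := key univ finite_univ
  rw [biUnion_univ, h, interior_univ] at h1
  exact univ_nonempty.ne_empty h1

/-- A forward orbit that is dense modulo `SL₂(ℤ)` is dense modulo `Γ₀(N)`. -/
theorem dense_orbitSet_Gamma0 {N : ℕ} (hN : 2 ≤ N) {t : ℝ} (ht : 0 < t) {x : SL2R}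
    (hx : Dense (orbitSet ⊤ t x)) :
    Dense (orbitSet (CongruenceSubgroup.Gamma0 N) t x) := by
  set Γ := CongruenceSubgroup.Gamma0 N with hΓ
  have : NeZero N := ⟨by omega⟩
  have : Finite (SL2Z ⧸ Γ) := Subgroup.finite_quotient_of_finiteIndex
  have hcover : ⋃ c : SL2Z ⧸ Γ,
      (Homeomorph.mulRight (toSL2R c.out)) ⁻¹' closure (orbitSet Γ t x) = univ := by
    rw [eq_univ_iff_forall]
    refine fun M => closure_minimal ?_
      (isClosed_iUnion_of_finite fun c => isClosed_closure.preimage (Homeomorph.continuous _))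
      (hx M)
    rintro _ ⟨k, γ, -, rfl⟩
    obtain ⟨δ, hδ⟩ := QuotientGroup.mk_out_eq_mul Γ γ⁻¹
    refine mem_iUnion.2 ⟨(γ⁻¹ : SL2Z), subset_closure ⟨k, δ, δ.2, ?_⟩⟩
    rw [hδ]
    simp [mul_assoc]
  obtain ⟨c, hc⟩ := exists_interior_nonempty_of_finite_iUnion
    (fun c => isClosed_closure.preimage (Homeomorph.continuous _)) hcover
  rw [← Homeomorph.preimage_interior] at hc
  have hU : (interior (closure (orbitSet Γ t x))).Nonempty := hc.elim fun _ h => ⟨_, h⟩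
  rw [dense_iff_inter_open]
  intro V hV hV'
  obtain ⟨k, u, hu, γ, hγ, hmem⟩ := exists_g2_pow_mul_mem hN ht isOpen_interior hU hV hV'
  have hcl : g2 t ^ k * u * toSL2R γ ∈ closure (orbitSet Γ t x) := by
    refine map_mem_closure (f := fun M => g2 t ^ k * M * toSL2R γ) (by fun_prop)
      (interior_subset hu) ?_
    rintro _ ⟨l, δ, hδ, rfl⟩
    exact ⟨k + l, δ * γ, mul_mem hδ hγ, by simp [pow_add, mul_assoc]⟩
  exact mem_closure_iff.1 hcl V hV hmem

theorem closure_range_h2_eq_univ_iff (t s : ℝ) :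
    closure (Set.range fun k : ℕ => g2 t ^ k • h2 s) = Set.univ ↔
      Dense (orbitSet ⊤ t (upperUnipotent s)) := by
  have hpre : orbitSet ⊤ t (upperUnipotent s) =
      (QuotientGroup.mk : SL2R → X2) ⁻¹' (Set.range fun k : ℕ => g2 t ^ k • h2 s) := by
    ext M
    constructor
    · rintro ⟨k, γ, -, rfl⟩
      refine ⟨k, ?_⟩
      change (QuotientGroup.mk (g2 t ^ k * upperUnipotent s) : X2) = _
      rw [QuotientGroup.eq]
      exact ⟨γ, by simp [mul_assoc]⟩
    · rintro ⟨k, hk⟩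
      change (QuotientGroup.mk (g2 t ^ k * upperUnipotent s) : X2) = _ at hk
      rw [QuotientGroup.eq] at hk
      obtain ⟨γ, hγ⟩ := hk
      exact ⟨k, γ, trivial, by rw [toSL2R, hγ]; simp [mul_assoc]⟩
  rw [← dense_iff_closure_eq, hpre]
  refine ⟨fun h => h.preimage QuotientGroup.isOpenMap_coe, fun h => ?_⟩
  have := QuotientGroup.mk_surjective.denseRange.dense_image
    (QuotientGroup.continuous_mk (N := SL2Zsub)) h
  rwa [image_preimage_eq _ QuotientGroup.mk_surjective] at this

/-- Conjugation by `diag(√N, 1/√N)` maps `orbitSet Γ₀(N)` of `[[1, s], [0, 1]]` to the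
`SL₂(ℤ)`-orbit set of `[[1, N s], [0, 1]]`. -/
theorem conj_mem_orbitSet {N : ℕ} (hN : 0 < N) (t s : ℝ) {M : SL2R}
    (hM : M ∈ orbitSet (CongruenceSubgroup.Gamma0 N) t (upperUnipotent s)) :
    g2 (Real.log N / 2) * M * (g2 (Real.log N / 2))⁻¹ ∈
      orbitSet ⊤ t (upperUnipotent (N * s)) := by
  obtain ⟨k, γ, hγ, rfl⟩ := hM
  rw [CongruenceSubgroup.Gamma0_mem, ZMod.intCast_zmod_eq_zero_iff_dvd] at hγ
  obtain ⟨c, hc⟩ := hγ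
  have hdet := γ.det_coe
  rw [Matrix.det_fin_two, hc] at hdet
  let δ : SL2Z := ⟨!![γ 0 0, N * γ 0 1; c, γ 1 1], by
    rw [Matrix.det_fin_two_of]; linarith⟩
  have hexp : Real.exp (Real.log N / 2) * Real.exp (Real.log N / 2) = N := by
    rw [← Real.exp_add, add_halves, Real.exp_log (by positivity)]
  refine ⟨k, δ, trivial, ?_⟩
  set ρ := Real.log N / 2
  have hcR : (γ 1 0 : ℝ) = N * c := by exact_mod_cast congrArg (Int.cast : ℤ → ℝ) hc
  rw [mul_inv_eq_iff_eq_mul, g2_pow]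
  ext i j
  simp only [SL2R.mul_apply, toSL2R_apply]
  fin_cases i <;> fin_cases j <;> simp [g2, upperUnipotent, δ, hcR, Real.exp_neg] <;>
    (try rw [← hexp]) <;> field_simp
theorem dense_orbit_invariant_times_n (n : ℤ) (hn : 2 ≤ n) (t₀ : ℝ) (ht₀ : 0 < t₀) (s : ℝ)
    (hs : closure (Set.range fun k : ℕ => (g2 t₀) ^ k • h2 s) = Set.univ) :
    closure (Set.range fun k : ℕ => (g2 t₀) ^ k • h2 ((n : ℝ) * s)) = Set.univ := by
  lift n to ℕ using by omega with N
  rw [closure_range_h2_eq_univ_iff] at hs ⊢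
  have hN : 2 ≤ N := by exact_mod_cast hn
  have hd := dense_orbitSet_Gamma0 hN ht₀ hs
  let φ := MulAut.conj (g2 (Real.log N / 2))
  have hφ : Continuous φ := by
    change Continuous fun M => g2 (Real.log N / 2) * M * (g2 (Real.log N / 2))⁻¹
    fun_prop
  refine (φ.surjective.denseRange.dense_image hφ hd).mono ?_
  rintro _ ⟨M, hM, rfl⟩
  exact conj_mem_orbitSet (by omega) t₀ s hM
end
end
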